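/- Let n ≥ 2, let M be a connected n-manifold without boundary, let X be a closed subset of M, and let μ be a good Radon measure on M. Then 𝓗_X(M;μ) is an ℓ₂-manifold if and only if 𝓗_X(M;μ) is an ANR and X ≠ M. -/

import Mathlib

open MeasureTheory TopologicalSpace

universe u

/-- The set of `μ`-preserving homeomorphisms of `M` fixing `X` pointwise,
as a subset of `C(M, M)` (compact-open topology). -/
def MPHomeoFixSet (M : Type*) [TopologicalSpace M] [MeasurableSpace M]
    (X : Set M) (μ : Measure M) : Set C(M, M) :=
  {f | IsHomeomorph f ∧ (∀ x ∈ X, f x = x) ∧ Measure.map f μ = μ}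

/-- The separable Hilbert space `ℓ₂` of square-summable real sequences. -/
noncomputable abbrev ell2 : Type := lp (fun _ : ℕ => ℝ) 2

/-- A space is an `ℓ₂`-manifold if it is separable metrizable and locally homeomorphic
to open subsets of `ℓ₂`. -/
def IsL2Manifold (X : Type*) [TopologicalSpace X] : Prop :=
  SeparableSpace X ∧ MetrizableSpace X ∧
    ∀ x : X, ∃ U : Set X, IsOpen U ∧ x ∈ U ∧
      ∃ V : Set ell2, IsOpen V ∧ Nonempty (↥U ≃ₜ ↥V)

/-- `X` is an absolute neighborhood retract. -/
def IsANR (X : Type u) [TopologicalSpace X] : Prop :=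
  MetrizableSpace X ∧
    ∀ (Y : Type u) [TopologicalSpace Y], MetrizableSpace Y →
      ∀ B : Set Y, IsClosed B → ∀ f : C(B, X),
        ∃ (U : Set Y) (_ : IsOpen U) (hBU : B ⊆ U) (g : C(U, X)),
          ∀ b : B, g ⟨b.1, hBU b.2⟩ = f b

section

open Filter Topology

open scoped ZeroAtInfty

section ZeroAtInftyNat

variable {X E : Type*} [TopologicalSpace X] [NormedAddCommGroup E]

/-- A map into `C₀(ℕ, E)` with continuous coordinates and locally uniformly small tails is
continuous. -/
theorem ZeroAtInftyContinuousMap.continuousAt_of_tails {F : X → C₀(ℕ, E)} {x : X}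
    (hc : ∀ n, ContinuousAt (fun y => F y n) x)
    (ht : ∀ ε > 0, ∃ N, ∀ᶠ y in 𝓝 x, ∀ n ≥ N, ‖F y n‖ ≤ ε) : ContinuousAt F x := by
  rw [Metric.continuousAt_iff']
  intro ε hε
  obtain ⟨N, hN⟩ := ht (ε / 4) (by positivity)
  have h1 : ∀ᶠ y in 𝓝 x, ∀ n ∈ Finset.range N, dist (F y n) (F x n) < ε / 2 := by
    rw [Filter.eventually_all_finset]
    intro n _
    exact Metric.continuousAt_iff'.1 (hc n) _ (by positivity)
  filter_upwards [hN, h1] with y hy h1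
  have hx := hN.self_of_nhds
  rw [← ZeroAtInftyContinuousMap.dist_toBCF_eq_dist]
  refine lt_of_le_of_lt ((BoundedContinuousFunction.dist_le (by positivity : 0 ≤ ε / 2)).2 ?_)
    (half_lt_self hε)
  intro n
  by_cases hn : n < N
  · exact (h1 n (Finset.mem_range.2 hn)).le
  · have := hy n (not_lt.1 hn)
    have := hx n (not_lt.1 hn)
    change dist (F y n) (F x n) ≤ ε / 2
    rw [dist_eq_norm]
    linarith [norm_sub_le (F y n) (F x n)]

theorem ZeroAtInftyContinuousMap.norm_apply_le {α : Type*} [TopologicalSpace α] (f : C₀(α, E))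
    (a : α) : ‖f a‖ ≤ ‖f‖ := by
  rw [← ZeroAtInftyContinuousMap.norm_toBCF_eq_norm]
  exact f.toBCF.norm_coe_le_norm a

theorem ZeroAtInftyContinuousMap.norm_le_of_forall {α : Type*} [TopologicalSpace α] {f : C₀(α, E)}
    {C : ℝ} (hC : 0 ≤ C) (h : ∀ a, ‖f a‖ ≤ C) : ‖f‖ ≤ C := by
  rw [← ZeroAtInftyContinuousMap.norm_toBCF_eq_norm]
  exact (BoundedContinuousFunction.norm_le hC).2 h

theorem ZeroAtInftyContinuousMap.continuous_apply {α : Type*} [TopologicalSpace α] (a : α) :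
    Continuous (fun f : C₀(α, E) => f a) :=
  LipschitzWith.continuous (K := 1) <| LipschitzWith.of_dist_le_mul fun f g => by
    simpa [dist_eq_norm] using (f - g).norm_apply_le a

/-- A sequence tending to zero, as an element of `C₀(ℕ, E)`. -/
def ZeroAtInftyContinuousMap.ofTendsto (f : ℕ → E) (h : Tendsto f atTop (𝓝 0)) : C₀(ℕ, E) where
  toFun := f
  continuous_toFun := continuous_of_discreteTopology
  zero_at_infty' := by rwa [cocompact_eq_cofinite, Nat.cofinite_eq_atTop]

@[simp] theorem ZeroAtInftyContinuousMap.ofTendsto_apply (f : ℕ → E) (h) (n : ℕ) :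
    ZeroAtInftyContinuousMap.ofTendsto f h n = f n := rfl

theorem ZeroAtInftyContinuousMap.tendsto_atTop (f : C₀(ℕ, E)) : Tendsto f atTop (𝓝 0) := by
  simpa only [cocompact_eq_cofinite, Nat.cofinite_eq_atTop] using zero_at_infty f

end ZeroAtInftyNat

namespace CZeroHomeo

/-- The summable weights `2⁻ⁿ`. -/
noncomputable def wt (n : ℕ) : ℝ := (1 / 2) ^ n

theorem wt_pos (n : ℕ) : 0 < wt n := by unfold wt; positivity

theorem sum_wt_le (n m : ℕ) : ∑ j ∈ Finset.range m, wt (n + j) ≤ 2 := by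
  have h : ∀ j, wt (n + j) ≤ wt j := fun j => by
    unfold wt
    exact pow_le_pow_of_le_one (by norm_num) (by norm_num) (by omega)
  refine (Finset.sum_le_sum fun j _ => h j).trans ?_
  exact (Summable.sum_le_tsum _ (fun _ _ => (wt_pos _).le) summable_geometric_two).trans
    tsum_geometric_two.le

/-- The partial expressions whose supremum is the tail gauge. -/
noncomputable def part (x : ℕ → ℝ) (n m : ℕ) : ℝ :=
  |x (n + m)| + ∑ j ∈ Finset.range m, wt (n + j) * |x (n + j)|

/-- The strictly monotone tail gauge `sup_m (|x (n+m)| + ∑_{j<m} 2^{-(n+j)} |x (n+j)|)`. -/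
noncomputable def gauge (x : ℕ → ℝ) (n : ℕ) : ℝ := ⨆ m, part x n m

theorem part_le {x : ℕ → ℝ} {n : ℕ} {B : ℝ} (hB : ∀ k ≥ n, |x k| ≤ B) (m : ℕ) :
    part x n m ≤ 3 * B := by
  have hB0 : 0 ≤ B := (abs_nonneg _).trans (hB n le_rfl)
  have h1 := hB (n + m) (by omega)
  have h2 : ∑ j ∈ Finset.range m, wt (n + j) * |x (n + j)| ≤ ∑ j ∈ Finset.range m, wt (n + j) * B :=
    Finset.sum_le_sum fun j _ => mul_le_mul_of_nonneg_left (hB _ (by omega)) (wt_pos _).le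
  rw [← Finset.sum_mul] at h2
  have := mul_le_mul_of_nonneg_right (sum_wt_le n m) hB0
  unfold part
  linarith

theorem gauge_le {x : ℕ → ℝ} {n : ℕ} {B : ℝ} (hB : ∀ k ≥ n, |x k| ≤ B) : gauge x n ≤ 3 * B :=
  ciSup_le (part_le hB)

theorem bddAbove_part (x : C₀(ℕ, ℝ)) (n : ℕ) : BddAbove (Set.range (part x n)) :=
  ⟨3 * ‖x‖, by rintro _ ⟨m, rfl⟩; exact part_le (fun k _ => x.norm_apply_le k) m⟩

theorem gauge_rec (x : C₀(ℕ, ℝ)) (n : ℕ) :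
    gauge x n = max |x n| (wt n * |x n| + gauge x (n + 1)) := by
  have hs : ∀ m, part x n (m + 1) = wt n * |x n| + part x (n + 1) m := by
    intro m
    simp only [part, Finset.sum_range_succ', add_zero]
    have : ∀ j, n + (j + 1) = n + 1 + j := by intro j; omega
    rw [this m, Finset.sum_congr rfl fun j _ => by rw [this j]]
    ring
  have h0 : part x n 0 = |x n| := by simp [part]
  apply le_antisymm
  · refine ciSup_le fun m => ?_
    cases m with
    | zero => rw [h0]; exact le_max_left _ _
    | succ m =>
      rw [hs]
      exact le_max_of_le_right (by gcongr; exact le_ciSup (bddAbove_part x _) m)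
  · refine max_le (h0 ▸ le_ciSup (bddAbove_part x n) 0) ?_
    have : gauge x (n + 1) ≤ gauge x n - wt n * |x n| := ciSup_le fun m => by
      have := le_ciSup (bddAbove_part x n) (m + 1)
      rw [hs] at this
      unfold gauge
      linarith
    linarith

theorem abs_le_gauge (x : C₀(ℕ, ℝ)) (n : ℕ) : |x n| ≤ gauge x n :=
  gauge_rec x n ▸ le_max_left _ _

theorem gauge_nonneg (x : C₀(ℕ, ℝ)) (n : ℕ) : 0 ≤ gauge x n :=
  (abs_nonneg _).trans (abs_le_gauge x n)

theorem gauge_add_le (x : C₀(ℕ, ℝ)) (n : ℕ) : wt n * |x n| + gauge x (n + 1) ≤ gauge x n :=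
  (gauge_rec x n).symm ▸ le_max_right _ _

theorem gauge_le_add (x y : C₀(ℕ, ℝ)) (n : ℕ) : gauge x n ≤ gauge y n + 3 * ‖x - y‖ := by
  refine ciSup_le fun m => ?_
  have h1 : part x n m ≤ part y n m + part (x - y : C₀(ℕ, ℝ)) n m := by
    have h : ∀ k, |x k| ≤ |y k| + |(x - y : C₀(ℕ, ℝ)) k| := fun k => by
      have := abs_add_le (y k) (x k - y k)
      simpa using this
    unfold part
    have := Finset.sum_le_sum (s := Finset.range m) fun j _ =>
      mul_le_mul_of_nonneg_left (h (n + j)) (wt_pos (n + j)).le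
    simp only [mul_add, Finset.sum_add_distrib] at this
    linarith [h (n + m)]
  have h2 := le_ciSup (bddAbove_part y n) m
  have h3 := part_le (x := (x - y : C₀(ℕ, ℝ))) (n := n)
    (fun k _ => (x - y).norm_apply_le k) m
  unfold gauge
  linarith

theorem continuous_gauge (n : ℕ) : Continuous fun x : C₀(ℕ, ℝ) => gauge x n := by
  refine LipschitzWith.continuous (K := 3) (LipschitzWith.of_dist_le_mul fun x y => ?_)
  rw [Real.dist_eq, abs_le, dist_eq_norm]
  have h1 := gauge_le_add x y n
  have h2 := gauge_le_add y x n
  rw [norm_sub_rev] at h2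
  push_cast
  constructor <;> linarith

theorem tendsto_gauge (x : C₀(ℕ, ℝ)) : Tendsto (gauge x) atTop (𝓝 0) := by
  rw [Metric.tendsto_atTop]
  intro ε hε
  obtain ⟨N, hN⟩ := Metric.tendsto_atTop.1 x.tendsto_atTop (ε / 4) (by positivity)
  refine ⟨N, fun n hn => ?_⟩
  have := gauge_le (x := x) (n := n) (B := ε / 4) fun k hk => by
    have := hN k (hn.trans hk)
    rw [dist_zero_right] at this
    exact this.le
  rw [dist_zero_right, Real.norm_of_nonneg (gauge_nonneg x n)]
  linarith

theorem continuous_sign_mul {X : Type*} [TopologicalSpace X] {f g : X → ℝ} (hf : Continuous f)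
    (hg : Continuous g) (h : ∀ x, f x = 0 → g x = 0) :
    Continuous fun x => Real.sign (f x) * g x := by
  rw [continuous_iff_continuousAt]
  intro x
  rcases lt_trichotomy (f x) 0 with hx | hx | hx
  · refine (hg.continuousAt.neg).congr ?_
    filter_upwards [hf.continuousAt.eventually_lt continuousAt_const hx] with y hy
    simp [Real.sign_of_neg hy]
  · have h0 := h x hx
    rw [ContinuousAt, show Real.sign (f x) * g x = 0 by rw [h0, mul_zero]]
    refine squeeze_zero_norm (a := fun y => |g y|) (fun y => ?_) ?_
    · rw [norm_mul, Real.norm_eq_abs, Real.norm_eq_abs]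
      rcases Real.sign_apply_eq (f y) with h | h | h <;> simp [h]
    · have := (hg.abs).continuousAt (x := x)
      simpa [ContinuousAt, h0] using this
  · refine hg.continuousAt.congr ?_
    filter_upwards [continuousAt_const.eventually_lt hf.continuousAt hx] with y hy
    simp [Real.sign_of_pos hy]

/-- Coordinates of the image in `ℓ₂`. -/
noncomputable def toSeq (x : C₀(ℕ, ℝ)) (n : ℕ) : ℝ :=
  Real.sign (x n) * √(gauge x n ^ 2 - gauge x (n + 1) ^ 2)

theorem gauge_succ_le (x : C₀(ℕ, ℝ)) (n : ℕ) : gauge x (n + 1) ≤ gauge x n := by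
  have := gauge_add_le x n
  have := mul_nonneg (wt_pos n).le (abs_nonneg (x n))
  linarith

theorem gauge_sq_sub_nonneg (x : C₀(ℕ, ℝ)) (n : ℕ) :
    0 ≤ gauge x n ^ 2 - gauge x (n + 1) ^ 2 := by
  have := gauge_succ_le x n
  have := gauge_nonneg x (n + 1)
  nlinarith

theorem gauge_eq_of_eq_zero {x : C₀(ℕ, ℝ)} {n : ℕ} (h : x n = 0) :
    gauge x n = gauge x (n + 1) := by
  rw [gauge_rec, h]
  simp [gauge_nonneg]

theorem toSeq_sq (x : C₀(ℕ, ℝ)) (n : ℕ) :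
    toSeq x n ^ 2 = gauge x n ^ 2 - gauge x (n + 1) ^ 2 := by
  unfold toSeq
  rw [mul_pow, Real.sq_sqrt (gauge_sq_sub_nonneg x n)]
  rcases eq_or_ne (x n) 0 with h | h
  · simp [h, gauge_eq_of_eq_zero h]
  · rcases Real.sign_apply_eq_of_ne_zero _ h with h | h <;> simp [h]

theorem sum_toSeq_sq (x : C₀(ℕ, ℝ)) (n : ℕ) :
    ∑ j ∈ Finset.range n, toSeq x j ^ 2 = gauge x 0 ^ 2 - gauge x n ^ 2 := by
  simp_rw [toSeq_sq]
  exact Finset.sum_range_sub' (fun n => gauge x n ^ 2) n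

theorem hasSum_toSeq_sq (x : C₀(ℕ, ℝ)) : HasSum (fun n => toSeq x n ^ 2) (gauge x 0 ^ 2) := by
  rw [hasSum_iff_tendsto_nat_of_nonneg (fun _ => sq_nonneg _)]
  simp_rw [sum_toSeq_sq]
  simpa using ((tendsto_gauge x).pow 2).const_sub (gauge x 0 ^ 2)

theorem ell2_norm_sq (y : ell2) : HasSum (fun n => y n ^ 2) (‖y‖ ^ 2) := by
  have := lp.hasSum_norm (p := 2) (by norm_num) y
  simpa using this

/-- The map `c₀ → ℓ₂`. -/
noncomputable def toEll2 (x : C₀(ℕ, ℝ)) : ell2 :=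
  ⟨toSeq x, memℓp_gen (by simpa using (hasSum_toSeq_sq x).summable)⟩

theorem toEll2_apply (x : C₀(ℕ, ℝ)) (n : ℕ) : toEll2 x n = toSeq x n := rfl

theorem norm_toEll2_sq (x : C₀(ℕ, ℝ)) : ‖toEll2 x‖ ^ 2 = gauge x 0 ^ 2 :=
  (ell2_norm_sq _).unique (hasSum_toSeq_sq x)

theorem continuous_to_ell2 {X : Type*} [TopologicalSpace X] {F : X → ell2}
    (hc : ∀ n, Continuous fun x => F x n) (hn : Continuous fun x => ‖F x‖ ^ 2) :
    Continuous F := by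
  rw [continuous_iff_continuousAt]
  intro x
  rw [Metric.continuousAt_iff']
  intro ε hε
  obtain ⟨s, hs⟩ := (Metric.tendsto_nhds.1 (lp.hasSum_single (p := 2) (by norm_num) (F x))
    (ε / 2) (by positivity)).exists
  set z : ell2 := ∑ i ∈ s, lp.single 2 i (F x i : ℝ) with hz
  have hin : ∀ y, ‖F y - z‖ ^ 2 = ‖F y‖ ^ 2 - 2 * ∑ i ∈ s, F x i * F y i + ‖z‖ ^ 2 := by
    intro y
    rw [norm_sub_sq_real, hz, inner_sum]
    congr 3
    refine Finset.sum_congr rfl fun i _ => ?_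
    rw [lp.inner_single_right]
    simp
  have hcont : Continuous fun y => ‖F y - z‖ ^ 2 := by
    simp_rw [hin]
    exact ((hn.sub (continuous_const.mul
      (continuous_finsetSum _ fun i _ => continuous_const.mul (hc i)))).add continuous_const)
  have hx : ‖F x - z‖ ^ 2 < (ε / 2) ^ 2 := by
    rw [dist_comm, dist_eq_norm] at hs
    gcongr
  filter_upwards [hcont.continuousAt.eventually_lt continuousAt_const hx] with y hy
  have h1 : dist (F y) z < ε / 2 := by
    rw [dist_eq_norm]; exact lt_of_pow_lt_pow_left₀ 2 (by positivity) hy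
  calc dist (F y) (F x) ≤ dist (F y) z + dist z (F x) := dist_triangle _ _ _
    _ < ε := by linarith

theorem continuous_toEll2 : Continuous toEll2 := by
  refine continuous_to_ell2 (fun n => ?_) ?_
  · refine continuous_sign_mul (ZeroAtInftyContinuousMap.continuous_apply n)
      (((continuous_gauge n).pow 2).sub ((continuous_gauge (n + 1)).pow 2)).sqrt fun x hx => ?_
    simp [gauge_eq_of_eq_zero hx]
  · simp_rw [norm_toEll2_sq]
    exact (continuous_gauge 0).pow 2

/-- Tail norms of an element of `ℓ₂`. -/
noncomputable def tail (y : ell2) (n : ℕ) : ℝ := √(‖y‖ ^ 2 - ∑ j ∈ Finset.range n, y j ^ 2)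

theorem tail_arg_nonneg (y : ell2) (n : ℕ) : 0 ≤ ‖y‖ ^ 2 - ∑ j ∈ Finset.range n, y j ^ 2 :=
  sub_nonneg.2 (sum_le_hasSum _ (fun _ _ => sq_nonneg _) (ell2_norm_sq y))

theorem tail_sq (y : ell2) (n : ℕ) : tail y n ^ 2 = y n ^ 2 + tail y (n + 1) ^ 2 := by
  unfold tail
  rw [Real.sq_sqrt (tail_arg_nonneg _ _), Real.sq_sqrt (tail_arg_nonneg _ _),
    Finset.sum_range_succ]
  ring

theorem tail_nonneg (y : ell2) (n : ℕ) : 0 ≤ tail y n := Real.sqrt_nonneg _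

theorem tail_succ_le (y : ell2) (n : ℕ) : tail y (n + 1) ≤ tail y n :=
  abs_le_of_sq_le_sq' (by nlinarith [tail_sq y n, sq_nonneg (y n)]) (tail_nonneg y n) |>.2

theorem continuous_tail (n : ℕ) : Continuous fun y => tail y n := by
  unfold tail
  refine ((continuous_norm.pow 2).sub (continuous_finsetSum _ fun i _ => ?_)).sqrt
  exact Continuous.pow (lp.evalCLM ℝ (fun _ : ℕ => ℝ) 2 i).continuous 2

theorem tendsto_tail (y : ell2) : Tendsto (tail y) atTop (𝓝 0) := by
  have := ((ell2_norm_sq y).tendsto_sum_nat.const_sub (‖y‖ ^ 2)).sqrt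
  rw [sub_self, Real.sqrt_zero] at this
  exact this

/-- Coordinates of the inverse. -/
noncomputable def invSeq (y : ell2) (n : ℕ) : ℝ :=
  Real.sign (y n) * min (tail y n) ((tail y n - tail y (n + 1)) / wt n)

theorem abs_sign_mul {a b : ℝ} (hb : 0 ≤ b) (h : a = 0 → b = 0) : |Real.sign a * b| = b := by
  rcases eq_or_ne a 0 with ha | ha
  · simp [ha, h ha]
  · rcases Real.sign_apply_eq_of_ne_zero _ ha with h | h <;> simp [h, abs_of_nonneg hb]

theorem abs_invSeq (y : ell2) (n : ℕ) :
    |invSeq y n| = min (tail y n) ((tail y n - tail y (n + 1)) / wt n) := by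
  refine abs_sign_mul (le_min (tail_nonneg _ _)
    (div_nonneg (sub_nonneg.2 (tail_succ_le y n)) (wt_pos n).le)) fun h => ?_
  have h2 : tail y n = tail y (n + 1) := by
    have := tail_sq y n
    rw [h] at this
    exact (sq_eq_sq₀ (tail_nonneg _ _) (tail_nonneg _ _)).1 (by linarith)
  rw [← h2]
  simp [tail_nonneg]

theorem abs_invSeq_le (y : ell2) (n : ℕ) : |invSeq y n| ≤ tail y n :=
  abs_invSeq y n ▸ min_le_left _ _

/-- The inverse map `ℓ₂ → c₀`. -/
noncomputable def ofEll2 (y : ell2) : C₀(ℕ, ℝ) :=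
  ZeroAtInftyContinuousMap.ofTendsto (invSeq y) <|
    squeeze_zero_norm (fun n => abs_invSeq_le y n) (tendsto_tail y)

theorem continuous_ofEll2 : Continuous ofEll2 := by
  rw [continuous_iff_continuousAt]
  intro y
  refine ZeroAtInftyContinuousMap.continuousAt_of_tails (fun n => Continuous.continuousAt ?_) ?_
  · refine continuous_sign_mul (lp.evalCLM ℝ (fun _ : ℕ => ℝ) 2 n).continuous ?_ fun z hz => ?_
    · exact (continuous_tail n).min
        (((continuous_tail n).sub (continuous_tail (n + 1))).div_const _)
    · have := abs_invSeq z n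
      rw [← this]
      have hz' : z n = 0 := hz
      simp [invSeq, hz']
  · intro ε hε
    obtain ⟨N, hN⟩ := ((tendsto_tail y).eventually_lt_const hε).exists
    refine ⟨N, ?_⟩
    filter_upwards [(continuous_tail N).continuousAt.eventually_lt continuousAt_const hN]
      with z hz n hn
    exact (abs_invSeq_le z n).trans
      ((antitone_nat_of_succ_le (tail_succ_le z) hn).trans hz.le)

theorem tail_toEll2 (x : C₀(ℕ, ℝ)) (n : ℕ) : tail (toEll2 x) n = gauge x n := by
  unfold tail
  simp_rw [norm_toEll2_sq, toEll2_apply, sum_toSeq_sq]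
  simp [gauge_nonneg]

theorem ofEll2_toEll2 (x : C₀(ℕ, ℝ)) : ofEll2 (toEll2 x) = x := by
  ext n
  change Real.sign (toSeq x n) * min (tail (toEll2 x) n)
    ((tail (toEll2 x) n - tail (toEll2 x) (n + 1)) / wt n) = x n
  rw [tail_toEll2, tail_toEll2]
  have hw := wt_pos n
  have hmin : min (gauge x n) ((gauge x n - gauge x (n + 1)) / wt n) = |x n| := by
    have h1 := abs_le_gauge x n
    have h2 := gauge_add_le x n
    have h3 : |x n| ≤ (gauge x n - gauge x (n + 1)) / wt n := by
      rw [le_div_iff₀ hw]; linarith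
    rcases max_choice |x n| (wt n * |x n| + gauge x (n + 1)) with h | h
    · rw [← gauge_rec] at h
      rw [min_eq_left (h ▸ h3), h]
    · rw [← gauge_rec] at h
      have : (gauge x n - gauge x (n + 1)) / wt n = |x n| := by
        rw [h]; field_simp; ring
      rw [this, min_eq_right h1]
  have hsign : Real.sign (toSeq x n) = Real.sign (x n) := by
    rcases eq_or_ne (x n) 0 with h | h
    · simp [toSeq, h]
    · have hlt : gauge x (n + 1) < gauge x n := by
        have := gauge_add_le x n
        have := mul_pos hw (abs_pos.2 h)
        linarith
      have : 0 < √(gauge x n ^ 2 - gauge x (n + 1) ^ 2) := by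
        apply Real.sqrt_pos.2
        nlinarith [gauge_nonneg x (n + 1)]
      unfold toSeq
      rcases lt_or_gt_of_ne h with h | h
      · rw [Real.sign_of_neg h, Real.sign_of_neg (by linarith)]
      · rw [Real.sign_of_pos h, Real.sign_of_pos (by linarith)]
  rw [hmin, hsign]
  rcases lt_trichotomy (x n) 0 with h | h | h
  · rw [Real.sign_of_neg h, abs_of_neg h]; ring
  · simp [h]
  · rw [Real.sign_of_pos h, abs_of_pos h]; ring

theorem tail_rec (y : ell2) (n : ℕ) :
    tail y n = max |ofEll2 y n| (wt n * |ofEll2 y n| + tail y (n + 1)) := by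
  have hw := wt_pos n
  change _ = max |invSeq y n| (wt n * |invSeq y n| + tail y (n + 1))
  rw [abs_invSeq]
  rcases le_total (tail y n) ((tail y n - tail y (n + 1)) / wt n) with h | h
  · rw [min_eq_left h]
    rw [le_div_iff₀ hw] at h
    rw [max_eq_left]; linarith
  · rw [min_eq_right h, mul_div_cancel₀ _ hw.ne', sub_add_cancel, max_eq_right h]

theorem gauge_ofEll2 (y : ell2) (n : ℕ) : gauge (ofEll2 y) n = tail y n := by
  have hstep : ∀ n, |gauge (ofEll2 y) n - tail y n| ≤
      |gauge (ofEll2 y) (n + 1) - tail y (n + 1)| := by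
    intro n
    rw [gauge_rec, tail_rec]
    refine (abs_max_sub_max_le_max _ _ _ _).trans ?_
    simp
  have hmono : Monotone fun n => |gauge (ofEll2 y) n - tail y n| := monotone_nat_of_le_succ hstep
  have hlim : Tendsto (fun n => |gauge (ofEll2 y) n - tail y n|) atTop (𝓝 0) := by
    simpa using ((tendsto_gauge (ofEll2 y)).sub (tendsto_tail y)).abs
  have := hmono.ge_of_tendsto hlim n
  exact sub_eq_zero.1 (abs_eq_zero.1 (le_antisymm this (abs_nonneg _)))

theorem toEll2_ofEll2 (y : ell2) : toEll2 (ofEll2 y) = y := by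
  ext n
  change Real.sign (invSeq y n) * √(gauge (ofEll2 y) n ^ 2 - gauge (ofEll2 y) (n + 1) ^ 2) = y n
  rw [gauge_ofEll2, gauge_ofEll2, tail_sq, add_sub_cancel_right, Real.sqrt_sq_eq_abs]
  rcases eq_or_ne (y n) 0 with h | h
  · simp [h]
  · have hlt : tail y (n + 1) < tail y n := by
      have := tail_sq y n
      have : 0 < y n ^ 2 := by positivity
      exact lt_of_pow_lt_pow_left₀ 2 (tail_nonneg y n) (by linarith)
    have hpos : 0 < min (tail y n) ((tail y n - tail y (n + 1)) / wt n) :=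
      lt_min ((tail_nonneg _ _).trans_lt hlt) (div_pos (sub_pos.2 hlt) (wt_pos n))
    unfold invSeq
    rcases lt_or_gt_of_ne h with h | h
    · rw [Real.sign_of_neg h, Real.sign_of_neg (by linarith), abs_of_neg h]; ring
    · rw [Real.sign_of_pos h, Real.sign_of_pos (by linarith), abs_of_pos h]; ring

/-- `c₀` and `ℓ₂` are homeomorphic. -/
noncomputable def homeoEll2 : C₀(ℕ, ℝ) ≃ₜ ell2 where
  toFun := toEll2
  invFun := ofEll2
  left_inv := ofEll2_toEll2
  right_inv := toEll2_ofEll2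
  continuous_toFun := continuous_toEll2
  continuous_invFun := continuous_ofEll2

end CZeroHomeo

end

section

open Filter Topology

/-- **Dugundji's extension theorem**, with control on the values off the closed set. -/
theorem ContinuousOn.exists_extension_mem_convexHull {Y E : Type*} [PseudoMetricSpace Y]
    [NormedAddCommGroup E] [NormedSpace ℝ E] {A : Set Y} (hA : IsClosed A) (hne : A.Nonempty)
    {f : Y → E} (hf : ContinuousOn f A) :
    ∃ F : Y → E, Continuous F ∧ Set.EqOn F f A ∧
      ∀ y ∉ A, F y ∈ convexHull ℝ (f '' (A ∩ Metric.ball y (3 * Metric.infDist y A))) := by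
  classical
  have hpos : ∀ y ∉ A, 0 < Metric.infDist y A := fun y hy =>
    (hA.notMem_iff_infDist_pos hne).1 hy
  obtain ⟨g, hg⟩ := exists_continuous_forall_mem_convex_of_local_const (X := ↥Aᶜ) (E := E)
    (t := fun y => convexHull ℝ (f '' (A ∩ Metric.ball y.1 (3 * Metric.infDist y.1 A))))
    (fun _ => convex_convexHull _ _) (fun y => by
      obtain ⟨a, haA, ha⟩ := (Metric.infDist_lt_iff hne (x := y.1)
        (r := 2 * Metric.infDist y.1 A)).1 (by linarith [hpos y.1 y.2])
      refine ⟨f a, ?_⟩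
      have h1 : ∀ᶠ z : ↥Aᶜ in 𝓝 y, dist z.1 a < 3 * Metric.infDist z.1 A := by
        refine ContinuousAt.eventually_lt (by fun_prop)
          (continuous_const.mul ((Metric.continuous_infDist_pt A).comp
            continuous_subtype_val)).continuousAt ?_
        have := hpos y.1 y.2
        change dist y.1 a < 3 * Metric.infDist y.1 A
        linarith
      filter_upwards [h1] with z hz
      exact subset_convexHull _ _ ⟨a, ⟨haA, by rwa [Metric.mem_ball, dist_comm]⟩, rfl⟩)
  set F : Y → E := fun y => if h : y ∈ A then f y else g ⟨y, h⟩ with hF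
  have hFA : ∀ y ∈ A, F y = f y := fun y hy => by simp [hF, hy]
  have hFn : ∀ y (hy : y ∉ A), F y = g ⟨y, hy⟩ := fun y hy => by simp [hF, hy]
  refine ⟨F, ?_, hFA, fun y hy => hFn y hy ▸ hg ⟨y, hy⟩⟩
  rw [continuous_iff_continuousAt]
  intro y
  by_cases hy : y ∈ A
  · rw [Metric.continuousAt_iff]
    intro ε hε
    obtain ⟨δ, hδ, hfδ⟩ := Metric.continuousOn_iff.1 hf y hy ε hε
    refine ⟨δ / 4, by positivity, fun {z} hz => ?_⟩
    rw [hFA y hy]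
    by_cases hzA : z ∈ A
    · rw [hFA z hzA]
      exact hfδ z hzA (by linarith)
    · have hsub : convexHull ℝ (f '' (A ∩ Metric.ball z (3 * Metric.infDist z A))) ⊆
          Metric.ball (f y) ε := by
        refine convexHull_min ?_ (convex_ball _ _)
        rintro _ ⟨a, ⟨haA, ha⟩, rfl⟩
        refine hfδ a haA ?_
        have h1 := Metric.infDist_le_dist_of_mem hy (x := z)
        have h2 := dist_triangle a z y
        rw [Metric.mem_ball] at ha
        linarith
      have := hsub (hg ⟨z, hzA⟩)
      rw [hFn z hzA]
      exact this
  · refine ContinuousOn.continuousAt (s := Aᶜ) ?_ (hA.isOpen_compl.mem_nhds hy)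
    rw [continuousOn_iff_continuous_domRestrict]
    have : Set.domRestrict Aᶜ F = g := by
      ext z
      exact hFn z.1 z.2
    rw [this]
    exact g.continuous

/-- `O` receives neighbourhood extensions of maps from closed subsets of the metrizable space
`Y`. -/
def NbhdExtends (Y : Type*) [TopologicalSpace Y] {Z : Type*} [TopologicalSpace Z]
    (O : Set Z) : Prop :=
  ∀ B : Set Y, IsClosed B → ∀ f : Y → Z, ContinuousOn f B → Set.MapsTo f B O →
    ∃ (U : Set Y) (g : Y → Z), IsOpen U ∧ B ⊆ U ∧ ContinuousOn g U ∧ Set.EqOn g f B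

theorem nbhdExtends_of_homeomorph {Y Z E : Type*} [PseudoMetricSpace Y] [TopologicalSpace Z]
    [NormedAddCommGroup E] [NormedSpace ℝ E] {O : Set Z} {V : Set E} (hV : IsOpen V)
    (e : O ≃ₜ V) : NbhdExtends Y O := by
  classical
  intro B hB f hf hfO
  rcases B.eq_empty_or_nonempty with rfl | hne
  · exact ⟨∅, f, isOpen_empty, subset_rfl, continuousOn_empty _, Set.eqOn_empty _ _⟩
  set φ : Y → E := fun y => if h : f y ∈ O then e ⟨f y, h⟩ else 0 with hφdef
  have hφ : ∀ y (h : f y ∈ O), φ y = e ⟨f y, h⟩ := fun y h => by simp [hφdef, h]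
  have hφc : ContinuousOn φ B := by
    rw [continuousOn_iff_continuous_domRestrict]
    have : B.domRestrict φ = fun b => (e ⟨f b.1, hfO b.2⟩ : E) := by
      ext b; exact hφ _ _
    rw [this]
    have h1 : Continuous fun b : B => (⟨f b.1, hfO b.2⟩ : O) :=
      (continuousOn_iff_continuous_domRestrict.1 hf).subtype_mk _
    exact continuous_subtype_val.comp (e.continuous.comp h1)
  obtain ⟨F, hFc, hFB, -⟩ := hφc.exists_extension_mem_convexHull hB hne
  refine ⟨F ⁻¹' V, fun y => if h : F y ∈ V then e.symm ⟨F y, h⟩ else f y, hV.preimage hFc,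
    fun b hb => ?_, ?_, fun b hb => ?_⟩
  · change F b ∈ V
    rw [hFB hb, hφ b (hfO hb)]
    exact Subtype.coe_prop _
  · rw [continuousOn_iff_continuous_domRestrict]
    have : (F ⁻¹' V).domRestrict (fun y => if h : F y ∈ V then (e.symm ⟨F y, h⟩ : Z) else f y) =
        fun b => (e.symm ⟨F b.1, b.2⟩ : Z) := by
      ext b
      exact dif_pos b.2
    rw [this]
    exact continuous_subtype_val.comp (e.symm.continuous.comp
      ((hFc.comp continuous_subtype_val).subtype_mk _))
  · have h1 : F b = e ⟨f b, hfO hb⟩ := (hFB hb).trans (hφ _ _)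
    simp [h1]

/-- **Hanner's theorem**: neighbourhood extensors glue along countable open covers. -/
theorem nbhdExtends_univ_of_countable_cover {Y Z : Type*} [PseudoMetricSpace Y]
    [TopologicalSpace Z] {O : ℕ → Set Z} (hO : ∀ i, IsOpen (O i)) (hcov : ⋃ i, O i = Set.univ)
    (hext : ∀ i, NbhdExtends Y (O i)) : NbhdExtends Y (Set.univ : Set Z) := by
  classical
  intro B hB f hf _
  -- a locally finite closed family `P i` adapted to the preimages of the `O i`
  obtain ⟨C, P, hPfin, hPcl, hCP, hBC, hPO⟩ : ∃ C P : ℕ → Set Y, LocallyFinite P ∧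
      (∀ i, IsClosed (P i)) ∧ (∀ i, IsClosed (C i) ∧ C i ⊆ interior (P i) ∧ C i ⊆ B) ∧
      B ⊆ ⋃ i, C i ∧ ∀ i, ∀ y ∈ B, y ∈ P i → f y ∈ O i := by
    have hG : ∀ i, ∃ G : Set Y, IsOpen G ∧ f ⁻¹' O i ∩ B = G ∩ B := fun i =>
      (continuousOn_iff'.1 hf (O i) (hO i))
    choose G hGo hGe using hG
    obtain ⟨v, hvo, hvc, hvf, hvs⟩ := precise_refinement
      (fun i : Option ℕ => i.elim Bᶜ G) (by
        rintro (_ | i)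
        exacts [hB.isOpen_compl, hGo i]) (by
        rw [Set.eq_univ_iff_forall]
        intro y
        by_cases hy : y ∈ B
        · obtain ⟨i, hi⟩ := Set.mem_iUnion.1 (hcov.symm ▸ Set.mem_univ (f y))
          have : y ∈ G i ∩ B := hGe i ▸ ⟨hi, hy⟩
          exact Set.mem_iUnion.2 ⟨some i, this.1⟩
        · exact Set.mem_iUnion.2 ⟨none, hy⟩)
    obtain ⟨w, hwc, hwo, hws⟩ := exists_iUnion_eq_closure_subset hvo
      (fun x => hvf.point_finite x) hvc
    obtain ⟨w', hwc', hwo', hws'⟩ := exists_iUnion_eq_closure_subset hwo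
      (fun x => (hvf.subset fun i => subset_closure.trans (hws i)).point_finite x) hwc
    refine ⟨fun i => closure (w' (some i)) ∩ B, fun i => closure (w (some i)), ?_,
      fun i => isClosed_closure, fun i => ⟨isClosed_closure.inter hB, ?_, Set.inter_subset_right⟩,
      ?_, ?_⟩
    · exact (hvf.subset hws).comp_injective (Option.some_injective ℕ)
    · exact Set.inter_subset_left.trans
        ((hws' _).trans (interior_maximal subset_closure (hwo _)))
    · intro b hb
      obtain ⟨i, hi⟩ := Set.mem_iUnion.1 (hwc'.symm ▸ Set.mem_univ b)
      rcases i with _ | i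
      · exact absurd hb (hvs none (hws none (subset_closure (hws' none (subset_closure hi)))))
      · exact Set.mem_iUnion.2 ⟨i, subset_closure hi, hb⟩
    · intro i y hy hyP
      have : y ∈ f ⁻¹' O i ∩ B := (hGe i).symm ▸ ⟨hvs _ (hws _ hyP), hy⟩
      exact this.1
  let Inv : Set Y × (Y → Z) → Prop := fun s => IsClosed s.1 ∧ ContinuousOn s.2 (B ∪ s.1) ∧
    Set.EqOn s.2 f B ∧ ∀ i, ∀ y ∈ B ∪ s.1, y ∈ P i → s.2 y ∈ O i
  have step : ∀ (n : ℕ) (s : {s // Inv s}), ∃ s' : {s // Inv s}, s.1.1 ⊆ s'.1.1 ∧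
      Set.EqOn s'.1.2 s.1.2 (B ∪ s.1.1) ∧ ∃ Q, IsClosed Q ∧ Q ⊆ P n ∧ C n ⊆ interior Q ∧
        s'.1.1 = s.1.1 ∪ Q := by
    rintro n ⟨⟨N, h⟩, hN, hc, hfB, hPi⟩
    dsimp only at hN hc hfB hPi ⊢
    obtain ⟨U, g, hU, hDU, hg, hgD⟩ := hext n ((B ∪ N) ∩ P n) ((hB.union hN).inter (hPcl n)) h
      (hc.mono Set.inter_subset_left) (fun y hy => hPi n y hy.1 hy.2)
    set S : Set Y := {y | y ∈ U ∧ y ∈ P n ∧ ∀ i, y ∈ P i → g y ∈ O i} with hS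
    have hCS : C n ⊆ interior S := by
      intro c hc'
      have hcB := (hCP n).2.2 hc'
      have hcP := (hCP n).2.1 hc'
      have hcD : c ∈ (B ∪ N) ∩ P n := ⟨Or.inl hcB, interior_subset hcP⟩
      rw [mem_interior_iff_mem_nhds]
      have h1 : U ∈ 𝓝 c := hU.mem_nhds (hDU hcD)
      have h2 : P n ∈ 𝓝 c := mem_interior_iff_mem_nhds.1 hcP
      have h3 : ∀ᶠ y in 𝓝 c, ∀ i, y ∈ P i → g y ∈ O i := by
        have h4 := hPfin.eventually_subset hPcl c
        have h5 : ∀ᶠ y in 𝓝 c, ∀ i ∈ {i | c ∈ P i}, g y ∈ O i := by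
          rw [Filter.eventually_all_finite (hPfin.point_finite c)]
          intro i hi
          refine (hg.continuousAt h1).eventually_mem ((hO i).mem_nhds ?_)
          rw [hgD hcD]
          exact hPi i c (Or.inl hcB) hi
        filter_upwards [h4, h5] with y h4 h5 i hi using h5 i (h4 hi)
      filter_upwards [h1, h2, h3] with y h1 h2 h3 using ⟨h1, h2, h3⟩
    obtain ⟨Q', hQ'o, hCQ', hQ'S⟩ := normal_exists_closure_subset (hCP n).1 isOpen_interior hCS
    set Q := closure Q' with hQ
    have hQS : Q ⊆ S := hQ'S.trans interior_subset
    set h' : Y → Z := fun y => if y ∈ B ∪ N then h y else g y with hh'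
    have heq : Set.EqOn h' h (B ∪ N) := fun y hy => if_pos hy
    have heqg : Set.EqOn h' g Q := fun y hy => by
      by_cases hyN : y ∈ B ∪ N
      · exact (if_pos hyN).trans (hgD ⟨hyN, (hQS hy).2.1⟩).symm
      · exact if_neg hyN
    refine ⟨⟨⟨N ∪ Q, h'⟩, hN.union isClosed_closure, ?_, fun b hb => ?_, ?_⟩,
      Set.subset_union_left, heq, Q, isClosed_closure, fun y hy => (hQS hy).2.1,
      hCQ'.trans (interior_maximal subset_closure hQ'o), rfl⟩
    · dsimp only
      rw [← Set.union_assoc]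
      exact (hc.congr heq).union_of_isClosed
        ((hg.mono fun y hy => (hQS hy).1).congr heqg) (hB.union hN) isClosed_closure
    · exact (heq (Or.inl hb)).trans (hfB hb)
    · rintro i y hy hyi
      dsimp only at hy ⊢
      rw [← Set.union_assoc] at hy
      rcases hy with hy | hy
      · rw [heq hy]; exact hPi i y hy hyi
      · rw [heqg hy]; exact (hQS hy).2.2 i hyi
  choose next hsub heq Q hQcl hQP hCQ hnext using step
  let st : ℕ → {s // Inv s} := fun n => n.rec ⟨⟨∅, f⟩, isClosed_empty, by simpa using hf,
    fun _ _ => rfl, by simpa using hPO⟩ next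
  have hst : ∀ n, st (n + 1) = next n (st n) := fun n => rfl
  let N : ℕ → Set Y := fun n => (st n).1.1
  let F : ℕ → Y → Z := fun n => (st n).1.2
  have hNmono : Monotone N := monotone_nat_of_le_succ fun n => hsub n (st n)
  have hFeq : ∀ k m, k ≤ m → Set.EqOn (F m) (F k) (B ∪ N k) := by
    intro k m hkm
    induction m, hkm using Nat.le_induction with
    | base => exact fun _ _ => rfl
    | succ m hkm ih =>
      intro y hy
      exact (heq m (st m) (Set.union_subset_union_right B (hNmono hkm) hy)).trans (ih hy)
  let R : ℕ → Set Y := fun n => Q n (st n)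
  have hRN : ∀ n, R n ⊆ N (n + 1) := fun n => by
    change R n ⊆ (next n (st n)).1.1
    rw [hnext]; exact Set.subset_union_right
  let Fl : Y → Z := fun y => if h : ∃ n, y ∈ N n then F (Nat.find h) y else f y
  have hFl : ∀ n, Set.EqOn Fl (F n) (N n) := by
    intro n y hy
    have h : ∃ n, y ∈ N n := ⟨n, hy⟩
    have : Fl y = F (Nat.find h) y := dif_pos h
    rw [this]
    exact (hFeq _ n (Nat.find_min' h hy) (Or.inr (Nat.find_spec h))).symm
  have hRfin : LocallyFinite R := hPfin.subset fun n => hQP n (st n)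
  have hcont : ContinuousOn Fl (⋃ n, R n) :=
    hRfin.continuousOn_iUnion (fun n => hQcl n (st n)) fun n =>
      ((st (n + 1)).2.2.1.mono ((hRN n).trans Set.subset_union_right)).congr
        ((hFl (n + 1)).mono (hRN n))
  have hBR : ∀ b ∈ B, ∃ n, b ∈ interior (R n) := fun b hb => by
    obtain ⟨n, hn⟩ := Set.mem_iUnion.1 (hBC hb)
    exact ⟨n, hCQ n (st n) hn⟩
  refine ⟨interior (⋃ n, R n), Fl, isOpen_interior, fun b hb => ?_,
    hcont.mono interior_subset, fun b hb => ?_⟩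
  · obtain ⟨n, hn⟩ := hBR b hb
    exact interior_mono (Set.subset_iUnion R n) hn
  · obtain ⟨n, hn⟩ := hBR b hb
    exact (hFl (n + 1) (hRN n (interior_subset hn))).trans ((st (n + 1)).2.2.2.1 hb)

end

section

open Filter Topology TopologicalSpace MeasureTheory

/-- An `ℓ₂`-manifold is an absolute neighbourhood retract. -/
theorem IsL2Manifold.isANR {X : Type u} [TopologicalSpace X] (h : IsL2Manifold X) : IsANR X := by
  classical
  obtain ⟨hsep, hmet, hloc⟩ := h
  refine ⟨hmet, fun Y _ hY B hB f => ?_⟩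
  rcases B.eq_empty_or_nonempty with rfl | ⟨b₀, hb₀⟩
  · exact ⟨∅, isOpen_empty, subset_rfl, ⟨fun y => absurd y.2 (Set.notMem_empty _),
      continuous_iff_continuousAt.2 fun y => absurd y.2 (Set.notMem_empty _)⟩,
      fun b => absurd b.2 (Set.notMem_empty _)⟩
  let _ := metrizableSpaceMetric Y
  let _ := metrizableSpaceMetric X
  have : SecondCountableTopology X := UniformSpace.secondCountable_of_separable X
  choose W hWo hxW V hVo hWV using hloc
  obtain ⟨s, hs, hsW⟩ := TopologicalSpace.countable_cover_nhds fun x => (hWo x).mem_nhds (hxW x)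
  have hsne : s.Nonempty := by
    by_contra hne
    rw [Set.not_nonempty_iff_eq_empty] at hne
    simp only [hne, Set.mem_empty_iff_false, Set.iUnion_of_empty, Set.iUnion_empty] at hsW
    exact (hsW ▸ Set.mem_univ (f ⟨b₀, hb₀⟩) : f ⟨b₀, hb₀⟩ ∈ (∅ : Set X))
  obtain ⟨e, he⟩ := hs.exists_eq_range hsne
  have key : NbhdExtends Y (Set.univ : Set X) := by
    refine nbhdExtends_univ_of_countable_cover (O := fun i => W (e i)) (fun i => hWo _) ?_
      fun i => nbhdExtends_of_homeomorph (hVo _) (hWV (e i)).some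
    rw [← hsW, he, Set.biUnion_range]
  set f' : Y → X := fun y => if h : y ∈ B then f ⟨y, h⟩ else f ⟨b₀, hb₀⟩ with hf'
  have hf'B : ∀ b : B, f' b = f b := fun b => by simp [hf']
  obtain ⟨U, g, hU, hBU, hg, hgf⟩ := key B hB f' (by
    rw [continuousOn_iff_continuous_domRestrict]
    have : B.domRestrict f' = f := funext hf'B
    rw [this]
    exact f.continuous) (Set.mapsTo_univ _ _)
  exact ⟨U, hU, hBU, ⟨U.domRestrict g, continuousOn_iff_continuous_domRestrict.1 hg⟩,
    fun b => (hgf b.2).trans (hf'B b)⟩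

theorem not_isL2Manifold_of_subsingleton {X : Type*} [TopologicalSpace X] [Subsingleton X]
    [Nonempty X] : ¬ IsL2Manifold X := by
  rintro ⟨-, -, h⟩
  obtain ⟨x⟩ := ‹Nonempty X›
  obtain ⟨U, -, hx, V, hV, ⟨e⟩⟩ := h x
  have hsub : V.Subsingleton := by
    intro a ha b hb
    have := e.symm.injective (Subsingleton.elim (e.symm ⟨a, ha⟩) (e.symm ⟨b, hb⟩))
    exact congrArg Subtype.val this
  have hVe : V = {(e ⟨x, hx⟩ : ell2)} := hsub.eq_singleton_of_mem (e ⟨x, hx⟩).2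
  have : Nontrivial ell2 := by
    refine ⟨⟨lp.single 2 0 1, 0, fun h => ?_⟩⟩
    have := congrArg (fun y : ell2 => y 0) h
    simp at this
  have : (𝓝[≠] (e ⟨x, hx⟩ : ell2)).NeBot := Module.punctured_nhds_neBot ℝ ell2 _
  exact not_isOpen_singleton _ (hVe ▸ hV)

theorem subsingleton_mpHomeoFixSet_univ {M : Type*} [TopologicalSpace M] [MeasurableSpace M]
    (μ : Measure M) : Subsingleton (MPHomeoFixSet M Set.univ μ) := by
  refine ⟨fun f g => Subtype.ext (ContinuousMap.ext fun x => ?_)⟩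
  rw [f.2.2.1 x trivial, g.2.2.1 x trivial]

theorem id_mem_mpHomeoFixSet {M : Type*} [TopologicalSpace M] [MeasurableSpace M] (X : Set M)
    (μ : Measure M) : ContinuousMap.id M ∈ MPHomeoFixSet M X μ :=
  ⟨IsHomeomorph.id, fun _ _ => rfl, Measure.map_id⟩

end

section

open Filter Topology TopologicalSpace
open scoped ZeroAtInfty

namespace BumpCovering

variable {X : Type*} [TopologicalSpace X]

/-- The star of `x` with respect to the supports of a bump covering. -/
def star (f : BumpCovering ℕ X) (x : X) : Set X := {p | ∃ i, 0 < f i x ∧ 0 < f i p}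

end BumpCovering

/-- A local smallness property of sets can be achieved by the stars of a bump covering. -/
theorem exists_bumpCovering_star {X : Type*} [MetricSpace X] [SeparableSpace X] [Nonempty X]
    {P : X → Set X → Prop} (hmono : ∀ x S T, S ⊆ T → P x T → P x S)
    (hloc : ∀ y, ∃ V ∈ 𝓝 y, ∀ x ∈ V, P x V) :
    ∃ f : BumpCovering ℕ X, ∀ x, P x (f.star x) := by
  have : SecondCountableTopology X := UniformSpace.secondCountable_of_separable X
  let S : X → Set ℝ := fun y => {r | 0 < r ∧ r ≤ 1 ∧ ∀ x ∈ Metric.ball y r, P x (Metric.ball y r)}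
  let σ : X → ℝ := fun y => sSup (S y)
  have hbdd : ∀ y, BddAbove (S y) := fun y => ⟨1, fun r hr => hr.2.1⟩
  have hshift : ∀ y y' r, r ∈ S y → dist y y' < r → r - dist y y' ∈ S y' := by
    intro y y' r hr hd
    have hsub : Metric.ball y' (r - dist y y') ⊆ Metric.ball y r :=
      Metric.ball_subset_ball' (by rw [dist_comm]; linarith)
    exact ⟨by linarith, by linarith [hr.2.1, dist_nonneg (x := y) (y := y')],
      fun x hx => hmono _ _ _ hsub (hr.2.2 x (hsub hx))⟩
  have hne : ∀ y, (S y).Nonempty := by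
    intro y
    obtain ⟨V, hV, hVP⟩ := hloc y
    obtain ⟨ρ, hρ, hρV⟩ := Metric.mem_nhds_iff.1 hV
    have hsub : Metric.ball y (min ρ 1) ⊆ V :=
      (Metric.ball_subset_ball (min_le_left _ _)).trans hρV
    exact ⟨min ρ 1, lt_min hρ one_pos, min_le_right _ _,
      fun x hx => hmono _ _ _ hsub (hVP x (hsub hx))⟩
  have hσpos : ∀ y, 0 < σ y := fun y => by
    obtain ⟨r, hr⟩ := hne y
    exact hr.1.trans_le (le_csSup (hbdd y) hr)
  have hσlip : ∀ y y', σ y - dist y y' ≤ σ y' := by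
    intro y y'
    have : σ y ≤ σ y' + dist y y' := csSup_le (hne y) fun r hr => by
      rcases lt_or_ge (dist y y') r with h | h
      · linarith [le_csSup (hbdd y') (hshift y y' r hr h)]
      · linarith [hσpos y']
    linarith
  have hσgood : ∀ x, P x (Metric.ball x (σ x / 2)) := fun x => by
    obtain ⟨r, hr, hlt⟩ := exists_lt_of_lt_csSup (hne x) (half_lt_self (hσpos x))
    exact hmono _ _ _ (Metric.ball_subset_ball hlt.le) (hr.2.2 x (Metric.mem_ball_self hr.1))
  obtain ⟨s, hs, hsU⟩ := TopologicalSpace.countable_cover_nhds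
    fun y => Metric.ball_mem_nhds y (by linarith [hσpos y] : 0 < σ y / 8)
  have hsne : s.Nonempty := by
    by_contra hne
    rw [Set.not_nonempty_iff_eq_empty] at hne
    simp only [hne, Set.mem_empty_iff_false, Set.iUnion_of_empty, Set.iUnion_empty] at hsU
    exact Set.empty_ne_univ hsU
  obtain ⟨e, he⟩ := hs.exists_eq_range hsne
  obtain ⟨f, hf⟩ := BumpCovering.exists_isSubordinate (X := X) isClosed_univ
    (fun i => Metric.ball (e i) (σ (e i) / 8)) (fun _ => Metric.isOpen_ball) (by
      rw [← hsU, he, Set.biUnion_range])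
  refine ⟨f, fun x => hmono _ _ _ ?_ (hσgood x)⟩
  rintro p ⟨i, hx, hp⟩
  have hx' := hf i (subset_tsupport _ (ne_of_gt hx : f i x ≠ 0))
  have hp' := hf i (subset_tsupport _ (ne_of_gt hp : f i p ≠ 0))
  simp only [Metric.mem_ball] at hx' hp' ⊢
  have h1 := hσlip (e i) x
  have h2 := dist_triangle_right p x (e i)
  rw [dist_comm (e i) x] at h1
  linarith [hσpos (e i)]

theorem BumpCovering.eventually_abs_sub_le {X : Type*} [TopologicalSpace X]
    (f : BumpCovering ℕ X) (y : X) {ε : ℝ} (hε : 0 < ε) :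
    ∃ V ∈ 𝓝 y, ∀ x ∈ V, ∀ p ∈ V, ∀ i, |f i x - f i p| ≤ ε := by
  obtain ⟨V, hV, hfin⟩ := f.locallyFinite y
  refine ⟨V ∩ {x | ∀ i ∈ hfin.toFinset, |f i x - f i y| < ε / 2}, Filter.inter_mem hV ?_, ?_⟩
  · change ∀ᶠ x in 𝓝 y, ∀ i ∈ hfin.toFinset, |f i x - f i y| < ε / 2
    rw [Filter.eventually_all_finset]
    intro i _
    have : ContinuousAt (fun x => |f i x - f i y|) y := by fun_prop
    exact this.eventually_lt continuousAt_const (by simpa using hε)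
  · rintro x ⟨hxV, hx⟩ p ⟨hpV, hp⟩ i
    by_cases hi : i ∈ hfin.toFinset
    · have h1 := hx i hi
      have h2 := hp i hi
      rw [abs_sub_comm] at h2
      linarith [abs_sub_le (f i x) (f i y) (f i p)]
    · have h0 : ∀ z ∈ V, f i z = 0 := fun z hz => by
        by_contra hne
        exact hi (hfin.mem_toFinset.2 ⟨z, hne, hz⟩)
      rw [h0 x hxV, h0 p hpV]
      simpa using hε.le

/-- The tower of bump coverings used to embed an ANR. -/
theorem exists_bumpCovering_tower {X Y : Type*} [MetricSpace X] [SeparableSpace X] [Nonempty X]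
    [NormedAddCommGroup Y] [NormedSpace ℝ Y] {ι : X → Y} (hι : Continuous ι) {W : Set Y}
    (hW : IsOpen W) {r : Y → X} (hr : ContinuousOn r W) (hιW : ∀ x, ι x ∈ W)
    (hrι : ∀ x, r (ι x) = x) :
    ∃ f : ℕ → BumpCovering ℕ X, ∀ n,
      (∀ x, ∀ p ∈ (f n).star x, dist x p ≤ (1 / 2) ^ n) ∧
      (∀ m < n, ∀ x, ∀ p ∈ (f n).star x, ∀ i, |f m i x - f m i p| ≤ (1 / 2) ^ n) ∧
      ∀ m < n, ∀ x, convexHull ℝ (ι '' (f n).star x) ⊆ W ∩ r ⁻¹' (f m).star x := by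
  classical
  let P : ℕ × BumpCovering ℕ X → Prop := fun q =>
    ∀ x, ∀ p ∈ q.2.star x, dist x p ≤ (1 / 2) ^ q.1
  let R : ℕ × BumpCovering ℕ X → ℕ × BumpCovering ℕ X → Prop := fun q q' => q.1 < q'.1 ∧
    (∀ x, ∀ p ∈ q'.2.star x, ∀ i, |q.2 i x - q.2 i p| ≤ (1 / 2) ^ q'.1) ∧
    ∀ x, convexHull ℝ (ι '' q'.2.star x) ⊆ W ∩ r ⁻¹' q.2.star x
  obtain ⟨F, hFP, hFR⟩ := exists_seq_of_forall_finset_exists P R fun s _ => by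
    obtain ⟨k, hk⟩ : ∃ k, ∀ q ∈ s, q.1 < k :=
      ⟨s.sup Prod.fst + 1, fun q hq => Nat.lt_succ_of_le (Finset.le_sup hq)⟩
    have hε : (0 : ℝ) < (1 / 2) ^ k := by positivity
    let Q : X → Set X → Prop := fun x S => (∀ p ∈ S, dist x p ≤ (1 / 2) ^ k) ∧
      ∀ q ∈ s, (∀ p ∈ S, ∀ i, |q.2 i x - q.2 i p| ≤ (1 / 2) ^ k) ∧
        convexHull ℝ (ι '' S) ⊆ W ∩ r ⁻¹' q.2.star x
    obtain ⟨f, hf⟩ := exists_bumpCovering_star (P := Q) (fun x S T hST hT =>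
      ⟨fun p hp => hT.1 p (hST hp), fun q hq => ⟨fun p hp => (hT.2 q hq).1 p (hST hp),
        (convexHull_mono (Set.image_mono hST)).trans (hT.2 q hq).2⟩⟩) (fun y => by
      have h1 : ∀ᶠ V in (𝓝 y).smallSets, ∀ x ∈ V, ∀ p ∈ V, dist x p ≤ (1 / 2) ^ k := by
        refine eventually_smallSets.2 ⟨Metric.ball y ((1 / 2) ^ k / 2),
          Metric.ball_mem_nhds _ (by positivity), fun t ht x hx p hp => ?_⟩
        have hx := Metric.mem_ball.1 (ht hx)
        have hp := Metric.mem_ball.1 (ht hp)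
        linarith [dist_triangle_right x p y]
      have h2 : ∀ᶠ V in (𝓝 y).smallSets, ∀ q ∈ s, ∀ x ∈ V,
          (∀ p ∈ V, ∀ i, |q.2 i x - q.2 i p| ≤ (1 / 2) ^ k) ∧
          convexHull ℝ (ι '' V) ⊆ W ∩ r ⁻¹' q.2.star x := by
        rw [Filter.eventually_all_finset]
        intro q _
        obtain ⟨V, hV, hVq⟩ := q.2.eventually_abs_sub_le y hε
        set i := q.2.ind y (Set.mem_univ y) with hi
        have hiy : q.2 i y = 1 := q.2.ind_apply y (Set.mem_univ y)
        have hVo : IsOpen {x | 0 < q.2 i x} := isOpen_lt continuous_const (q.2 i).continuous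
        have hyo : y ∈ {x | 0 < q.2 i x} := by simp [hiy]
        have hpre : W ∩ r ⁻¹' {x | 0 < q.2 i x} ∈ 𝓝 (ι y) :=
          Filter.inter_mem (hW.mem_nhds (hιW y)) <|
            (hr.continuousAt (hW.mem_nhds (hιW y))).preimage_mem_nhds
              (by rw [hrι]; exact hVo.mem_nhds hyo)
        obtain ⟨δ, hδ, hδs⟩ := Metric.mem_nhds_iff.1 hpre
        refine eventually_smallSets.2 ⟨V ∩ ({x | 0 < q.2 i x} ∩ ι ⁻¹' Metric.ball (ι y) δ),
          Filter.inter_mem hV (Filter.inter_mem (hVo.mem_nhds hyo)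
            (hι.continuousAt.preimage_mem_nhds (Metric.ball_mem_nhds _ hδ))),
          fun t ht x hx => ⟨fun p hp => hVq x (ht hx).1 p (ht hp).1, ?_⟩⟩
        have hsub : convexHull ℝ (ι '' t) ⊆ Metric.ball (ι y) δ :=
          convexHull_min (by rintro _ ⟨p, hp, rfl⟩; exact (ht hp).2.2) (convex_ball _ _)
        intro z hz
        have := hδs (hsub hz)
        exact ⟨this.1, i, (ht hx).2.1, this.2⟩
      obtain ⟨V, hV, hVt⟩ := eventually_smallSets.1 (h1.and h2)
      exact ⟨V, hV, fun x hx => ⟨fun p hp => (hVt V subset_rfl).1 x hx p hp,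
        fun q hq => (hVt V subset_rfl).2 q hq x hx⟩⟩)
    exact ⟨⟨k, f⟩, fun x p hp => (hf x).1 p hp, fun q hq => ⟨hk q hq,
      fun x p hp i => ((hf x).2 q hq).1 p hp i, fun x => ((hf x).2 q hq).2⟩⟩
  have hk : ∀ n, n ≤ (F n).1 := (strictMono_nat_of_lt_succ fun n =>
    (hFR n (n + 1) n.lt_succ_self).1).id_le
  have hpow : ∀ n, ((1 : ℝ) / 2) ^ (F n).1 ≤ (1 / 2) ^ n := fun n =>
    pow_le_pow_of_le_one (by norm_num) (by norm_num) (hk n)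
  exact ⟨fun n => (F n).2, fun n => ⟨fun x p hp => (hFP n x p hp).trans (hpow n),
    fun m hm x p hp i => ((hFR m n hm).2.1 x p hp i).trans (hpow n),
    fun m hm x => (hFR m n hm).2.2 x⟩⟩

/-- The embedding into `c₀(ℕ × ℕ)` attached to a sequence of bump coverings. -/
noncomputable def towerMap {X : Type*} [TopologicalSpace X] (f : ℕ → BumpCovering ℕ X) (x : X) :
    C₀(ℕ × ℕ, ℝ) where
  toFun q := (1 / 2) ^ q.1 * f q.1 q.2 x
  continuous_toFun := continuous_of_discreteTopology
  zero_at_infty' := by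
    rw [cocompact_eq_cofinite, Metric.tendsto_nhds]
    intro ε hε
    obtain ⟨N, hN⟩ := exists_pow_lt_of_lt_one hε (by norm_num : (1 / 2 : ℝ) < 1)
    refine ((Set.finite_lt_nat N).biUnion (t := fun n => Prod.mk n '' {i | f n i x ≠ 0})
      fun n _ => ((f n).point_finite x).image _).subset ?_
    rintro ⟨n, i⟩ hq
    simp only [Set.mem_compl_iff, Set.mem_ofPred_eq, dist_zero_right, not_lt, norm_mul, norm_pow,
      Real.norm_eq_abs, abs_of_nonneg ((f n).nonneg i x)] at hq
    rw [abs_of_nonneg (by norm_num : (0 : ℝ) ≤ 1 / 2)] at hq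
    refine Set.mem_biUnion (x := n) ?_ ⟨i, fun h0 => ?_, rfl⟩
    · by_contra hn
      have h1 : ((1 : ℝ) / 2) ^ n ≤ (1 / 2) ^ N :=
        pow_le_pow_of_le_one (by norm_num) (by norm_num) (not_lt.1 hn)
      have h2 := mul_le_mul_of_nonneg_left ((f n).le_one i x)
        (by positivity : (0 : ℝ) ≤ (1 / 2) ^ n)
      linarith
    · rw [h0, mul_zero] at hq
      linarith

theorem towerMap_apply {X : Type*} [TopologicalSpace X] (f : ℕ → BumpCovering ℕ X) (x : X)
    (n i : ℕ) : towerMap f x (n, i) = (1 / 2) ^ n * f n i x := rfl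

end

section

open Filter Topology TopologicalSpace
open scoped ZeroAtInfty

theorem mem_star_of_norm_towerMap_sub_lt {X : Type*} [TopologicalSpace X]
    {f : ℕ → BumpCovering ℕ X} {x p : X} {n : ℕ}
    (h : ‖towerMap f p - towerMap f x‖ < (1 / 2) ^ n) : p ∈ (f n).star x := by
  set i := (f n).ind x (Set.mem_univ x)
  have hi : f n i x = 1 := (f n).ind_apply x (Set.mem_univ x)
  refine ⟨i, by simp [hi], ?_⟩
  have h1 := ((towerMap f p - towerMap f x).norm_apply_le (n, i)).trans_lt h
  rw [ZeroAtInftyContinuousMap.sub_apply, towerMap_apply, towerMap_apply, hi, ← mul_sub, norm_mul,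
    Real.norm_of_nonneg (by positivity)] at h1
  have h2 : (0 : ℝ) < (1 / 2) ^ n := by positivity
  have h3 : ‖f n i p - 1‖ < 1 := by
    by_contra hc
    have := mul_le_mul_of_nonneg_left (not_lt.1 hc) h2.le
    linarith
  rw [Real.norm_eq_abs, abs_lt] at h3
  linarith

theorem norm_towerMap_sub_le_one {X : Type*} [TopologicalSpace X] {f : ℕ → BumpCovering ℕ X}
    {x p : X} {n : ℕ} (hosc : ∀ m < n, ∀ i, |f m i x - f m i p| ≤ (1 / 2) ^ n) :
    ‖towerMap f p - towerMap f x‖ ≤ (1 / 2) ^ n := by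
  refine ZeroAtInftyContinuousMap.norm_le_of_forall (by positivity) ?_
  rintro ⟨m, i⟩
  rw [ZeroAtInftyContinuousMap.sub_apply, towerMap_apply, towerMap_apply, ← mul_sub, norm_mul,
    Real.norm_of_nonneg (by positivity), Real.norm_eq_abs, abs_sub_comm]
  have hm0 : (0 : ℝ) ≤ (1 / 2) ^ m := by positivity
  rcases lt_or_ge m n with h | h
  · have h1 : ((1 : ℝ) / 2) ^ m ≤ 1 := pow_le_one₀ (by norm_num) (by norm_num)
    have := mul_le_mul h1 (hosc m h i) (abs_nonneg _) zero_le_one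
    linarith
  · have h1 : ((1 : ℝ) / 2) ^ m ≤ (1 / 2) ^ n :=
      pow_le_pow_of_le_one (by norm_num) (by norm_num) h
    have h2 : |f m i x - f m i p| ≤ 1 := by
      rw [abs_le]
      constructor <;> linarith [(f m).nonneg i x, (f m).nonneg i p, (f m).le_one i x,
        (f m).le_one i p]
    have := mul_le_mul_of_nonneg_left h2 hm0
    linarith

/-- A neighbourhood retraction which is Lipschitz at the points of the embedded space. -/
structure LipRetraction (X E : Type*) [TopologicalSpace X] [NormedAddCommGroup E] where
  /-- the embedding -/
  emb : X → E
  /-- the retraction -/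
  ret : E → X
  isClosedEmbedding : IsClosedEmbedding emb
  continuousOn_ret : ContinuousOn ret {e | ∃ x, ‖e - emb x‖ < 1 / 8}
  norm_sub_le : ∀ e x, ‖e - emb x‖ < 1 / 8 → ‖emb (ret e) - emb x‖ ≤ 16 * ‖e - emb x‖

theorem exists_pow_bracket {t : ℝ} (h0 : 0 < t) (h1 : t < 1 / 8) :
    ∃ n : ℕ, 4 * t < (1 / 2) ^ (n + 1) ∧ (1 / 2) ^ n ≤ 16 * t := by
  classical
  have hex : ∃ n : ℕ, ((1 : ℝ) / 2) ^ n ≤ 16 * t :=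
    (exists_pow_lt_of_lt_one (by positivity : 0 < 16 * t) (by norm_num : (1 / 2 : ℝ) < 1)).imp
      fun _ h => h.le
  refine ⟨Nat.find hex, ?_, Nat.find_spec hex⟩
  rcases h : Nat.find hex with _ | n
  · norm_num
    linarith
  · have := not_le.1 (Nat.find_min hex (m := n) (by omega))
    rw [pow_succ, pow_succ]
    linarith

theorem exists_lipRetraction {X : Type u} [MetricSpace X] [CompleteSpace X] [SeparableSpace X]
    [Nonempty X] (hX : IsANR X) : Nonempty (LipRetraction X C₀(ℕ × ℕ, ℝ)) := by
  classical
  let Y := ULift.{u} (lp (fun _ : ℕ => ℝ) ⊤)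
  let ι : X → Y := fun x => ULift.up (kuratowskiEmbedding X x)
  have hιi : Isometry ι := fun x y => kuratowskiEmbedding.isometry X x y
  obtain ⟨W, hW, hBW, g, hg⟩ := hX.2 Y inferInstance (Set.range ι)
    hιi.isClosedEmbedding.isClosed_range
    ⟨hιi.isEmbedding.toHomeomorph.symm, hιi.isEmbedding.toHomeomorph.symm.continuous⟩
  obtain ⟨x₀⟩ := ‹Nonempty X›
  let r : Y → X := fun y => if h : y ∈ W then g ⟨y, h⟩ else x₀
  have hrW : ∀ y (h : y ∈ W), r y = g ⟨y, h⟩ := fun y h => dif_pos h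
  have hr : ContinuousOn r W := by
    rw [continuousOn_iff_continuous_domRestrict]
    have : W.domRestrict r = g := funext fun y => hrW y.1 y.2
    rw [this]
    exact g.continuous
  have hιW : ∀ x, ι x ∈ W := fun x => hBW ⟨x, rfl⟩
  have hrι : ∀ x, r (ι x) = x := fun x => by
    rw [hrW _ (hιW x), hg ⟨ι x, x, rfl⟩]
    exact hιi.isEmbedding.toHomeomorph.symm_apply_apply x
  have : Nonempty X := ⟨x₀⟩
  obtain ⟨f, hf⟩ := exists_bumpCovering_tower hιi.continuous hW hr hιW hrι
  have hstar : ∀ n x p, ‖towerMap f p - towerMap f x‖ < (1 / 2) ^ n → p ∈ (f n).star x :=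
    fun n x p => mem_star_of_norm_towerMap_sub_lt
  have hnorm : ∀ n x, ∀ p ∈ (f n).star x, ‖towerMap f p - towerMap f x‖ ≤ (1 / 2) ^ n :=
    fun n x p hp => norm_towerMap_sub_le_one fun m hm => (hf n).2.1 m hm x p hp
  have hcont : Continuous (towerMap f) := by
    rw [Metric.continuous_iff']
    intro x ε hε
    obtain ⟨n, hn⟩ := exists_pow_lt_of_lt_one hε (by norm_num : (1 / 2 : ℝ) < 1)
    set i := (f n).ind x (Set.mem_univ x)
    have hi : f n i x = 1 := (f n).ind_apply x (Set.mem_univ x)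
    filter_upwards [(isOpen_lt continuous_const (f n i).continuous).mem_nhds
      (by simp [hi] : x ∈ {p | 0 < f n i p})] with p hp
    rw [dist_eq_norm]
    exact (hnorm n x p ⟨i, by simp [hi], hp⟩).trans_lt hn
  have hdist : ∀ n x p, ‖towerMap f p - towerMap f x‖ < (1 / 2) ^ n → dist x p ≤ (1 / 2) ^ n :=
    fun n x p h => (hf n).1 x p (hstar n x p h)
  have hinj : Function.Injective (towerMap f) := by
    intro x p hxp
    refine dist_le_zero.1 (ge_of_tendsto' (tendsto_pow_atTop_nhds_zero_of_lt_one
      (by norm_num : (0 : ℝ) ≤ 1 / 2) (by norm_num)) fun n => hdist n x p ?_)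
    rw [hxp, sub_self, norm_zero]
    positivity
  have hcl : IsClosedEmbedding (towerMap f) := by
    refine IsClosedEmbedding.of_continuous_injective_isClosedMap hcont hinj fun S hS => ?_
    refine IsSeqClosed.isClosed fun u e hu hue => ?_
    choose s hsS hsu using hu
    have hcau : CauchySeq s := by
      rw [Metric.cauchySeq_iff]
      intro ε hε
      obtain ⟨n, hn⟩ := exists_pow_lt_of_lt_one hε (by norm_num : (1 / 2 : ℝ) < 1)
      obtain ⟨N, hN⟩ := Metric.cauchySeq_iff.1 hue.cauchySeq ((1 / 2) ^ n) (by positivity)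
      refine ⟨N, fun a ha b hb => (hdist n _ _ ?_).trans_lt hn⟩
      rw [hsu, hsu, ← dist_eq_norm]
      exact hN b hb a ha
    obtain ⟨x, hx⟩ := cauchySeq_tendsto_of_complete hcau
    refine ⟨x, hS.mem_of_tendsto hx (Eventually.of_forall hsS), ?_⟩
    refine tendsto_nhds_unique ((hcont.tendsto x).comp hx) ?_
    simpa only [Function.comp_def, hsu] using hue
  let inv : C₀(ℕ × ℕ, ℝ) → X := Function.invFun (towerMap f)
  have hinv : ∀ x, inv (towerMap f x) = x := Function.leftInverse_invFun hcl.injective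
  have hinvc : ContinuousOn inv (Set.range (towerMap f)) := by
    rw [continuousOn_iff_continuous_domRestrict]
    have : (Set.range (towerMap f)).domRestrict inv = hcl.isEmbedding.toHomeomorph.symm := by
      funext e
      obtain ⟨x, rfl⟩ := hcl.isEmbedding.toHomeomorph.surjective e
      rw [Homeomorph.symm_apply_apply]
      exact hinv x
    rw [this]
    exact hcl.isEmbedding.toHomeomorph.symm.continuous
  obtain ⟨κ, hκc, hκA, hκ⟩ := (hιi.continuous.comp_continuousOn hinvc)
    |>.exists_extension_mem_convexHull hcl.isClosed_range (Set.range_nonempty _)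
  have key : ∀ e x n, 4 * ‖e - towerMap f x‖ < (1 / 2) ^ (n + 1) →
      κ e ∈ W ∧ r (κ e) ∈ (f n).star x := by
    intro e x n hn
    by_cases he : e ∈ Set.range (towerMap f)
    · obtain ⟨p, rfl⟩ := he
      have : κ (towerMap f p) = ι p := by rw [hκA ⟨p, rfl⟩]; simp [hinv]
      rw [this, hrι]
      refine ⟨hιW p, hstar n x p ?_⟩
      rw [pow_succ] at hn
      linarith [norm_nonneg (towerMap f p - towerMap f x)]
    · refine (hf (n + 1)).2.2 n n.lt_succ_self x (convexHull_mono ?_ (hκ e he))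
      rintro _ ⟨_, ⟨⟨p, rfl⟩, hp⟩, rfl⟩
      refine ⟨p, hstar _ _ _ ?_, by simp [hinv]⟩
      have h1 := Metric.infDist_le_dist_of_mem (x := e) (Set.mem_range_self (f := towerMap f) x)
      rw [Metric.mem_ball, dist_eq_norm] at hp
      rw [dist_eq_norm] at h1
      have h2 := norm_sub_le_norm_sub_add_norm_sub (towerMap f p) e (towerMap f x)
      linarith
  refine ⟨⟨towerMap f, fun e => r (κ e), hcl, ?_, ?_⟩⟩
  · refine hr.comp hκc.continuousOn ?_
    rintro e ⟨x, hx⟩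
    exact (key e x 0 (by norm_num; linarith)).1
  · intro e x hx
    rcases (norm_nonneg (e - towerMap f x)).eq_or_lt with h0 | h0
    · have he : e = towerMap f x := sub_eq_zero.1 (norm_eq_zero.1 h0.symm)
      have : κ e = ι x := by rw [he, hκA ⟨x, rfl⟩]; simp [hinv]
      simp only [this, hrι, sub_self, norm_zero]
      positivity
    · obtain ⟨n, hn, hn'⟩ := exists_pow_bracket h0 hx
      exact (hnorm n x _ (key e x n hn).2).trans hn'

end

section

open Filter Topology TopologicalSpace
open scoped ZeroAtInfty

namespace LipRetraction

variable {X E : Type*} [TopologicalSpace X] [T2Space X] [Nonempty X] [NormedAddCommGroup E]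
  [NormedSpace ℝ E] [CompleteSpace E] (R : LipRetraction X E)

/-- The orbit associated with a perturbation sequence. -/
noncomputable def orbit (u : ℕ → E) : ℕ → E
  | 0 => u 0
  | k + 1 => R.emb (R.ret (orbit u k)) + ((1 / 2 : ℝ) ^ (k + 1)) • u (k + 1)

/-- The limit point of an orbit. -/
noncomputable def orbitLim (u : ℕ → E) : X := limUnder atTop fun k => R.ret (R.orbit u k)

/-- The rescaled deviations of the orbit from its limit. -/
noncomputable def deviation (u : ℕ → E) (k : ℕ) : E :=
  (2 : ℝ) ^ k • (R.orbit u k - R.emb (R.orbitLim u))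

open Classical in
/-- The forward map `𝓛 → X × 𝓛`. -/
noncomputable def fwd (u : C₀(ℕ, E)) : X × C₀(ℕ, E) :=
  (R.orbitLim u, if h : Tendsto (R.deviation u) atTop (𝓝 0) then .ofTendsto _ h else 0)

/-- The points of the reconstructed orbit. -/
noncomputable def point (q : X × C₀(ℕ, E)) (k : ℕ) : E := R.emb q.1 + ((1 / 2 : ℝ) ^ k) • q.2 k

/-- The perturbations reconstructed from the deviations. -/
noncomputable def perturbation (q : X × C₀(ℕ, E)) : ℕ → E
  | 0 => R.point q 0
  | k + 1 => (2 : ℝ) ^ (k + 1) • (R.point q (k + 1) - R.emb (R.ret (R.point q k)))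

open Classical in
/-- The backward map `X × 𝓛 → 𝓛`. -/
noncomputable def bwd (q : X × C₀(ℕ, E)) : C₀(ℕ, E) :=
  if h : Tendsto (R.perturbation q) atTop (𝓝 0) then .ofTendsto _ h else 0

/-- The domain of the forward map. -/
def fwdDom : Set C₀(ℕ, E) := {u | ∃ x, ‖u 0 - R.emb x‖ < 1 / 8 ∧
  ∃ δ < (1 / 8 : ℝ), ∀ k, ‖u (k + 1)‖ ≤ δ}

/-- The domain of the backward map. -/
def bwdDom (X E : Type*) [NormedAddCommGroup E] : Set (X × C₀(ℕ, E)) := {q | ‖q.2‖ < 1 / 8}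

theorem isOpen_fwdDom : IsOpen R.fwdDom := by
  rw [Metric.isOpen_iff]
  rintro u ⟨x, hx, δ, hδ, hu⟩
  refine ⟨min (1 / 8 - ‖u 0 - R.emb x‖) ((1 / 8 - δ) / 2),
    lt_min (by linarith) (by linarith), fun v hv => ?_⟩
  rw [Metric.mem_ball, dist_eq_norm, lt_min_iff] at hv
  have hvk : ∀ k, ‖v k - u k‖ ≤ ‖v - u‖ := fun k => (v - u).norm_apply_le k
  refine ⟨x, ?_, (1 / 8 + δ) / 2, by linarith, fun k => ?_⟩
  · linarith [norm_sub_le_norm_sub_add_norm_sub (v 0) (u 0) (R.emb x), hvk 0]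
  · have := norm_add_le (v (k + 1) - u (k + 1)) (u (k + 1))
    rw [sub_add_cancel] at this
    linarith [hvk (k + 1), hu k]

theorem isOpen_bwdDom : IsOpen (bwdDom X E) :=
  isOpen_lt (continuous_norm.comp continuous_snd) continuous_const

theorem norm_half_smul (k : ℕ) (v : E) : ‖((1 / 2 : ℝ) ^ k) • v‖ = (1 / 2) ^ k * ‖v‖ := by
  rw [norm_smul, Real.norm_of_nonneg (by positivity)]

theorem norm_two_smul (k : ℕ) (v : E) : ‖((2 : ℝ) ^ k) • v‖ = 2 ^ k * ‖v‖ := by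
  rw [norm_smul, Real.norm_of_nonneg (by positivity)]

theorem half_pow_mul_two_pow (k : ℕ) : (1 / 2 : ℝ) ^ k * 2 ^ k = 1 := by
  rw [← mul_pow]; norm_num

theorem half_pow_le_one (k : ℕ) : (1 / 2 : ℝ) ^ k ≤ 1 := pow_le_one₀ (by norm_num) (by norm_num)

theorem norm_orbit_succ_sub (u : ℕ → E) (k : ℕ) :
    ‖R.orbit u (k + 1) - R.emb (R.ret (R.orbit u k))‖ = (1 / 2) ^ (k + 1) * ‖u (k + 1)‖ := by
  rw [orbit, add_sub_cancel_left, norm_half_smul]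

section Forward

variable {R} {u : C₀(ℕ, E)} (hu : u ∈ R.fwdDom)
include hu

theorem orbit_near (k : ℕ) :
    ‖R.orbit u (k + 1) - R.emb (R.ret (R.orbit u k))‖ < 1 / 8 := by
  obtain ⟨-, -, δ, hδ, h⟩ := hu
  rw [norm_orbit_succ_sub]
  have := mul_le_mul (half_pow_le_one (k + 1)) (h k) (norm_nonneg _) zero_le_one
  linarith

theorem orbit_mem (k : ℕ) : R.orbit u k ∈ {e | ∃ x, ‖e - R.emb x‖ < 1 / 8} := by
  cases k with
  | zero => exact ⟨hu.choose, hu.choose_spec.1⟩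
  | succ k => exact ⟨_, orbit_near hu k⟩

theorem norm_ret_succ_sub_le (k : ℕ) :
    ‖R.emb (R.ret (R.orbit u (k + 1))) - R.emb (R.ret (R.orbit u k))‖ ≤
      16 * ((1 / 2) ^ (k + 1) * ‖u (k + 1)‖) :=
  norm_orbit_succ_sub R u k ▸ R.norm_sub_le _ _ (orbit_near hu k)

theorem norm_ret_sub_le {k : ℕ} {ε : ℝ} (hε : ∀ l > k, ‖u l‖ ≤ ε) {m : ℕ} (hm : k ≤ m) :
    ‖R.emb (R.ret (R.orbit u m)) - R.emb (R.ret (R.orbit u k))‖ ≤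
      16 * ε * ((1 / 2) ^ k - (1 / 2) ^ m) := by
  induction m, hm using Nat.le_induction with
  | base => simp
  | succ m hm ih =>
    have h1 := norm_ret_succ_sub_le hu m
    have h2 := norm_sub_le_norm_sub_add_norm_sub (R.emb (R.ret (R.orbit u (m + 1))))
      (R.emb (R.ret (R.orbit u m))) (R.emb (R.ret (R.orbit u k)))
    have h3 := mul_le_mul_of_nonneg_left (hε (m + 1) (by omega))
      (by positivity : (0 : ℝ) ≤ (1 / 2) ^ (m + 1))
    have h4 : (1 / 2 : ℝ) ^ (m + 1) = (1 / 2) ^ m / 2 := by rw [pow_succ]; ring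
    rw [h4] at h1 h3 ⊢
    nlinarith

theorem norm_ret_sub_le' {k : ℕ} {ε : ℝ} (hε : ∀ l > k, ‖u l‖ ≤ ε) {m : ℕ} (hm : k ≤ m) :
    ‖R.emb (R.ret (R.orbit u m)) - R.emb (R.ret (R.orbit u k))‖ ≤ 16 * ε * (1 / 2) ^ k := by
  refine (norm_ret_sub_le hu hε hm).trans (mul_le_mul_of_nonneg_left ?_ ?_)
  · have : (0 : ℝ) ≤ (1 / 2) ^ m := by positivity
    linarith
  · have := (norm_nonneg _).trans (hε (k + 1) (by omega))
    linarith

theorem norm_le_of_mem_fwdDom {k l : ℕ} (h : k < l) : ‖u l‖ ≤ 1 / 8 := by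
  obtain ⟨-, -, δ, hδ, h'⟩ := hu
  obtain ⟨l, rfl⟩ := Nat.exists_eq_succ_of_ne_zero (by omega : l ≠ 0)
  exact (h' l).trans hδ.le

theorem tendsto_ret : Tendsto (fun k => R.ret (R.orbit u k)) atTop (𝓝 (R.orbitLim u)) := by
  have hcau : CauchySeq fun k => R.emb (R.ret (R.orbit u k)) := by
    refine cauchySeq_of_le_geometric (1 / 2) 1 (by norm_num) fun k => ?_
    rw [dist_comm, dist_eq_norm]
    have h1 := norm_ret_succ_sub_le hu k
    have h2 := mul_le_mul_of_nonneg_left (norm_le_of_mem_fwdDom hu (by omega : k < k + 1))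
      (by positivity : (0 : ℝ) ≤ (1 / 2) ^ (k + 1))
    rw [pow_succ] at h1 h2
    linarith
  obtain ⟨e, he⟩ := cauchySeq_tendsto_of_complete hcau
  obtain ⟨x, rfl⟩ := R.isClosedEmbedding.isClosed_range.mem_of_tendsto he
    (Eventually.of_forall fun k => Set.mem_range_self _)
  have := R.isClosedEmbedding.isInducing.tendsto_nhds_iff.2 he
  exact tendsto_nhds_limUnder ⟨x, this⟩

theorem norm_lim_sub_le {k : ℕ} {ε : ℝ} (hε : ∀ l > k, ‖u l‖ ≤ ε) :
    ‖R.emb (R.orbitLim u) - R.emb (R.ret (R.orbit u k))‖ ≤ 16 * ε * (1 / 2) ^ k := by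
  have h1 : Tendsto (fun m => ‖R.emb (R.ret (R.orbit u m)) - R.emb (R.ret (R.orbit u k))‖) atTop
      (𝓝 ‖R.emb (R.orbitLim u) - R.emb (R.ret (R.orbit u k))‖) :=
    (((R.isClosedEmbedding.continuous.tendsto _).comp (tendsto_ret hu)).sub_const _).norm
  exact le_of_tendsto h1 (eventually_atTop.2 ⟨k, fun m hm => norm_ret_sub_le' hu hε hm⟩)

theorem norm_deviation_le {k : ℕ} {ε : ℝ} (hε : ∀ l > k, ‖u l‖ ≤ ε) :
    ‖R.deviation u (k + 1)‖ ≤ 33 * ε := by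
  have h1 := norm_lim_sub_le hu hε
  rw [norm_sub_rev] at h1
  have h2 := norm_orbit_succ_sub R u k
  have h3 := norm_sub_le_norm_sub_add_norm_sub (R.orbit u (k + 1))
    (R.emb (R.ret (R.orbit u k))) (R.emb (R.orbitLim u))
  have h4 := mul_le_mul_of_nonneg_left (hε (k + 1) (by omega))
    (by positivity : (0 : ℝ) ≤ (1 / 2) ^ (k + 1))
  rw [deviation, norm_two_smul]
  have h5 : ‖R.orbit u (k + 1) - R.emb (R.orbitLim u)‖ ≤ (1 / 2) ^ (k + 1) * (33 * ε) := by
    have : (1 / 2 : ℝ) ^ k = (1 / 2) ^ (k + 1) * 2 := by rw [pow_succ]; ring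
    rw [this] at h1
    linarith
  calc _ ≤ 2 ^ (k + 1) * ((1 / 2) ^ (k + 1) * (33 * ε)) := by gcongr
    _ = ((1 / 2) ^ (k + 1) * 2 ^ (k + 1)) * (33 * ε) := by ring
    _ = 33 * ε := by rw [half_pow_mul_two_pow, one_mul]

theorem tendsto_deviation : Tendsto (R.deviation u) atTop (𝓝 0) := by
  rw [Metric.tendsto_atTop]
  intro ε hε
  obtain ⟨N, hN⟩ := Metric.tendsto_atTop.1 u.tendsto_atTop (ε / 34) (by positivity)
  refine ⟨N + 1, fun n hn => ?_⟩
  obtain ⟨k, rfl⟩ : ∃ k, n = k + 1 := ⟨n - 1, by omega⟩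
  rw [dist_zero_right]
  have := norm_deviation_le hu (k := k) (ε := ε / 34) fun l hl => by
    have := hN l (by omega)
    rw [dist_zero_right] at this
    exact this.le
  linarith

theorem fwd_snd_apply (k : ℕ) : (R.fwd u).2 k = R.deviation u k := by
  rw [fwd]
  simp [tendsto_deviation hu]

theorem point_fwd (k : ℕ) : R.point (R.fwd u) k = R.orbit u k := by
  rw [point, fwd_snd_apply hu, deviation, smul_smul, half_pow_mul_two_pow, one_smul, fwd]
  simp

theorem bwd_fwd : R.bwd (R.fwd u) = u := by
  have h : R.perturbation (R.fwd u) = u := by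
    funext k
    cases k with
    | zero => rw [perturbation, point_fwd hu, orbit]
    | succ k =>
      rw [perturbation, point_fwd hu, point_fwd hu, orbit, add_sub_cancel_left, smul_smul,
        mul_comm, half_pow_mul_two_pow, one_smul]
  have h' : Tendsto (R.perturbation (R.fwd u)) atTop (𝓝 0) := h ▸ u.tendsto_atTop
  rw [bwd, dif_pos h']
  ext k
  exact congrFun h k

end Forward

theorem continuousOn_orbit (k : ℕ) : ContinuousOn (fun u : C₀(ℕ, E) => R.orbit u k) R.fwdDom := by
  induction k with
  | zero => exact (ZeroAtInftyContinuousMap.continuous_apply 0).continuousOn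
  | succ k ih =>
    exact (R.isClosedEmbedding.continuous.comp_continuousOn
      (R.continuousOn_ret.comp ih fun u hu => orbit_mem hu k)).add
      ((ZeroAtInftyContinuousMap.continuous_apply (k + 1)).continuousOn.const_smul _)

theorem continuousOn_orbitLim : ContinuousOn (fun u : C₀(ℕ, E) => R.orbitLim u) R.fwdDom := by
  rw [R.isClosedEmbedding.isInducing.continuousOn_iff]
  have h : TendstoUniformlyOn (fun (k : ℕ) (u : C₀(ℕ, E)) => R.emb (R.ret (R.orbit u k)))
      (fun u => R.emb (R.orbitLim u)) atTop R.fwdDom := by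
    rw [Metric.tendstoUniformlyOn_iff]
    intro ε hε
    obtain ⟨n, hn⟩ := exists_pow_lt_of_lt_one (by positivity : 0 < ε / 2)
      (by norm_num : (1 / 2 : ℝ) < 1)
    refine eventually_atTop.2 ⟨n, fun k hk u hu => ?_⟩
    have h1 := norm_lim_sub_le hu (k := k) (ε := 1 / 8) fun l hl => norm_le_of_mem_fwdDom hu hl
    have h2 : (1 / 2 : ℝ) ^ k ≤ (1 / 2) ^ n :=
      pow_le_pow_of_le_one (by norm_num) (by norm_num) hk
    rw [dist_eq_norm]
    linarith
  refine h.continuousOn (Frequently.of_forall fun k => ?_)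
  exact R.isClosedEmbedding.continuous.comp_continuousOn
      (R.continuousOn_ret.comp (R.continuousOn_orbit k) fun u hu => orbit_mem hu k)

theorem continuousOn_fwd : ContinuousOn R.fwd R.fwdDom := by
  refine R.continuousOn_orbitLim.prodMk fun u hu => ContinuousAt.continuousWithinAt ?_
  have hev : ∀ᶠ v in 𝓝 u, v ∈ R.fwdDom := R.isOpen_fwdDom.mem_nhds hu
  refine ZeroAtInftyContinuousMap.continuousAt_of_tails (F := fun v => (R.fwd v).2)
    (fun k => ?_) fun ε hε => ?_
  · have h1 : ContinuousAt (fun v : C₀(ℕ, E) => R.deviation v k) u :=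
      (((R.continuousOn_orbit k).sub (R.isClosedEmbedding.continuous.comp_continuousOn
        R.continuousOn_orbitLim)).const_smul _).continuousAt (R.isOpen_fwdDom.mem_nhds hu)
    refine h1.congr ?_
    filter_upwards [hev] with v hv
    exact (fwd_snd_apply hv k).symm
  · obtain ⟨N, hN⟩ := Metric.tendsto_atTop.1 u.tendsto_atTop (ε / 66) (by positivity)
    refine ⟨N + 1, ?_⟩
    filter_upwards [hev, Metric.ball_mem_nhds u (by positivity : 0 < ε / 66)] with v hv hvu n hn
    obtain ⟨k, rfl⟩ : ∃ k, n = k + 1 := ⟨n - 1, by omega⟩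
    rw [fwd_snd_apply hv]
    have := norm_deviation_le hv (k := k) (ε := ε / 33) fun l hl => by
      have h1 := hN l (by omega)
      rw [dist_zero_right] at h1
      rw [Metric.mem_ball, dist_eq_norm] at hvu
      have h2 : ‖v l - u l‖ ≤ ‖v - u‖ := (v - u).norm_apply_le l
      have h3 := norm_add_le (v l - u l) (u l)
      rw [sub_add_cancel] at h3
      linarith
    linarith

section Backward

variable {R} {q : X × C₀(ℕ, E)} (hq : q ∈ bwdDom X E)

theorem norm_point_sub (q : X × C₀(ℕ, E)) (k : ℕ) :
    ‖R.point q k - R.emb q.1‖ = (1 / 2) ^ k * ‖q.2 k‖ := by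
  rw [point, add_sub_cancel_left, norm_half_smul]

include hq

theorem point_near (k : ℕ) : ‖R.point q k - R.emb q.1‖ < 1 / 8 := by
  rw [norm_point_sub]
  have := mul_le_mul (half_pow_le_one k) (q.2.norm_apply_le k) (norm_nonneg _) zero_le_one
  have : ‖q.2‖ < 1 / 8 := hq
  linarith

theorem norm_ret_point_sub_le (k : ℕ) :
    ‖R.emb (R.ret (R.point q k)) - R.emb q.1‖ ≤ 16 * ((1 / 2) ^ k * ‖q.2 k‖) :=
  norm_point_sub (R := R) q k ▸ R.norm_sub_le _ _ (point_near hq k)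

theorem norm_perturbation_le (k : ℕ) :
    ‖R.perturbation q (k + 1)‖ ≤ ‖q.2 (k + 1)‖ + 32 * ‖q.2 k‖ := by
  have h1 := norm_ret_point_sub_le (R := R) hq k
  rw [norm_sub_rev] at h1
  have h2 := norm_point_sub (R := R) q (k + 1)
  have h3 := norm_sub_le_norm_sub_add_norm_sub (R.point q (k + 1)) (R.emb q.1)
    (R.emb (R.ret (R.point q k)))
  have h4 : (1 / 2 : ℝ) ^ k = (1 / 2) ^ (k + 1) * 2 := by rw [pow_succ]; ring
  rw [h4] at h1
  rw [perturbation, norm_two_smul]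
  calc _ ≤ 2 ^ (k + 1) * ((1 / 2) ^ (k + 1) * (‖q.2 (k + 1)‖ + 32 * ‖q.2 k‖)) := by
        gcongr; linarith
    _ = ((1 / 2) ^ (k + 1) * 2 ^ (k + 1)) * (‖q.2 (k + 1)‖ + 32 * ‖q.2 k‖) := by ring
    _ = _ := by rw [half_pow_mul_two_pow, one_mul]

theorem tendsto_perturbation : Tendsto (R.perturbation q) atTop (𝓝 0) := by
  rw [← tendsto_add_atTop_iff_nat 1]
  refine squeeze_zero_norm (norm_perturbation_le hq) ?_
  have h1 := q.2.tendsto_atTop.norm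
  have h2 := ((tendsto_add_atTop_iff_nat 1).2 h1).add (h1.const_mul 32)
  simpa using h2

theorem bwd_apply (k : ℕ) : R.bwd q k = R.perturbation q k := by
  rw [bwd, dif_pos (tendsto_perturbation hq)]
  rfl

theorem orbit_bwd (k : ℕ) : R.orbit (R.bwd q) k = R.point q k := by
  induction k with
  | zero => rw [orbit, bwd_apply hq, perturbation]
  | succ k ih =>
    rw [orbit, ih, bwd_apply hq, perturbation, smul_smul, half_pow_mul_two_pow, one_smul]
    abel

theorem orbitLim_bwd : R.orbitLim (R.bwd q) = q.1 := by
  refine Tendsto.limUnder_eq (R.isClosedEmbedding.isInducing.tendsto_nhds_iff.2 ?_)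
  simp only [orbit_bwd hq, Function.comp_def]
  rw [tendsto_iff_norm_sub_tendsto_zero]
  refine squeeze_zero (fun _ => norm_nonneg _) (norm_ret_point_sub_le hq) ?_
  have h1 := q.2.tendsto_atTop.norm
  have h2 := tendsto_pow_atTop_nhds_zero_of_lt_one (by norm_num : (0 : ℝ) ≤ 1 / 2) (by norm_num)
  simpa using (h2.mul h1).const_mul 16

theorem fwd_bwd : R.fwd (R.bwd q) = q := by
  have h : R.deviation (R.bwd q) = q.2 := by
    funext k
    rw [deviation, orbit_bwd hq, orbitLim_bwd hq, point, add_sub_cancel_left, smul_smul, mul_comm,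
      half_pow_mul_two_pow, one_smul]
  have h' : Tendsto (R.deviation (R.bwd q)) atTop (𝓝 0) := h ▸ q.2.tendsto_atTop
  refine Prod.ext (orbitLim_bwd hq) ?_
  rw [fwd, dif_pos h']
  ext k
  exact congrFun h k

end Backward

theorem continuous_point (k : ℕ) : Continuous fun q : X × C₀(ℕ, E) => R.point q k :=
  (R.isClosedEmbedding.continuous.comp continuous_fst).add
    (((ZeroAtInftyContinuousMap.continuous_apply k).comp continuous_snd).const_smul _)

theorem continuousOn_bwd : ContinuousOn R.bwd (bwdDom X E) := by
  intro q hq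
  refine ContinuousAt.continuousWithinAt ?_
  have hev : ∀ᶠ p in 𝓝 q, p ∈ bwdDom X E := isOpen_bwdDom.mem_nhds hq
  refine ZeroAtInftyContinuousMap.continuousAt_of_tails (fun k => ?_) fun ε hε => ?_
  · have h1 : ContinuousAt (fun p => R.perturbation p k) q := by
      cases k with
      | zero => exact (R.continuous_point 0).continuousAt
      | succ k =>
        refine ((R.continuous_point (k + 1)).continuousAt.sub ?_).const_smul _
        refine ContinuousOn.continuousAt ?_ (isOpen_bwdDom.mem_nhds hq)
        exact R.isClosedEmbedding.continuous.comp_continuousOn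
          (R.continuousOn_ret.comp (R.continuous_point k).continuousOn
            fun p hp => ⟨p.1, point_near hp k⟩)
    refine h1.congr ?_
    filter_upwards [hev] with p hp
    exact (bwd_apply hp k).symm
  · obtain ⟨N, hN⟩ := Metric.tendsto_atTop.1 q.2.tendsto_atTop (ε / 66) (by positivity)
    refine ⟨N + 1, ?_⟩
    have hball : ∀ᶠ p in 𝓝 q, p.2 ∈ Metric.ball q.2 (ε / 66) :=
      continuous_snd.continuousAt.preimage_mem_nhds (Metric.ball_mem_nhds _ (by positivity))
    filter_upwards [hev, hball] with p hp hpq n hn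
    obtain ⟨k, rfl⟩ : ∃ k, n = k + 1 := ⟨n - 1, by omega⟩
    rw [bwd_apply hp]
    have key : ∀ l ≥ N, ‖p.2 l‖ ≤ ε / 33 := fun l hl => by
      have h1 := hN l hl
      rw [dist_zero_right] at h1
      rw [Metric.mem_ball, dist_eq_norm] at hpq
      have h2 : ‖p.2 l - q.2 l‖ ≤ ‖p.2 - q.2‖ := (p.2 - q.2).norm_apply_le l
      have h3 := norm_add_le (p.2 l - q.2 l) (q.2 l)
      rw [sub_add_cancel] at h3
      linarith
    linarith [norm_perturbation_le (R := R) hp k, key k (by omega), key (k + 1) (by omega)]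

/-- The local homeomorphism between `X × 𝓛` and `𝓛`. -/
noncomputable def partialHomeo : OpenPartialHomeomorph (X × C₀(ℕ, E)) C₀(ℕ, E) where
  toFun := R.bwd
  invFun := R.fwd
  source := bwdDom X E ∩ R.bwd ⁻¹' R.fwdDom
  target := R.fwdDom ∩ R.fwd ⁻¹' bwdDom X E
  map_source' q hq := ⟨hq.2, by rw [Set.mem_preimage, fwd_bwd hq.1]; exact hq.1⟩
  map_target' u hu := ⟨hu.2, by rw [Set.mem_preimage, bwd_fwd hu.1]; exact hu.1⟩
  left_inv' q hq := fwd_bwd hq.1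
  right_inv' u hu := bwd_fwd hu.1
  open_source := R.continuousOn_bwd.isOpen_inter_preimage isOpen_bwdDom R.isOpen_fwdDom
  open_target := R.continuousOn_fwd.isOpen_inter_preimage R.isOpen_fwdDom isOpen_bwdDom
  continuousOn_toFun := R.continuousOn_bwd.mono Set.inter_subset_left
  continuousOn_invFun := R.continuousOn_fwd.mono Set.inter_subset_left

theorem mem_partialHomeo_source (x : X) : (x, 0) ∈ R.partialHomeo.source := by
  have hq : ((x, 0) : X × C₀(ℕ, E)) ∈ bwdDom X E := by simp [bwdDom]
  refine ⟨hq, x, ?_, 0, by norm_num, fun k => ?_⟩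
  · rw [bwd_apply hq, perturbation, norm_point_sub]
    simp
  · rw [bwd_apply hq]
    refine (norm_perturbation_le hq k).trans ?_
    simp

end LipRetraction

end

section

open Filter Topology TopologicalSpace
open scoped ZeroAtInfty

section ZeroAtInftyDiscrete

variable {α β E : Type*} [TopologicalSpace α] [DiscreteTopology α] [TopologicalSpace β]
  [DiscreteTopology β] [NormedAddCommGroup E]

namespace ZeroAtInftyContinuousMap

theorem finite_le_norm (f : C₀(α, E)) {ε : ℝ} (hε : 0 < ε) : {a | ε ≤ ‖f a‖}.Finite := by
  have h := zero_at_infty f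
  rw [cocompact_eq_cofinite] at h
  have := (tendsto_zero_iff_norm_tendsto_zero.1 h).eventually (gt_mem_nhds hε)
  simpa [Filter.eventually_cofinite, not_lt] using this

theorem finite_le_norm_comp {γ : Type*} {φ : γ → α} (f : C₀(α, E)) (hφ : φ.Injective) {ε : ℝ}
    (hε : 0 < ε) : {c | ε ≤ ‖f (φ c)‖}.Finite :=
  Set.Finite.preimage (s := {a | ε ≤ ‖f a‖}) hφ.injOn (f.finite_le_norm hε)

/-- A function on a discrete space whose super-level sets are finite vanishes at infinity. -/
noncomputable def ofFinite (f : α → E) (h : ∀ ε > 0, {a | ε ≤ ‖f a‖}.Finite) : C₀(α, E) where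
  toFun := f
  continuous_toFun := continuous_of_discreteTopology
  zero_at_infty' := by
    rw [cocompact_eq_cofinite, tendsto_zero_iff_norm_tendsto_zero]
    refine tendsto_order.2 ⟨fun a ha => .of_forall fun x => ha.trans_le (norm_nonneg _),
      fun a ha => ?_⟩
    simpa [Filter.eventually_cofinite, not_lt] using h a ha

@[simp] theorem ofFinite_apply (f : α → E) (h) (a : α) : ofFinite f h a = f a := rfl

theorem dist_apply_le {α : Type*} [TopologicalSpace α] (f g : C₀(α, E)) (a : α) :
    dist (f a) (g a) ≤ dist f g := by
  simpa [dist_eq_norm] using (f - g).norm_apply_le a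

theorem dist_le_of_forall {α : Type*} [TopologicalSpace α] {f g : C₀(α, E)} {C : ℝ} (hC : 0 ≤ C)
    (h : ∀ a, dist (f a) (g a) ≤ C) : dist f g ≤ C := by
  rw [dist_eq_norm]
  exact norm_le_of_forall hC fun a => by simpa [dist_eq_norm] using h a

/-- Reindexing of functions vanishing at infinity on discrete spaces. -/
noncomputable def reindex (e : α ≃ β) : C₀(α, E) ≃ₜ C₀(β, E) where
  toFun f := ofFinite (fun b => f (e.symm b)) fun ε hε =>
    f.finite_le_norm_comp e.symm.injective hε
  invFun f := ofFinite (fun a => f (e a)) fun ε hε =>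
    f.finite_le_norm_comp e.injective hε
  left_inv f := by ext; simp
  right_inv f := by ext; simp
  continuous_toFun := (LipschitzWith.mk_one fun f g =>
    dist_le_of_forall dist_nonneg fun b => dist_apply_le f g (e.symm b)).continuous
  continuous_invFun := (LipschitzWith.mk_one fun f g =>
    dist_le_of_forall dist_nonneg fun a => dist_apply_le f g (e a)).continuous

/-- Functions vanishing at infinity on a disjoint union. -/
noncomputable def sumHomeo : C₀(α ⊕ β, E) ≃ₜ C₀(α, E) × C₀(β, E) where
  toFun f := (ofFinite (fun a => f (.inl a)) fun ε hε =>
      f.finite_le_norm_comp Sum.inl_injective hε,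
    ofFinite (fun a => f (.inr a)) fun ε hε =>
      f.finite_le_norm_comp Sum.inr_injective hε)
  invFun f := ofFinite (Sum.elim f.1 f.2) fun ε hε => by
    refine (((f.1.finite_le_norm hε).image Sum.inl).union
      ((f.2.finite_le_norm hε).image Sum.inr)).subset ?_
    rintro (a | a) h
    · exact .inl ⟨a, h, rfl⟩
    · exact .inr ⟨a, h, rfl⟩
  left_inv f := by ext (a | a) <;> rfl
  right_inv f := by ext <;> rfl
  continuous_toFun := (LipschitzWith.mk_one fun f g =>
      dist_le_of_forall dist_nonneg fun b => dist_apply_le f g (.inl b)).continuous.prodMk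
    (LipschitzWith.mk_one fun f g =>
      dist_le_of_forall dist_nonneg fun b => dist_apply_le f g (.inr b)).continuous
  continuous_invFun := (LipschitzWith.mk_one fun f g =>
    dist_le_of_forall dist_nonneg fun b => by
      obtain a | a := b
      · exact (dist_apply_le f.1 g.1 a).trans (le_max_left _ _)
      · exact (dist_apply_le f.2 g.2 a).trans (le_max_right _ _)).continuous

/-- Currying of functions vanishing at infinity on discrete spaces. -/
noncomputable def curryHomeo : C₀(α × β, E) ≃ₜ C₀(α, C₀(β, E)) where
  toFun f := ofFinite (fun a => ofFinite (fun b => f (a, b)) fun ε hε =>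
      f.finite_le_norm_comp (Prod.mk_right_injective a) hε) fun ε hε => by
    refine ((f.finite_le_norm (half_pos hε)).image Prod.fst).subset fun a ha => ?_
    by_contra hcon
    refine (half_lt_self hε).not_ge (le_trans (b := _) ha (norm_le_of_forall (half_pos hε).le
      fun b => ?_))
    by_contra hb
    exact hcon ⟨(a, b), (not_le.1 hb).le, rfl⟩
  invFun f := ofFinite (fun p => f p.1 p.2) fun ε hε => by
    refine ((f.finite_le_norm hε).biUnion fun a _ =>
      ((f a).finite_le_norm hε).image (Prod.mk a)).subset fun p hp => ?_
    simp only [Set.mem_iUnion]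
    exact ⟨p.1, hp.trans (norm_apply_le _ _), p.2, hp, rfl⟩
  left_inv f := by ext; rfl
  right_inv f := by ext; rfl
  continuous_toFun := (LipschitzWith.mk_one fun f g =>
    dist_le_of_forall dist_nonneg fun a => dist_le_of_forall dist_nonneg fun b =>
      dist_apply_le f g _).continuous
  continuous_invFun := (LipschitzWith.mk_one fun f g =>
    dist_le_of_forall dist_nonneg fun p =>
      (dist_apply_le (f p.1) (g p.1) p.2).trans (dist_apply_le f g p.1)).continuous

end ZeroAtInftyContinuousMap

end ZeroAtInftyDiscrete

/-- The iterated sequence space is homeomorphic to `c₀`. -/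
noncomputable def iteratedHomeo : C₀(ℕ, C₀(ℕ × ℕ, ℝ)) ≃ₜ C₀(ℕ, ℝ) :=
  ZeroAtInftyContinuousMap.curryHomeo.symm.trans
    (ZeroAtInftyContinuousMap.reindex
      ((Equiv.prodCongr (.refl ℕ) Nat.pairEquiv).trans Nat.pairEquiv))

/-- `c₀` is homeomorphic to its square. -/
noncomputable def squareHomeo : C₀(ℕ, ℝ) ≃ₜ C₀(ℕ, ℝ) × C₀(ℕ, ℝ) :=
  (ZeroAtInftyContinuousMap.reindex Equiv.natSumNatEquivNat.symm).trans
    ZeroAtInftyContinuousMap.sumHomeo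

/-- A space with a `c₀`-ball factor absorbs the iterated sequence space. -/
noncomputable def absorbHomeo {Ω S : Type*} [TopologicalSpace Ω] [TopologicalSpace S]
    (e : Ω ≃ₜ S × Metric.ball (0 : C₀(ℕ, ℝ)) 1) : Ω ≃ₜ Ω × C₀(ℕ, C₀(ℕ × ℕ, ℝ)) :=
  let b : S × Metric.ball (0 : C₀(ℕ, ℝ)) 1 ≃ₜ S × C₀(ℕ, ℝ) :=
    (Homeomorph.refl S).prodCongr Homeomorph.unitBall.symm
  let e' := e.trans b
  e'.trans <| ((Homeomorph.refl S).prodCongr squareHomeo).trans <|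
    (Homeomorph.prodAssoc _ _ _).symm.trans <| e'.symm.prodCongr iteratedHomeo.symm

/-- A homogeneous Polish ANR with a nonempty open set having a `c₀`-ball factor is an
`ℓ₂`-manifold. -/
theorem isL2Manifold_of_isANR_of_ball_factor {G : Type u} [TopologicalSpace G] [PolishSpace G]
    (hG : IsANR G) (hom : ∀ x y : G, ∃ e : G ≃ₜ G, e x = y) {Ω : Set G} (hΩ : IsOpen Ω)
    (hne : Ω.Nonempty) {S : Type*} [TopologicalSpace S]
    (e : Ω ≃ₜ S × Metric.ball (0 : C₀(ℕ, ℝ)) 1) : IsL2Manifold G := by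
  let _ := upgradeIsCompletelyMetrizable G
  obtain ⟨p, hp⟩ := hne
  have : Nonempty G := ⟨p⟩
  obtain ⟨R⟩ := exists_lipRetraction hG
  have : Nonempty Ω := ⟨⟨p, hp⟩⟩
  let i := hΩ.isOpenEmbedding_subtypeVal.toOpenPartialHomeomorph
  have hj : IsOpenEmbedding (Prod.map (Subtype.val : Ω → G) (id : C₀(ℕ, C₀(ℕ × ℕ, ℝ)) → _)) :=
    hΩ.isOpenEmbedding_subtypeVal.prodMap IsOpenEmbedding.id
  let j := hj.toOpenPartialHomeomorph
  let ψ : OpenPartialHomeomorph G ell2 :=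
    ((i.symm.trans (absorbHomeo e).toOpenPartialHomeomorph).trans (j.trans R.partialHomeo)).trans
      (iteratedHomeo.trans CZeroHomeo.homeoEll2).toOpenPartialHomeomorph
  let g : Ω := (absorbHomeo e).symm (⟨p, hp⟩, 0)
  have hg : (g : G) ∈ ψ.source := by
    have hgi : i.symm (g : G) = g := by
      have := i.left_inv (x := g) (by simp [i])
      simpa [i] using this
    simp only [ψ, OpenPartialHomeomorph.trans_source, Homeomorph.toOpenPartialHomeomorph_source,
      Set.preimage_univ, Set.inter_univ, Set.mem_inter_iff, Set.mem_preimage,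
      OpenPartialHomeomorph.symm_source, OpenPartialHomeomorph.coe_trans, Function.comp_apply, hgi]
    refine ⟨by simp [i], by simp [j], ?_⟩
    have : (absorbHomeo e) g = (⟨p, hp⟩, 0) := (absorbHomeo e).apply_symm_apply _
    simp only [Homeomorph.toOpenPartialHomeomorph_apply, this, j]
    exact R.mem_partialHomeo_source p
  refine ⟨inferInstance, inferInstance, fun x => ?_⟩
  obtain ⟨t, ht⟩ := hom x g
  let χ := t.toOpenPartialHomeomorph.trans ψ
  refine ⟨χ.source, χ.open_source, ?_, χ.target, χ.open_target, ⟨χ.toHomeomorphSourceTarget⟩⟩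
  simp [χ, ht, hg]

end

section

open Filter Topology TopologicalSpace MeasureTheory

theorem polishSpace_of_locallyCompactSpace (M : Type*) [TopologicalSpace M] [LocallyCompactSpace M]
    [SeparableSpace M] [MetrizableSpace M] : PolishSpace M := by
  let _ := metrizableSpaceMetric M
  have hd := UniformSpace.Completion.isDenseEmbedding_coe (α := M)
  have hopen : IsOpen (Set.range ((↑) : M → UniformSpace.Completion M)) := by
    rw [isOpen_iff_mem_nhds]
    rintro _ ⟨x, rfl⟩
    obtain ⟨C, hC, hxC⟩ := exists_compact_mem_nhds x
    have hmem : C ∈ comap ((↑) : M → UniformSpace.Completion M) (𝓝 (x : UniformSpace.Completion M)) := by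
      rwa [← hd.isInducing.nhds_eq_comap]
    obtain ⟨O, hO, hOC⟩ := hmem
    obtain ⟨O', hO'O, hO', hxO'⟩ := mem_nhds_iff.1 hO
    refine mem_of_superset (hO'.mem_nhds hxO') ?_
    have hcl : IsClosed (((↑) : M → UniformSpace.Completion M) '' C) :=
      (hC.image hd.continuous).isClosed
    calc O' ⊆ closure (O' ∩ Set.range ((↑) : M → UniformSpace.Completion M)) :=
          hd.dense.open_subset_closure_inter hO'
      _ ⊆ ((↑) : M → UniformSpace.Completion M) '' C := by
          refine closure_minimal ?_ hcl
          rintro _ ⟨hy, y, rfl⟩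
          exact ⟨y, hOC (hO'O hy), rfl⟩
      _ ⊆ _ := Set.image_subset_range _ _
  have := hopen.polishSpace
  exact hd.isEmbedding.toHomeomorph.isClosedEmbedding.polishSpace

section HomeoGroup

variable {M : Type*} [TopologicalSpace M]

/-- The inverse of a homeomorphism, as a continuous map. -/
noncomputable def homeoInv (f : {f : C(M, M) // IsHomeomorph f}) : C(M, M) :=
  ⟨(f.2.homeomorph f.1).symm, (f.2.homeomorph f.1).symm.continuous⟩

theorem homeoInv_apply_self (f : {f : C(M, M) // IsHomeomorph f}) (x : M) :
    homeoInv f (f.1 x) = x := (f.2.homeomorph f.1).symm_apply_apply x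

theorem self_apply_homeoInv (f : {f : C(M, M) // IsHomeomorph f}) (x : M) :
    f.1 (homeoInv f x) = x := (f.2.homeomorph f.1).apply_symm_apply x

theorem continuous_homeoInv [T2Space M] [LocallyCompactSpace M] [LocallyConnectedSpace M] :
    Continuous (homeoInv (M := M)) := by
  refine ContinuousMap.continuous_of_continuous_uncurry _ ?_
  rw [continuous_iff_continuousAt]
  rintro ⟨f₀, y₀⟩
  set x₀ := homeoInv f₀ y₀ with hx₀
  have hy₀ : f₀.1 x₀ = y₀ := self_apply_homeoInv f₀ y₀
  intro O hO
  change O ∈ 𝓝 x₀ at hO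
  obtain ⟨C, hCx, hCO, hC⟩ := LocallyCompactSpace.local_compact_nhds x₀ O hO
  have hfr : IsCompact (frontier C) := hC.of_isClosed_subset isClosed_frontier
    hC.isClosed.frontier_subset
  have hy₀fr : (f₀.1 '' frontier C)ᶜ ∈ 𝓝 y₀ := by
    refine (hfr.image f₀.1.continuous).isClosed.isOpen_compl.mem_nhds ?_
    rintro ⟨x, hx, hxy⟩
    have : x = x₀ := f₀.2.injective (hxy.trans hy₀.symm)
    exact hx.2 (this ▸ mem_interior_iff_mem_nhds.2 hCx)
  obtain ⟨D, hDy, hDfr, hD⟩ := LocallyCompactSpace.local_compact_nhds y₀ _ hy₀fr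
  obtain ⟨V, hVD, hVo, hyV, hVc⟩ := locallyConnectedSpace_iff_subsets_isOpen_isConnected.1
    inferInstance y₀ D hDy
  have h1 : ∀ᶠ f : {f : C(M, M) // IsHomeomorph f} in 𝓝 f₀, Set.MapsTo f.1 (frontier C) Dᶜ :=
    continuous_subtype_val.continuousAt.eventually (ContinuousMap.eventually_mapsTo hfr
      hD.isClosed.isOpen_compl fun x hx hxD => hDfr hxD ⟨x, hx, rfl⟩)
  have h2 : ∀ᶠ f : {f : C(M, M) // IsHomeomorph f} in 𝓝 f₀, f.1 x₀ ∈ V := by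
    have : Continuous fun f : {f : C(M, M) // IsHomeomorph f} => f.1 x₀ :=
      (continuous_eval_const x₀).comp continuous_subtype_val
    exact this.continuousAt.eventually (hVo.mem_nhds (show f₀.1 x₀ ∈ V from hy₀.symm ▸ hyV))
  change ∀ᶠ p : {f : C(M, M) // IsHomeomorph f} × M in 𝓝 (f₀, y₀), homeoInv p.1 p.2 ∈ O
  filter_upwards [(h1.and h2).prodMk_nhds (hVo.mem_nhds hyV)] with p hp
  obtain ⟨⟨hp1, hp2⟩, hpV⟩ := hp
  refine hCO ?_
  by_contra hcon
  have hconn : IsPreconnected (homeoInv p.1 '' V) :=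
    hVc.isPreconnected.image _ (homeoInv p.1).continuous.continuousOn
  obtain ⟨x, -, hx, hx'⟩ := hconn (interior C) Cᶜ isOpen_interior hC.isClosed.isOpen_compl (by
      rintro _ ⟨y, hyV, rfl⟩
      by_cases hy : homeoInv p.1 y ∈ C
      · refine .inl ?_
        by_contra hyi
        have := hp1 (hC.isClosed.frontier_eq ▸ ⟨hy, hyi⟩ : homeoInv p.1 y ∈ frontier C)
        rw [self_apply_homeoInv] at this
        exact this (hVD hyV)
      · exact .inr hy)
    ⟨x₀, ⟨p.1.1 x₀, hp2, homeoInv_apply_self _ _⟩, mem_interior_iff_mem_nhds.2 hCx⟩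
    ⟨homeoInv p.1 p.2, ⟨p.2, hpV, rfl⟩, hcon⟩
  exact hx' (interior_subset hx)

end HomeoGroup

section MeasurePreserving

variable {M : Type*} [TopologicalSpace M] [MeasurableSpace M] [BorelSpace M] [LocallyCompactSpace M]
  [SecondCountableTopology M] [MetrizableSpace M] {X : Set M} {μ : Measure M}
  [IsFiniteMeasureOnCompacts μ]

theorem isClosed_measure_le_image {K : Set M} (hK : IsCompact K) :
    IsClosed {f : C(M, M) | μ K ≤ μ (f '' K)} := by
  rw [← isOpen_compl_iff, isOpen_iff_mem_nhds]
  intro f hf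
  have hf : μ (f '' K) < μ K := not_le.1 hf
  obtain ⟨U, hKU, hU, hμU⟩ := (f '' K).exists_isOpen_lt_of_lt _ hf
  filter_upwards [ContinuousMap.eventually_mapsTo hK hU (Set.mapsTo_iff_image_subset.2 hKU)]
    with g hg
  exact not_le.2 ((measure_mono (Set.mapsTo_iff_image_subset.1 hg)).trans_lt hμU)

theorem map_eq_of_measure_le_image {f g : C(M, M)} (hfg : ∀ x, f (g x) = x) (hgf : ∀ x, g (f x) = x)
    (hf : ∀ K, IsCompact K → μ K ≤ μ (f '' K)) (hg : ∀ K, IsCompact K → μ K ≤ μ (g '' K)) :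
    μ.map f = μ := by
  have himg : ∀ A, f ⁻¹' A = g '' A := fun A =>
    (Set.image_eq_preimage_of_inverse hfg hgf ▸ rfl)
  have hc : ∀ K, IsCompact K → μ.map f K = μ K := by
    intro K hK
    rw [Measure.map_apply f.continuous.measurable hK.measurableSet, himg]
    refine le_antisymm ?_ (hg K hK)
    have := hf _ (hK.image g.continuous)
    rwa [Set.image_image, Set.image_congr fun x _ => hfg x, Set.image_id'] at this
  have : IsFiniteMeasureOnCompacts (μ.map f) := ⟨fun K hK => by
    rw [hc K hK]; exact hK.measure_lt_top⟩
  ext A hA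
  rw [hA.measure_eq_iSup_isCompact, hA.measure_eq_iSup_isCompact]
  exact iSup_congr fun K => iSup_congr fun _ => iSup_congr fun hK => hc K hK

theorem measure_image_of_map_eq {f g : C(M, M)} (hgf : ∀ x, g (f x) = x)
    (hf : μ.map f = μ) {K : Set M} (hK : IsCompact K) : μ (f '' K) = μ K := by
  have h := Measure.map_apply (μ := μ) f.continuous.measurable
    (hK.image f.continuous).measurableSet
  rw [hf] at h
  rw [h, Set.preimage_image_eq _ (Function.LeftInverse.injective hgf)]

theorem measure_image_inv_of_map_eq {f g : C(M, M)} (hfg : ∀ x, f (g x) = x)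
    (hgf : ∀ x, g (f x) = x) (hf : μ.map f = μ) {K : Set M} (hK : IsCompact K) :
    μ (g '' K) = μ K := by
  have h := Measure.map_apply (μ := μ) f.continuous.measurable hK.measurableSet
  rw [hf] at h
  rw [h, ← Set.image_eq_preimage_of_inverse hfg hgf]

theorem mpHomeoFixSet_polishSpace [LocallyConnectedSpace M] :
    PolishSpace (MPHomeoFixSet M X μ) := by
  have := polishSpace_of_locallyCompactSpace M
  have hC : PolishSpace C(M, M) := by
    let _ := upgradeIsCompletelyMetrizable M
    have : IsCompletelyMetrizableSpace C(M, M) := inferInstance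
    infer_instance
  let i : MPHomeoFixSet M X μ → {f : C(M, M) // IsHomeomorph f} := fun f => ⟨f.1, f.2.1⟩
  have hi : Continuous i := continuous_subtype_val.subtype_mk _
  let Φ : MPHomeoFixSet M X μ → C(M, M) × C(M, M) := fun f => (f.1, homeoInv (i f))
  have hΦ : Continuous Φ := continuous_subtype_val.prodMk (continuous_homeoInv.comp hi)
  have hemb : IsEmbedding Φ := IsEmbedding.of_comp hΦ continuous_fst IsEmbedding.subtypeVal
  refine IsClosedEmbedding.polishSpace (f := Φ) ⟨hemb, ?_⟩
  have hrange : Set.range Φ = {p | p.1.comp p.2 = .id M} ∩ {p | p.2.comp p.1 = .id M} ∩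
      {p | ∀ x ∈ X, p.1 x = x} ∩ {p | ∀ K, IsCompact K → μ K ≤ μ (p.1 '' K)} ∩
      {p | ∀ K, IsCompact K → μ K ≤ μ (p.2 '' K)} := by
    ext ⟨f, g⟩
    constructor
    · rintro ⟨f, h⟩
      obtain ⟨rfl, rfl⟩ := Prod.mk.inj h
      have h1 := self_apply_homeoInv (i f)
      have h2 := homeoInv_apply_self (i f)
      exact ⟨⟨⟨⟨ContinuousMap.ext h1, ContinuousMap.ext h2⟩, f.2.2.1⟩,
        fun K hK => (measure_image_of_map_eq h2 f.2.2.2 hK).ge⟩,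
        fun K hK => (measure_image_inv_of_map_eq h1 h2 f.2.2.2 hK).ge⟩
    · rintro ⟨⟨⟨⟨h1, h2⟩, h3⟩, h4⟩, h5⟩
      replace h1 : ∀ x, f (g x) = x := fun x => DFunLike.congr_fun h1 x
      replace h2 : ∀ x, g (f x) = x := fun x => DFunLike.congr_fun h2 x
      have hf : IsHomeomorph f := (Homeomorph.mk ⟨f, g, h2, h1⟩ f.2 g.2).isHomeomorph
      refine ⟨⟨f, hf, h3, map_eq_of_measure_le_image h1 h2 h4 h5⟩, Prod.ext rfl ?_⟩
      ext x
      exact hf.injective ((self_apply_homeoInv ⟨f, hf⟩ x).trans (h1 x).symm)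
  rw [hrange]
  refine ((((isClosed_eq (ContinuousMap.continuous_comp'.comp continuous_swap)
    continuous_const).inter (isClosed_eq ContinuousMap.continuous_comp' continuous_const)).inter
    ?_).inter ?_).inter ?_
  · simp only [Set.ofPred_forall]
    exact isClosed_iInter fun x => isClosed_iInter fun _ =>
      isClosed_eq ((continuous_eval_const x).comp continuous_fst) continuous_const
  · simp only [Set.ofPred_forall]
    exact isClosed_iInter fun K => isClosed_iInter fun hK =>
      (isClosed_measure_le_image hK).preimage continuous_fst
  · simp only [Set.ofPred_forall]
    exact isClosed_iInter fun K => isClosed_iInter fun hK =>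
      (isClosed_measure_le_image hK).preimage continuous_snd

omit [LocallyCompactSpace M] [SecondCountableTopology M] [MetrizableSpace M]
  [IsFiniteMeasureOnCompacts μ]

theorem comp_mem_mpHomeoFixSet {f g : C(M, M)} (hf : f ∈ MPHomeoFixSet M X μ)
    (hg : g ∈ MPHomeoFixSet M X μ) : f.comp g ∈ MPHomeoFixSet M X μ := by
  refine ⟨hf.1.comp hg.1, fun x hx => ?_, ?_⟩
  · rw [ContinuousMap.comp_apply, hg.2.1 x hx, hf.2.1 x hx]
  · rw [ContinuousMap.coe_comp, ← Measure.map_map f.continuous.measurable g.continuous.measurable,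
      hg.2.2, hf.2.2]

theorem inv_mem_mpHomeoFixSet {f g : C(M, M)} (hf : f ∈ MPHomeoFixSet M X μ)
    (hfg : ∀ x, f (g x) = x) (hgf : ∀ x, g (f x) = x) : g ∈ MPHomeoFixSet M X μ := by
  refine ⟨(Homeomorph.mk ⟨g, f, hfg, hgf⟩ g.2 f.2).isHomeomorph, fun x hx => ?_, ?_⟩
  · rw [← hf.2.1 x hx, hgf, hf.2.1 x hx]
  · conv_lhs => rw [← hf.2.2]
    rw [Measure.map_map g.continuous.measurable f.continuous.measurable]
    have : g ∘ f = id := funext hgf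
    rw [this, Measure.map_id]

theorem exists_homeomorph_mpHomeoFixSet (f g : MPHomeoFixSet M X μ) :
    ∃ e : MPHomeoFixSet M X μ ≃ₜ MPHomeoFixSet M X μ, e f = g := by
  have hf := inv_mem_mpHomeoFixSet f.2 (self_apply_homeoInv ⟨f.1, f.2.1⟩)
    (homeoInv_apply_self ⟨f.1, f.2.1⟩)
  have hg := inv_mem_mpHomeoFixSet g.2 (self_apply_homeoInv ⟨g.1, g.2.1⟩)
    (homeoInv_apply_self ⟨g.1, g.2.1⟩)
  let t (h : C(M, M)) (hh : h ∈ MPHomeoFixSet M X μ) (k : MPHomeoFixSet M X μ) :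
    MPHomeoFixSet M X μ := ⟨h.comp k.1, comp_mem_mpHomeoFixSet hh k.2⟩
  have ht (h : C(M, M)) (hh : h ∈ MPHomeoFixSet M X μ) : Continuous (t h hh) :=
    ((ContinuousMap.continuous_postcomp h).comp continuous_subtype_val).subtype_mk _
  refine ⟨⟨⟨fun k => t g.1 g.2 (t _ hf k), fun k => t f.1 f.2 (t _ hg k), fun k => ?_,
    fun k => ?_⟩, (ht g.1 g.2).comp (ht _ hf), (ht f.1 f.2).comp (ht _ hg)⟩, ?_⟩
  · ext x
    exact (congrArg f.1 (homeoInv_apply_self ⟨g.1, g.2.1⟩ _)).trans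
      (self_apply_homeoInv ⟨f.1, f.2.1⟩ _)
  · ext x
    exact (congrArg g.1 (homeoInv_apply_self ⟨f.1, f.2.1⟩ _)).trans
      (self_apply_homeoInv ⟨g.1, g.2.1⟩ _)
  · ext x
    exact congrArg g.1 (homeoInv_apply_self ⟨f.1, f.2.1⟩ x)

end MeasurePreserving

end

section

open Filter Topology TopologicalSpace MeasureTheory
open scoped ZeroAtInfty

namespace PlaneRotation

variable {ι : Type*} [Fintype ι] [DecidableEq ι] (i j : ι)

/-- The complex number formed by the coordinates `i` and `j`. -/
def toC (y : ι → ℝ) : ℂ := ⟨y i, y j⟩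

/-- Replace the coordinates `i` and `j` by the real and imaginary part of a complex number. -/
def setC (y : ι → ℝ) (z : ℂ) : ι → ℝ := Function.update (Function.update y i z.re) j z.im

/-- The square of the Euclidean norm. -/
def sq (y : ι → ℝ) : ℝ := ∑ k, y k ^ 2

/-- Multiplication of the `i`-`j`-plane by a complex number. -/
def rot (a : ℂ) (y : ι → ℝ) : ι → ℝ := setC i j y (a * toC i j y)

omit [Fintype ι] [DecidableEq ι] in
theorem continuous_toC : Continuous (toC i j) := by
  have : toC i j = fun y => (y i : ℂ) + y j * Complex.I := by
    ext1 y; apply Complex.ext <;> simp [toC]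
  rw [this]
  fun_prop

omit [Fintype ι] in
theorem continuous_setC : Continuous fun p : (ι → ℝ) × ℂ => setC i j p.1 p.2 :=
  (continuous_fst.update i (Complex.continuous_re.comp continuous_snd)).update j
    (Complex.continuous_im.comp continuous_snd)

omit [DecidableEq ι] in
theorem continuous_sq : Continuous (sq (ι := ι)) :=
  continuous_finsetSum _ fun k _ => (continuous_apply k).pow 2

omit [Fintype ι] in
theorem continuous_rot : Continuous fun p : ℂ × (ι → ℝ) => rot i j p.1 p.2 :=
  (continuous_setC i j).comp (continuous_snd.prodMk
    (continuous_fst.mul ((continuous_toC i j).comp continuous_snd)))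

variable {i j} (hij : i ≠ j)
include hij

omit [Fintype ι] in
theorem toC_setC (y : ι → ℝ) (z : ℂ) : toC i j (setC i j y z) = z := by
  apply Complex.ext <;> simp [toC, setC, Function.update_of_ne hij]

omit [Fintype ι] in
theorem setC_setC (y : ι → ℝ) (z w : ℂ) : setC i j (setC i j y z) w = setC i j y w := by
  ext k
  by_cases hk : k = j
  · subst hk; simp [setC]
  by_cases hk' : k = i
  · subst hk'; simp [setC, Function.update_of_ne hij]
  simp [setC, hk, hk']

omit [Fintype ι] hij in
theorem setC_toC (y : ι → ℝ) : setC i j y (toC i j y) = y := by simp [setC, toC]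

omit [Fintype ι] in
theorem rot_rot (a b : ℂ) (y : ι → ℝ) : rot i j a (rot i j b y) = rot i j (a * b) y := by
  rw [rot, rot, toC_setC hij, setC_setC hij, rot, mul_assoc]

omit [Fintype ι] hij in
theorem rot_one (y : ι → ℝ) : rot i j 1 y = y := by rw [rot, one_mul, setC_toC]

theorem sq_setC (y : ι → ℝ) (z : ℂ) :
    sq (setC i j y z) = Complex.normSq z + ∑ k ∈ (Finset.univ.erase j).erase i, y k ^ 2 := by
  rw [sq, ← Finset.add_sum_erase _ _ (Finset.mem_univ j),
    ← Finset.add_sum_erase _ _ (Finset.mem_erase.2 ⟨hij, Finset.mem_univ i⟩), ← add_assoc]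
  congr 1
  · simp [setC, Function.update_of_ne hij, Complex.normSq_apply]; ring
  · refine Finset.sum_congr rfl fun k hk => ?_
    simp only [Finset.mem_erase, Finset.mem_univ, and_true] at hk
    simp [setC, hk.1, hk.2]

theorem sq_rot {a : ℂ} (ha : ‖a‖ = 1) (y : ι → ℝ) : sq (rot i j a y) = sq y := by
  conv_rhs => rw [← setC_toC (i := i) (j := j) y]
  rw [rot, sq_setC hij, sq_setC hij, map_mul, Complex.normSq_eq_norm_sq a, ha]
  simp

omit [Fintype ι] hij in
/-- A real linear endomorphism of `ℂ`, extended to the `i`-`j`-plane. -/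
noncomputable def extend (L : ℂ →ₗ[ℝ] ℂ) (i j : ι) : (ι → ℝ) →ₗ[ℝ] (ι → ℝ) where
  toFun y := setC i j y (L (toC i j y))
  map_add' x y := by
    have : toC i j (x + y) = toC i j x + toC i j y := by apply Complex.ext <;> simp [toC]
    rw [this, map_add]
    ext k
    by_cases hk : k = j
    · subst hk; simp [setC]
    by_cases hk' : k = i
    · subst hk'; simp [setC, Function.update_of_ne hk]
    simp [setC, hk, hk']
  map_smul' c x := by
    have : toC i j (c • x) = c • toC i j x := by apply Complex.ext <;> simp [toC]
    rw [this, map_smul]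
    ext k
    by_cases hk : k = j
    · subst hk; simp [setC]
    by_cases hk' : k = i
    · subst hk'; simp [setC, Function.update_of_ne hk]
    simp [setC, hk, hk']

theorem measurePreserving_extend {L : ℂ →ₗ[ℝ] ℂ} (hL : ∀ z, L (L z) = z) :
    MeasurePreserving (extend L i j) := by
  have hinv : extend L i j ∘ₗ extend L i j = LinearMap.id := by
    ext1 k
    ext1
    simp only [extend, LinearMap.comp_apply, LinearMap.coe_mk, AddHom.coe_mk, toC_setC hij, hL,
      setC_setC hij, setC_toC, LinearMap.id_apply]
  have hdet : LinearMap.det (extend L i j) * LinearMap.det (extend L i j) = 1 := by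
    rw [← LinearMap.det_comp, hinv, LinearMap.det_id]
  have habs : |(LinearMap.det (extend L i j))⁻¹| = 1 := by
    rcases mul_self_eq_one_iff.1 hdet with h | h <;> simp [h]
  refine ⟨(LinearMap.continuous_of_finiteDimensional _).measurable, ?_⟩
  rw [Real.map_linearMap_volume_pi_eq_smul_volume_pi (left_ne_zero_of_mul_eq_one hdet), habs]
  simp

theorem measurePreserving_rot {a : ℂ} (ha : ‖a‖ = 1) : MeasurePreserving (rot (ι := ι) i j a) := by
  let conjL : ℂ →ₗ[ℝ] ℂ := Complex.conjAe.toLinearMap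
  let L : ℂ →ₗ[ℝ] ℂ := (LinearMap.mulLeft ℝ a).comp conjL
  have h1 : ∀ z, conjL (conjL z) = z := fun z => by simp [conjL]
  have h2 : ∀ z, L (L z) = z := fun z => by
    simp only [L, conjL, LinearMap.comp_apply, LinearMap.mulLeft_apply, AlgEquiv.toLinearMap_apply,
      Complex.conjAe_coe, map_mul, Complex.conj_conj, ← mul_assoc, Complex.mul_conj,
      Complex.normSq_eq_norm_sq, ha]
    simp
  have := (measurePreserving_extend hij h2).comp (measurePreserving_extend hij h1)
  convert this using 1
  ext1 y
  simp only [Function.comp_apply, extend, LinearMap.coe_mk, AddHom.coe_mk, toC_setC hij,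
    setC_setC hij, rot]
  congr 1
  simp [L, conjL]

/-- A rotation of the `i`-`j`-plane by an angle depending continuously on the square of the
Euclidean norm preserves the Lebesgue measure. -/
theorem measurePreserving_twist {F : ℝ → ℝ} (hF : Continuous F) :
    MeasurePreserving fun y : ι → ℝ => rot i j (Complex.exp (F (sq y) * Complex.I)) y := by
  have : Fact (0 < 2 * Real.pi) := ⟨Real.two_pi_pos⟩
  let ν : Measure (AddCircle (2 * Real.pi)) := AddCircle.haarAddCircle
  let u : AddCircle (2 * Real.pi) → ℂ := fun t => AddCircle.toCircle t
  have hu : Continuous u := continuous_subtype_val.comp AddCircle.continuous_toCircle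
  have hun : ∀ t, ‖u t‖ = 1 := fun t => Circle.norm_coe _
  have hexp : ∀ x : ℝ, u (x : AddCircle (2 * Real.pi)) = Complex.exp (x * Complex.I) := by
    intro x
    simp only [u, AddCircle.toCircle_apply_mk, Circle.coe_exp]
    rw [div_self Real.two_pi_pos.ne', one_mul]
  have hadd : ∀ s t, u (s + t) = u s * u t := fun s t => by
    simp [u, AddCircle.toCircle_add]
  have hΦ : MeasurePreserving (fun p : AddCircle (2 * Real.pi) × (ι → ℝ) => rot i j (u p.1) p.2)
      (ν.prod volume) volume := by
    have h1 := (MeasurePreserving.id ν).skew_product (μc := (volume : Measure (ι → ℝ)))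
      (μd := volume) (g := fun t y => rot i j (u t) y)
      (((continuous_rot i j).comp (hu.prodMap continuous_id)).measurable)
      (.of_forall fun t => (measurePreserving_rot hij (hun t)).map_eq)
    exact measurePreserving_snd.comp h1
  have hΨ : MeasurePreserving (fun p : AddCircle (2 * Real.pi) × (ι → ℝ) =>
      (((F (sq p.2) : ℝ) : AddCircle (2 * Real.pi)) + p.1, p.2)) (ν.prod volume)
      (ν.prod volume) := by
    have h1 := (MeasurePreserving.id (volume : Measure (ι → ℝ))).skew_product (μc := ν)
      (μd := ν) (g := fun y t => ((F (sq y) : ℝ) : AddCircle (2 * Real.pi)) + t)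
      (Continuous.measurable (by
        have := (AddCircle.continuous_mk' (2 * Real.pi)).comp (hF.comp (continuous_sq (ι := ι)))
        exact (this.comp continuous_fst).add continuous_snd))
      (.of_forall fun y => map_add_left_eq_self ν _)
    exact Measure.measurePreserving_swap.comp (h1.comp Measure.measurePreserving_swap)
  have hT : Continuous fun y : ι → ℝ => rot i j (Complex.exp (F (sq y) * Complex.I)) y := by
    refine (continuous_rot i j).comp (Continuous.prodMk ?_ continuous_id)
    exact Complex.continuous_exp.comp
      ((Complex.continuous_ofReal.comp (hF.comp (continuous_sq (ι := ι)))).mul continuous_const)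
  refine ⟨hT.measurable, ?_⟩
  conv_lhs => rw [← hΦ.map_eq]
  rw [Measure.map_map hT.measurable hΦ.measurable]
  conv_rhs => rw [← (hΦ.comp hΨ).map_eq]
  congr 1
  ext1 p
  simp only [Function.comp_apply, sq_rot hij (hun _), rot_rot hij, hadd, hexp]

end PlaneRotation

end

section

open Filter Topology TopologicalSpace MeasureTheory
open scoped ZeroAtInfty

/-- A fibrewise translation structure over the open unit ball of `c₀` splits off the ball. -/
theorem exists_ball_factor {G : Type*} [TopologicalSpace G] (act : G → C₀(ℕ, ℝ) → G)
    (hact : Continuous fun p : G × C₀(ℕ, ℝ) => act p.1 p.2)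
    (hinv : ∀ g v, act (act g v) (-v) = g) {U V : Set G} (hU : IsOpen U) (hV : IsOpen V)
    (hUV : U ⊆ V) (τ : V → C₀(ℕ, ℝ)) (hτ : Continuous τ)
    (hmem : ∀ g ∈ U, ∀ v : C₀(ℕ, ℝ), ‖v‖ < 1 → act g v ∈ V)
    (htrans : ∀ g (hg : g ∈ U) (v : C₀(ℕ, ℝ)) (hv : ‖v‖ < 1),
      τ ⟨act g v, hmem g hg v hv⟩ = τ ⟨g, hUV hg⟩ + v)
    {o : G} (ho : o ∈ U) (hτo : τ ⟨o, hUV ho⟩ = 0) :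
    ∃ Ω : Set G, IsOpen Ω ∧ Ω.Nonempty ∧ ∃ S : Set G,
      Nonempty (Ω ≃ₜ S × Metric.ball (0 : C₀(ℕ, ℝ)) 1) := by
  have hinv' : ∀ g v, act (act g (-v)) v = g := fun g v => by simpa using hinv g (-v)
  let O : Set V := {g | ‖τ g‖ < 1 ∧ act g (-τ g) ∈ U}
  have hO : IsOpen O := (isOpen_lt hτ.norm continuous_const).inter
    (hU.preimage (hact.comp (continuous_subtype_val.prodMk hτ.neg)))
  let S : Set G := {g | ∃ hg : g ∈ U, τ ⟨g, hUV hg⟩ = 0}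
  have hactz : ∀ g (hg : g ∈ V), (⟨g, hg⟩ : V) ∈ O →
      ∃ h : act g (-τ ⟨g, hg⟩) ∈ U, τ ⟨_, hUV h⟩ = 0 := by
    rintro g hg ⟨h1, h2⟩
    refine ⟨h2, ?_⟩
    have := htrans _ h2 _ h1
    simp only [hinv'] at this
    simpa using this
  have hback : ∀ s ∈ S, ∀ v : C₀(ℕ, ℝ), ‖v‖ < 1 → ∃ h : act s v ∈ V, τ ⟨_, h⟩ = v := by
    rintro s ⟨hs, hs0⟩ v hv
    exact ⟨hmem s hs v hv, by rw [htrans s hs v hv, hs0, zero_add]⟩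
  have hball : ∀ v : Metric.ball (0 : C₀(ℕ, ℝ)) 1, ‖(v : C₀(ℕ, ℝ))‖ < 1 := fun v =>
    mem_ball_zero_iff.1 v.2
  obtain ⟨hoV, hτo'⟩ := hback o ⟨ho, hτo⟩ 0 (by simp)
  refine ⟨Subtype.val '' O, hV.isOpenMap_subtype_val _ hO, ⟨act o 0, ⟨_, hoV⟩,
    ⟨by simp [hτo'], ?_⟩, rfl⟩, S, ⟨?_⟩⟩
  · simpa only [hτo', hinv] using ho
  let e : O ≃ₜ S × Metric.ball (0 : C₀(ℕ, ℝ)) 1 :=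
  { toFun := fun g => (⟨act g.1 (-τ g.1), hactz _ g.1.2 g.2⟩, ⟨τ g.1, by simpa using g.2.1⟩)
    invFun := fun p => ⟨⟨act p.1 p.2, (hback _ p.1.2 _ (hball p.2)).1⟩, by
      obtain ⟨h, h'⟩ := hback _ p.1.2 _ (hball p.2)
      refine ⟨by simpa only [h'] using hball p.2, ?_⟩
      simp only [h', hinv]
      exact p.1.2.1⟩
    left_inv := fun g => by
      apply Subtype.ext; apply Subtype.ext; simp [hinv']
    right_inv := fun p => by
      obtain ⟨h, h'⟩ := hback _ p.1.2 _ (hball p.2)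
      apply Prod.ext
      · apply Subtype.ext; simp [h', hinv]
      · apply Subtype.ext; simp [h']
    continuous_toFun := by
      have h1 : Continuous fun g : O => τ g.1 := hτ.comp continuous_subtype_val
      exact ((hact.comp ((continuous_subtype_val.comp continuous_subtype_val).prodMk
        h1.neg)).subtype_mk _).prodMk (h1.subtype_mk _)
    continuous_invFun := by
      have h1 : Continuous fun p : S × Metric.ball (0 : C₀(ℕ, ℝ)) 1 => act p.1 p.2 :=
        hact.comp ((continuous_subtype_val.comp continuous_fst).prodMk
          (continuous_subtype_val.comp continuous_snd))
      exact (h1.subtype_mk _).subtype_mk _ }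
  exact (Topology.IsEmbedding.subtypeVal.homeomorphImage O).symm.trans e

namespace TwistProfile

/-- The radii at which twists are read off. -/
noncomputable def radius (k : ℕ) : ℝ := 1 / 4 + 1 / (4 * (k + 1))

/-- A bump function selecting `radius k` among all the radii. -/
noncomputable def bump (k : ℕ) (s : ℝ) : ℝ :=
  max 0 (1 - 4 * (k + 1) * (k + 2) * |s - radius k|)

theorem continuous_bump (k : ℕ) : Continuous (bump k) := by
  unfold bump; fun_prop

theorem bump_nonneg (k : ℕ) (s : ℝ) : 0 ≤ bump k s := le_max_left _ _

theorem bump_le_one (k : ℕ) (s : ℝ) : bump k s ≤ 1 :=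
  max_le zero_le_one (sub_le_self _ (by positivity))

theorem bump_self (k : ℕ) : bump k (radius k) = 1 := by simp [bump]

theorem bump_eq_zero {k : ℕ} {s : ℝ} (h : 1 / (4 * (k + 1) * (k + 2)) ≤ |s - radius k|) :
    bump k s = 0 := by
  rw [div_le_iff₀' (by positivity)] at h
  exact max_eq_left (by linarith)

theorem radius_sub {k l : ℕ} (h : k < l) :
    1 / (4 * ((k : ℝ) + 1) * (k + 2)) ≤ radius k - radius l := by
  have hl : (k : ℝ) + 2 ≤ l + 1 := by
    have : (k : ℝ) + 1 ≤ l := by exact_mod_cast h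
    linarith
  have h1 : (1 : ℝ) / (4 * (l + 1)) ≤ 1 / (4 * (k + 2)) := by gcongr
  have h2 : (1 : ℝ) / (4 * (k + 1)) - 1 / (4 * (k + 2)) = 1 / (4 * (k + 1) * (k + 2)) := by
    field_simp; ring
  unfold radius
  linarith

theorem bump_radius_of_ne {k l : ℕ} (h : k ≠ l) : bump k (radius l) = 0 := by
  apply bump_eq_zero
  rcases lt_or_gt_of_ne h with h | h
  · rw [abs_sub_comm]
    exact (radius_sub h).trans (le_abs_self _)
  · refine le_trans ?_ ((radius_sub h).trans (le_abs_self _))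
    have : (l : ℝ) ≤ k := by exact_mod_cast h.le
    gcongr

theorem bump_quarter (k : ℕ) : bump k (1 / 4) = 0 := by
  apply bump_eq_zero
  rw [abs_sub_comm]
  refine le_trans ?_ (le_abs_self _)
  rw [radius, add_sub_cancel_left]
  refine one_div_le_one_div_of_le (by positivity) ?_
  nlinarith [(k.cast_nonneg : (0 : ℝ) ≤ k)]

theorem radius_mem (k : ℕ) : radius k ∈ Set.Icc (1 / 4 : ℝ) (1 / 2) := by
  refine ⟨by unfold radius; linarith [show (0 : ℝ) ≤ 1 / (4 * (k + 1)) by positivity], ?_⟩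
  have : (1 : ℝ) / (4 * (k + 1)) ≤ 1 / (4 * 1) := by
    gcongr; linarith [(k.cast_nonneg : (0 : ℝ) ≤ k)]
  unfold radius; linarith

theorem tendsto_radius : Tendsto radius atTop (𝓝 (1 / 4)) := by
  have h := (tendsto_one_div_add_atTop_nhds_zero_nat (𝕜 := ℝ)).const_mul (1 / 4)
  have h2 := h.const_add (1 / 4)
  simp only [mul_zero, add_zero] at h2
  refine h2.congr fun k => ?_
  unfold radius
  field_simp

theorem bump_of_one_le (k : ℕ) {s : ℝ} (hs : 1 ≤ s) : bump k s = 0 := by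
  apply bump_eq_zero
  have h1 := (radius_mem k).2
  have h2 : (1 : ℝ) / (4 * (k + 1) * (k + 2)) ≤ 1 / (4 * (0 + 1) * (0 + 2)) := by
    gcongr <;> exact k.cast_nonneg
  refine h2.trans (le_trans ?_ (le_abs_self _))
  norm_num at h2 ⊢
  linarith

/-- The positive parts of the coefficients, weighted by the bump functions. -/
noncomputable def posPart (v : C₀(ℕ, ℝ)) (s : ℝ) : C₀(ℕ, ℝ) :=
  .ofTendsto (fun k => max (v k * bump k s) 0) <| by
    refine squeeze_zero_norm (a := fun k => ‖v k‖) (fun k => ?_) (by simpa using v.tendsto_atTop.norm)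
    rw [Real.norm_of_nonneg (le_max_right _ _)]
    refine max_le ((le_abs_self _).trans ?_) (norm_nonneg _)
    rw [abs_mul, abs_of_nonneg (bump_nonneg k s)]
    exact mul_le_of_le_one_right (abs_nonneg _) (bump_le_one k s)

theorem posPart_apply (v : C₀(ℕ, ℝ)) (s : ℝ) (k : ℕ) : posPart v s k = max (v k * bump k s) 0 :=
  ZeroAtInftyContinuousMap.ofTendsto_apply _ _ _

theorem norm_posPart_apply_le (v : C₀(ℕ, ℝ)) (s : ℝ) (k : ℕ) : ‖posPart v s k‖ ≤ ‖v k‖ := by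
  rw [posPart_apply, Real.norm_of_nonneg (le_max_right _ _)]
  refine max_le ((le_abs_self _).trans ?_) (norm_nonneg _)
  rw [abs_mul, abs_of_nonneg (bump_nonneg k s)]
  exact mul_le_of_le_one_right (abs_nonneg _) (bump_le_one k s)

theorem norm_posPart_le (v : C₀(ℕ, ℝ)) (s : ℝ) : ‖posPart v s‖ ≤ ‖v‖ :=
  ZeroAtInftyContinuousMap.norm_le_of_forall (norm_nonneg _) fun k =>
    (norm_posPart_apply_le v s k).trans (v.norm_apply_le k)

theorem continuous_posPart : Continuous fun p : C₀(ℕ, ℝ) × ℝ => posPart p.1 p.2 := by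
  refine continuous_iff_continuousAt.2 fun p =>
    ZeroAtInftyContinuousMap.continuousAt_of_tails (fun k => ?_) fun ε hε => ?_
  · simp only [posPart_apply]
    exact Continuous.continuousAt ((((ZeroAtInftyContinuousMap.continuous_apply k).comp
      continuous_fst).mul ((continuous_bump k).comp continuous_snd)).max continuous_const)
  · obtain ⟨N, hN⟩ := eventually_atTop.1
      ((tendsto_zero_iff_norm_tendsto_zero.1 p.1.tendsto_atTop).eventually
        (gt_mem_nhds (half_pos hε)))
    refine ⟨N, ?_⟩
    filter_upwards [(continuous_fst.tendsto p).eventually (Metric.ball_mem_nhds p.1 (half_pos hε))]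
      with q hq k hk
    refine (norm_posPart_apply_le _ _ _).trans ?_
    have h1 : ‖q.1 k - p.1 k‖ ≤ ‖q.1 - p.1‖ := (q.1 - p.1).norm_apply_le k
    rw [dist_eq_norm] at hq
    have h2 := norm_le_norm_add_norm_sub' (q.1 k) (p.1 k)
    linarith [hN k hk]

/-- The function with prescribed values at the radii. -/
noncomputable def profile (v : C₀(ℕ, ℝ)) (s : ℝ) : ℝ := ‖posPart v s‖ - ‖posPart (-v) s‖

theorem continuous_profile : Continuous fun p : C₀(ℕ, ℝ) × ℝ => profile p.1 p.2 :=
  continuous_posPart.norm.sub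
    (continuous_posPart.comp (continuous_fst.neg.prodMk continuous_snd)).norm

theorem continuous_profile_right (v : C₀(ℕ, ℝ)) : Continuous (profile v) := by
  have h : Continuous fun s : ℝ => (v, s) := continuous_const.prodMk continuous_id
  have := continuous_profile.comp h
  exact this

theorem profile_neg (v : C₀(ℕ, ℝ)) (s : ℝ) : profile (-v) s = -profile v s := by
  simp [profile]

theorem abs_profile_le (v : C₀(ℕ, ℝ)) (s : ℝ) : |profile v s| ≤ ‖v‖ := by
  have h1 := norm_posPart_le v s
  have h2 := norm_posPart_le (-v) s
  rw [norm_neg] at h2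
  rw [profile, abs_sub_le_iff]
  constructor <;> linarith [norm_nonneg (posPart v s), norm_nonneg (posPart (-v) s)]

theorem profile_eq_zero {v : C₀(ℕ, ℝ)} {s : ℝ} (h : ∀ k, bump k s = 0) : profile v s = 0 := by
  have : ∀ v, posPart v s = 0 := fun v => by ext k; simp [posPart_apply, h]
  simp [profile, this]

theorem norm_posPart_radius (v : C₀(ℕ, ℝ)) (k : ℕ) : ‖posPart v (radius k)‖ = max (v k) 0 := by
  refine le_antisymm (ZeroAtInftyContinuousMap.norm_le_of_forall (le_max_right _ _) fun l => ?_) ?_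
  · rw [posPart_apply, Real.norm_of_nonneg (le_max_right _ _)]
    rcases eq_or_ne l k with rfl | h
    · simp [bump_self]
    · simp [bump_radius_of_ne h]
  · refine le_trans (le_of_eq ?_) ((posPart v (radius k)).norm_apply_le k)
    rw [posPart_apply, Real.norm_of_nonneg (le_max_right _ _), bump_self, mul_one]

theorem profile_radius (v : C₀(ℕ, ℝ)) (k : ℕ) : profile v (radius k) = v k := by
  rw [profile, norm_posPart_radius, norm_posPart_radius]
  have : (-v) k = -v k := rfl
  rw [this]
  rcases le_total (v k) 0 with h | h <;> simp [h]

end TwistProfile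

end

section

open Filter Topology TopologicalSpace MeasureTheory
open scoped ZeroAtInfty

namespace PlaneRotation

variable {ι : Type*} [Fintype ι] [DecidableEq ι]

omit [DecidableEq ι] in
theorem isCompact_sq_le_one : IsCompact {y : ι → ℝ | sq y ≤ 1} := by
  refine (isCompact_univ_pi fun _ : ι => isCompact_Icc (a := (-1 : ℝ)) (b := 1)).of_isClosed_subset
    (isClosed_le continuous_sq continuous_const) fun y hy k _ => ?_
  have h1 : y k ^ 2 ≤ sq y :=
    Finset.single_le_sum (f := fun k => y k ^ 2) (fun k _ => sq_nonneg (y k)) (Finset.mem_univ k)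
  exact abs_le.1 (abs_le_one_iff_mul_self_le_one.2 (by nlinarith [h1.trans hy]))

/-- The rotation of the `i`-`j`-plane whose angle is prescribed by a null sequence. -/
noncomputable def twist (i j : ι) (v : C₀(ℕ, ℝ)) (y : ι → ℝ) : ι → ℝ :=
  rot i j (Complex.exp (TwistProfile.profile v (sq y) * Complex.I)) y

theorem continuous_twist (i j : ι) :
    Continuous fun p : C₀(ℕ, ℝ) × (ι → ℝ) => twist i j p.1 p.2 := by
  refine (continuous_rot i j).comp (Continuous.prodMk ?_ continuous_snd)
  exact Complex.continuous_exp.comp ((Complex.continuous_ofReal.comp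
    (TwistProfile.continuous_profile.comp
      (continuous_fst.prodMk (continuous_sq.comp continuous_snd)))).mul continuous_const)

variable {i j : ι}

theorem twist_of_one_le (v : C₀(ℕ, ℝ)) {y : ι → ℝ} (hy : 1 ≤ sq y) : twist i j v y = y := by
  rw [twist, TwistProfile.profile_eq_zero fun k => TwistProfile.bump_of_one_le k hy]
  simp [rot_one]

theorem sq_twist (hij : i ≠ j) (v : C₀(ℕ, ℝ)) (y : ι → ℝ) : sq (twist i j v y) = sq y :=
  sq_rot hij (Complex.norm_exp_ofReal_mul_I _) y

theorem twist_neg_twist (hij : i ≠ j) (v : C₀(ℕ, ℝ)) (y : ι → ℝ) :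
    twist i j (-v) (twist i j v y) = y := by
  rw [twist, sq_twist hij, twist, rot_rot hij, ← Complex.exp_add, TwistProfile.profile_neg]
  simp [rot_one]

theorem twist_mem (hij : i ≠ j) {s : Set (ι → ℝ)} (hs : {y | sq y ≤ 1} ⊆ s) (v : C₀(ℕ, ℝ))
    {y : ι → ℝ} (hy : y ∈ s) : twist i j v y ∈ s := by
  rcases le_total (sq y) 1 with h | h
  · exact hs (by rwa [Set.mem_ofPred_eq, sq_twist hij])
  · rwa [twist_of_one_le v h]

end PlaneRotation

namespace ChartTwist

open PlaneRotation

variable {M : Type*} [TopologicalSpace M] {ι : Type*} [Fintype ι] [DecidableEq ι]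

open Classical in
/-- A twist in a chart, extended by the identity. -/
noncomputable def push (φ : OpenPartialHomeomorph M (ι → ℝ)) (i j : ι) (v : C₀(ℕ, ℝ)) (m : M) : M :=
  if m ∈ φ.source then φ.symm (twist i j v (φ m)) else m

variable {φ : OpenPartialHomeomorph M (ι → ℝ)} {i j : ι}

theorem push_of_mem {v : C₀(ℕ, ℝ)} {m : M} (hm : m ∈ φ.source) :
    push φ i j v m = φ.symm (twist i j v (φ m)) := if_pos hm

theorem push_of_notMem {v : C₀(ℕ, ℝ)} {m : M} (hm : m ∉ φ.source) : push φ i j v m = m := if_neg hm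

variable (hij : i ≠ j) (hφ : {y | PlaneRotation.sq y ≤ 1} ⊆ φ.target)
include hij hφ

theorem push_mem {v : C₀(ℕ, ℝ)} {m : M} (hm : m ∈ φ.source) : push φ i j v m ∈ φ.source := by
  rw [push_of_mem hm]
  exact φ.map_target (twist_mem hij hφ v (φ.map_source hm))

theorem apply_push {v : C₀(ℕ, ℝ)} {m : M} (hm : m ∈ φ.source) :
    φ (push φ i j v m) = twist i j v (φ m) := by
  rw [push_of_mem hm, φ.right_inv (twist_mem hij hφ v (φ.map_source hm))]

theorem push_neg_push (v : C₀(ℕ, ℝ)) (m : M) : push φ i j (-v) (push φ i j v m) = m := by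
  by_cases hm : m ∈ φ.source
  · rw [push_of_mem (push_mem hij hφ hm), apply_push hij hφ hm, twist_neg_twist hij, φ.left_inv hm]
  · rw [push_of_notMem hm, push_of_notMem hm]

theorem push_push_neg (v : C₀(ℕ, ℝ)) (m : M) : push φ i j v (push φ i j (-v) m) = m := by
  simpa using push_neg_push hij hφ (-v) m

theorem continuous_push [T2Space M] :
    Continuous fun p : C₀(ℕ, ℝ) × M => push φ i j p.1 p.2 := by
  have hK : IsClosed (φ.symm '' {y | PlaneRotation.sq y ≤ 1}) :=
    (isCompact_sq_le_one.image_of_continuousOn (φ.continuousOn_symm.mono hφ)).isClosed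
  refine continuous_iff_continuousAt.2 fun p => ?_
  by_cases hp : p.2 ∈ φ.source
  · have h1 : ContinuousAt (fun p : C₀(ℕ, ℝ) × M => twist i j p.1 (φ p.2)) p :=
      (continuous_twist i j).continuousAt.comp (f := fun p : C₀(ℕ, ℝ) × M => (p.1, φ p.2))
        (continuousAt_fst.prodMk ((φ.continuousAt hp).comp continuousAt_snd))
    have h2 : ContinuousAt (fun p : C₀(ℕ, ℝ) × M => φ.symm (twist i j p.1 (φ p.2))) p :=
      ContinuousAt.comp (φ.continuousAt_symm (twist_mem hij hφ _ (φ.map_source hp))) h1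
    refine h2.congr ?_
    filter_upwards [(φ.open_source.preimage continuous_snd).mem_nhds hp] with q hq
    exact (push_of_mem hq).symm
  · refine (continuousAt_snd (p := p)).congr ?_
    have hp' : p.2 ∈ (φ.symm '' {y | PlaneRotation.sq y ≤ 1})ᶜ := by
      rintro ⟨y, hy, hyp⟩
      exact hp (hyp ▸ φ.map_target (hφ hy))
    filter_upwards [(hK.isOpen_compl.preimage continuous_snd).mem_nhds hp'] with q hq
    by_cases hqs : q.2 ∈ φ.source
    · rw [push_of_mem hqs, twist_of_one_le, φ.left_inv hqs]
      by_contra hlt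
      exact hq ⟨φ q.2, (not_le.1 hlt).le, φ.left_inv hqs⟩
    · exact (push_of_notMem hqs).symm

theorem measure_preimage_push [T2Space M] [MeasurableSpace M] [BorelSpace M] {μ : Measure M}
    {c : ENNReal}
    (hμ : ∀ B ⊆ φ.target, MeasurableSet B → μ (φ.symm '' B) = c * volume B) (v : C₀(ℕ, ℝ)) :
    Measure.map (push φ i j v) μ = μ := by
  have hc : Continuous (push φ i j v) :=
    (continuous_push hij hφ).comp (continuous_const.prodMk continuous_id : Continuous fun m => (v, m))
  have htm : Measurable (twist i j v) :=
    ((continuous_twist i j).comp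
      (continuous_const.prodMk continuous_id : Continuous fun y => (v, y))).measurable
  have htp : MeasurePreserving (twist i j v) := 
    measurePreserving_twist hij (TwistProfile.continuous_profile_right v)
  ext A hA
  have hsm : MeasurableSet φ.source := φ.open_source.measurableSet
  rw [Measure.map_apply hc.measurable hA, ← measure_inter_add_sdiff _ hsm,
    ← measure_inter_add_sdiff A hsm]
  have hB : MeasurableSet (φ.target ∩ φ.symm ⁻¹' A) := by
    have h1 := φ.open_target.measurableSet.subtype_image
      (φ.continuousOn_symm.domRestrict.measurable hA)
    convert h1 using 1
    ext y
    simp [Set.domRestrict, and_comm]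
  have hA' : A ∩ φ.source = φ.symm '' (φ.target ∩ φ.symm ⁻¹' A) := by
    ext m
    constructor
    · rintro ⟨h1, h2⟩
      exact ⟨φ m, ⟨φ.map_source h2, by rwa [Set.mem_preimage, φ.left_inv h2]⟩, φ.left_inv h2⟩
    · rintro ⟨y, ⟨h1, h2⟩, rfl⟩
      exact ⟨h2, φ.map_target h1⟩
  have hpA : push φ i j v ⁻¹' A ∩ φ.source =
      φ.symm '' (φ.target ∩ twist i j v ⁻¹' (φ.target ∩ φ.symm ⁻¹' A)) := by
    ext m
    constructor
    · rintro ⟨h1, h2⟩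
      rw [Set.mem_preimage, push_of_mem h2] at h1
      exact ⟨φ m, ⟨φ.map_source h2, twist_mem hij hφ v (φ.map_source h2), h1⟩, φ.left_inv h2⟩
    · rintro ⟨y, ⟨h1, h2, h3⟩, rfl⟩
      refine ⟨?_, φ.map_target h1⟩
      rw [Set.mem_preimage, push_of_mem (φ.map_target h1), φ.right_inv h1]
      exact h3
  have htt : φ.target ∩ twist i j v ⁻¹' (φ.target ∩ φ.symm ⁻¹' A) =
      twist i j v ⁻¹' (φ.target ∩ φ.symm ⁻¹' A) := by
    refine Set.inter_eq_right.2 fun y hy => ?_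
    rw [← twist_neg_twist hij v y]
    exact twist_mem hij hφ _ hy.1
  have hd : push φ i j v ⁻¹' A \ φ.source = A \ φ.source := by
    ext m
    refine and_congr_left fun hm => ?_
    rw [Set.mem_preimage, push_of_notMem hm]
  have hsub : twist i j v ⁻¹' (φ.target ∩ φ.symm ⁻¹' A) ⊆ φ.target := by
    rw [← htt]; exact Set.inter_subset_left
  rw [hd, hpA, hA', htt, hμ _ Set.inter_subset_left hB, hμ _ hsub (htm hB),
    htp.measure_preimage hB.nullMeasurableSet]

end ChartTwist

end

section

open Filter Topology TopologicalSpace MeasureTheory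
open scoped ZeroAtInfty

namespace ChartTwist

open PlaneRotation TwistProfile

/-- The circle of angles. -/
abbrev Angle : Type := AddCircle (2 * Real.pi)

instance : Fact (0 < 2 * Real.pi) := ⟨Real.two_pi_pos⟩

/-- The unit complex number of a given angle. -/
noncomputable def unit (t : Angle) : ℂ := AddCircle.toCircle t

theorem continuous_unit : Continuous unit :=
  continuous_subtype_val.comp AddCircle.continuous_toCircle

theorem norm_unit (t : Angle) : ‖unit t‖ = 1 := Circle.norm_coe _

theorem unit_coe (x : ℝ) : unit (x : Angle) = Complex.exp (x * Complex.I) := by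
  simp only [unit, AddCircle.toCircle_apply_mk, Circle.coe_exp]
  rw [div_self Real.two_pi_pos.ne', one_mul]

theorem unit_add (s t : Angle) : unit (s + t) = unit s * unit t := by
  simp [unit, AddCircle.toCircle_add]

theorem unit_mul_conj (t : Angle) : unit t * (starRingEnd ℂ) (unit t) = 1 := by
  rw [Complex.mul_conj, Complex.normSq_eq_norm_sq, norm_unit]; simp

/-- The annulus, in polar coordinates. -/
abbrev Annulus : Type := Set.Icc (1 / 4 : ℝ) (1 / 2) × Angle

/-- The circular mean at a given radius. -/
noncomputable def mean (f : C(Annulus, ℝ)) (s : Set.Icc (1 / 4 : ℝ) (1 / 2)) : ℝ :=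
  ∫ t, f (s, t) ∂(AddCircle.haarAddCircle : Measure Angle)

theorem integrable_slice (f : C(Annulus, ℝ)) (s : Set.Icc (1 / 4 : ℝ) (1 / 2)) :
    Integrable (fun t => f (s, t)) (AddCircle.haarAddCircle : Measure Angle) := by
  have : Continuous fun t => f (s, t) := f.continuous.comp (Continuous.prodMk_right s)
  exact this.integrable_of_hasCompactSupport (HasCompactSupport.of_compactSpace _)

theorem continuous_mean (f : C(Annulus, ℝ)) : Continuous (mean f) := by
  have h := continuous_parametric_integral_of_continuous
    (μ := (AddCircle.haarAddCircle : Measure Angle))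
    (f := fun (s : Set.Icc (1 / 4 : ℝ) (1 / 2)) (t : Angle) => f (s, t)) f.continuous
    (s := Set.univ) isCompact_univ
  simp only [Measure.restrict_univ] at h
  exact h

theorem dist_mean_le (f g : C(Annulus, ℝ)) (s : Set.Icc (1 / 4 : ℝ) (1 / 2)) :
    dist (mean f s) (mean g s) ≤ dist f g := by
  rw [dist_eq_norm, mean, mean, ← integral_sub (integrable_slice f s) (integrable_slice g s)]
  refine (norm_integral_le_of_norm_le_const (C := dist f g) (.of_forall fun t => ?_)).trans ?_
  · rw [← dist_eq_norm]; exact ContinuousMap.dist_apply_le_dist _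
  · simp

/-- The innermost radius of the annulus. -/
noncomputable def innermost : Set.Icc (1 / 4 : ℝ) (1 / 2) := ⟨1 / 4, by norm_num, by norm_num⟩

/-- The circular means at the radii `radius k`, compared with the innermost radius. -/
noncomputable def means (f : C(Annulus, ℝ)) : C₀(ℕ, ℝ) :=
  .ofTendsto (fun k => mean f ⟨radius k, radius_mem k⟩ - mean f innermost) <| by
    have h1 : Tendsto (fun k => (⟨radius k, radius_mem k⟩ : Set.Icc (1 / 4 : ℝ) (1 / 2))) atTop
        (𝓝 innermost) := tendsto_subtype_rng.2 tendsto_radius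
    simpa using (((continuous_mean f).tendsto innermost).comp h1).sub_const (mean f innermost)

theorem means_apply (f : C(Annulus, ℝ)) (k : ℕ) :
    means f k = mean f ⟨radius k, radius_mem k⟩ - mean f innermost :=
  ZeroAtInftyContinuousMap.ofTendsto_apply _ _ _

theorem continuous_means : Continuous means := by
  refine (LipschitzWith.of_dist_le_mul (K := 2) fun f g => ?_).continuous
  refine ZeroAtInftyContinuousMap.dist_le_of_forall (by positivity) fun k => ?_
  rw [means_apply, means_apply]
  refine (dist_sub_sub_le _ _ _ _).trans ?_
  have h1 := dist_mean_le f g ⟨radius k, radius_mem k⟩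
  have h2 := dist_mean_le f g innermost
  push_cast
  linarith

/-- Rotating each circle by an angle given by a profile, and adding that angle, adds the profile's
coefficients to the means. -/
theorem means_eq_add {f g : C(Annulus, ℝ)} {v : C₀(ℕ, ℝ)}
    (h : ∀ (s : Set.Icc (1 / 4 : ℝ) (1 / 2)) (t : Angle),
      g (s, t) = f (s, t + (profile v s : ℝ)) + profile v s) : means g = means f + v := by
  have hm : ∀ s, mean g s = mean f s + profile v s := fun s => by
    rw [mean, mean, funext (h s)]
    rw [integral_add, integral_add_right_eq_self (fun t => f (s, t))]
    · simp
    · exact (integrable_slice f s).comp_add_right _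
    · exact integrable_const _
  ext k
  have : (means f + v) k = means f k + v k := rfl
  rw [this, means_apply, means_apply, hm, hm, profile_radius,
    profile_eq_zero (s := (innermost : ℝ)) fun l => bump_quarter l]
  ring

end ChartTwist

end

section

open Filter Topology TopologicalSpace MeasureTheory
open scoped ZeroAtInfty

namespace ChartTwist

open PlaneRotation TwistProfile

section Point

variable {ι : Type*} [Fintype ι] [DecidableEq ι] {i j : ι}

/-- The point of the `i`-`j`-plane with given polar coordinates. -/
noncomputable def polar (i j : ι) (d : Annulus) : ι → ℝ := setC i j 0 (√(d.1 : ℝ) * unit d.2)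

omit [Fintype ι] in
theorem continuous_polar : Continuous (polar i j) := by
  have h1 : Continuous fun d : Annulus => ((√(d.1 : ℝ) : ℝ) : ℂ) * unit d.2 :=
    (Complex.continuous_ofReal.comp (Real.continuous_sqrt.comp
      (continuous_subtype_val.comp continuous_fst))).mul (continuous_unit.comp continuous_snd)
  exact (continuous_setC i j).comp (continuous_const.prodMk h1)

theorem sq_polar (hij : i ≠ j) (d : Annulus) : PlaneRotation.sq (polar i j d) = d.1 := by
  have h0 : (0 : ℝ) ≤ d.1 := le_trans (by norm_num) d.1.2.1
  rw [polar, sq_setC hij, map_mul, Complex.normSq_ofReal, Real.mul_self_sqrt h0,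
    Complex.normSq_eq_norm_sq, norm_unit]
  simp

omit [Fintype ι] in
theorem toC_polar (hij : i ≠ j) (d : Annulus) :
    toC i j (polar i j d) = √(d.1 : ℝ) * unit d.2 := toC_setC hij _ _

theorem twist_polar (hij : i ≠ j) (v : C₀(ℕ, ℝ)) (d : Annulus) :
    twist i j v (polar i j d) = polar i j (d.1, d.2 + (profile v d.1 : ℝ)) := by
  rw [twist, sq_polar hij, rot, toC_polar hij, polar, setC_setC hij, polar, unit_add, unit_coe]
  congr 1
  ring

end Point

variable {M : Type*} [TopologicalSpace M] {ι : Type*} [Fintype ι] [DecidableEq ι]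
  (φ : OpenPartialHomeomorph M (ι → ℝ)) (i j : ι)

/-- The position of a point of `M`, relative to a given direction. -/
noncomputable def relPos (p : M × Angle) : ℂ := toC i j (φ p.1) * (starRingEnd ℂ) (unit p.2)

/-- The points of `M` whose angle with a given direction is less than `r`. -/
def sector (r : ℝ) : Set (M × Angle) :=
  {p | p.1 ∈ φ.source ∧ relPos φ i j p ∈ Complex.slitPlane ∧ |(relPos φ i j p).arg| < r}

variable {φ i j}

omit [Fintype ι] [DecidableEq ι] in
theorem continuousAt_relPos {p : M × Angle} (hp : p.1 ∈ φ.source) :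
    ContinuousAt (relPos φ i j) p :=
  ((continuous_toC i j).continuousAt.comp ((φ.continuousAt hp).comp continuousAt_fst)).mul
    (Complex.continuous_conj.comp (continuous_unit.comp continuous_snd)).continuousAt

omit [Fintype ι] [DecidableEq ι] in
theorem continuousAt_arg_relPos {r : ℝ} {p : M × Angle} (hp : p ∈ sector φ i j r) :
    ContinuousAt (fun p => (relPos φ i j p).arg) p :=
  ContinuousAt.comp (Complex.continuousAt_arg hp.2.1) (continuousAt_relPos hp.1)

omit [Fintype ι] [DecidableEq ι] in
theorem isOpen_sector (r : ℝ) : IsOpen (sector φ i j r) := by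
  refine isOpen_iff_mem_nhds.2 fun p hp => ?_
  filter_upwards [(φ.open_source.preimage continuous_fst).mem_nhds hp.1,
    (continuousAt_relPos hp.1).eventually (Complex.isOpen_slitPlane.mem_nhds hp.2.1),
    (continuousAt_arg_relPos hp).abs.eventually (gt_mem_nhds hp.2.2)] with q h1 h2 h3
  exact ⟨h1, h2, h3⟩

omit [Fintype ι] [DecidableEq ι] in
theorem relPos_add {m : M} {t s : Angle} :
    relPos φ i j (m, t) = relPos φ i j (m, t + s) * unit s := by
  simp only [relPos, unit_add, map_mul]
  linear_combination (-toC i j (φ m) * (starRingEnd ℂ) (unit t)) * unit_mul_conj s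

omit [Fintype ι] [DecidableEq ι] in
theorem sector_add {m : M} {t : Angle} {a : ℝ} (h : (m, t + (a : Angle)) ∈ sector φ i j 1)
    (ha : |a| < 1) : (m, t) ∈ sector φ i j 2 ∧
      (relPos φ i j (m, t)).arg = (relPos φ i j (m, t + (a : Angle))).arg + a := by
  obtain ⟨h1, h2, h3⟩ := h
  have hpi := Real.pi_gt_three
  have ha' := abs_lt.1 ha
  have h3' := abs_lt.1 h3
  have hz : relPos φ i j (m, t + (a : Angle)) ≠ 0 := Complex.slitPlane_ne_zero h2
  have harg : (Complex.exp (a * Complex.I)).arg = a := by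
    rw [Complex.arg_exp_mul_I, toIocMod_eq_self]
    constructor <;> linarith [ha'.1, ha'.2]
  have key : (relPos φ i j (m, t)).arg = (relPos φ i j (m, t + (a : Angle))).arg + a := by
    rw [relPos_add (s := (a : Angle)), unit_coe, Complex.arg_mul hz (Complex.exp_ne_zero _), harg]
    rw [harg]
    constructor <;> linarith [ha'.1, ha'.2, h3'.1, h3'.2]
  refine ⟨⟨h1, ?_, ?_⟩, key⟩
  · rw [Complex.mem_slitPlane_iff_arg, key]
    refine ⟨by linarith [ha'.1, ha'.2, h3'.1, h3'.2], ?_⟩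
    rw [relPos_add (s := (a : Angle)), unit_coe]
    exact mul_ne_zero hz (Complex.exp_ne_zero _)
  · rw [key, abs_lt]
    constructor <;> linarith [ha'.1, ha'.2, h3'.1, h3'.2]

theorem exists_ball_factor [T2Space M] [LocallyCompactSpace M] [MeasurableSpace M] [BorelSpace M]
    {X : Set M} {μ : Measure M} {c : ENNReal} (hij : i ≠ j)
    (hφ : {y | PlaneRotation.sq y ≤ 1} ⊆ φ.target) (hX : Disjoint φ.source X)
    (hμ : ∀ B ⊆ φ.target, MeasurableSet B → μ (φ.symm '' B) = c * volume B) :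
    ∃ Ω : Set (MPHomeoFixSet M X μ), IsOpen Ω ∧ Ω.Nonempty ∧ ∃ S : Set (MPHomeoFixSet M X μ),
      Nonempty (Ω ≃ₜ S × Metric.ball (0 : C₀(ℕ, ℝ)) 1) := by
  have hpush : ∀ v, Continuous (push φ i j v) := fun v =>
    (continuous_push hij hφ).comp (continuous_const.prodMk continuous_id : Continuous fun m => (v, m))
  have hpolar : ∀ d, polar i j d ∈ φ.target := fun d => hφ <| by
    rw [Set.mem_ofPred_eq, sq_polar hij]
    exact d.1.2.2.trans (by norm_num)
  let H : C₀(ℕ, ℝ) → C(M, M) := fun v => ⟨push φ i j v, hpush v⟩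
  have hH : ∀ v, H v ∈ MPHomeoFixSet M X μ := fun v => by
    refine ⟨?_, fun x hx => push_of_notMem (Set.disjoint_right.1 hX hx),
      measure_preimage_push hij hφ hμ v⟩
    let e : M ≃ₜ M := ⟨⟨push φ i j v, push φ i j (-v), push_neg_push hij hφ v,
      push_push_neg hij hφ v⟩, hpush v, hpush (-v)⟩
    exact e.isHomeomorph
  let act : MPHomeoFixSet M X μ → C₀(ℕ, ℝ) → MPHomeoFixSet M X μ := fun g v =>
    ⟨g.1.comp (H v), comp_mem_mpHomeoFixSet g.2 (hH v)⟩
  have hact : Continuous fun p : MPHomeoFixSet M X μ × C₀(ℕ, ℝ) => act p.1 p.2 := by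
    refine Continuous.subtype_mk (ContinuousMap.continuous_of_continuous_uncurry _ ?_) _
    have h1 : Continuous fun q : (MPHomeoFixSet M X μ × C₀(ℕ, ℝ)) × M => push φ i j q.1.2 q.2 :=
      (continuous_push hij hφ).comp ((continuous_snd.comp continuous_fst).prodMk continuous_snd)
    exact (continuous_subtype_val.comp (continuous_fst.comp continuous_fst)).eval h1
  let Q : C(Annulus, M) := ⟨fun d => φ.symm (polar i j d),
    φ.continuousOn_symm.comp_continuous continuous_polar hpolar⟩
  have hQ : ∀ v d, push φ i j v (Q d) = Q (d.1, d.2 + (profile v d.1 : ℝ)) := fun v d => by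
    have : Q d ∈ φ.source := φ.map_target (hpolar d)
    rw [push_of_mem this]
    simp only [Q, ContinuousMap.coe_mk]
    rw [φ.right_inv (hpolar d), twist_polar hij]
  let ev : MPHomeoFixSet M X μ → C(Annulus, M × Angle) := fun g =>
    ⟨fun d => (g.1 (Q d), d.2), (g.1.continuous.comp Q.continuous).prodMk continuous_snd⟩
  have hev' : Continuous fun p : MPHomeoFixSet M X μ × Annulus => ev p.1 p.2 :=
    ((continuous_subtype_val.comp continuous_fst).eval
      (Q.continuous.comp continuous_snd)).prodMk (continuous_snd.comp continuous_snd)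
  have hev : Continuous ev := ContinuousMap.continuous_of_continuous_uncurry _ hev'
  let V : ℝ → Set (MPHomeoFixSet M X μ) := fun r => {g | ∀ d, ev g d ∈ sector φ i j r}
  have hV : ∀ r, IsOpen (V r) := fun r => by
    convert (ContinuousMap.isOpen_setOfPred_mapsTo (isCompact_univ (X := Annulus))
      (isOpen_sector (φ := φ) (i := i) (j := j) r)).preimage hev using 1
    ext g
    simp [V, Set.MapsTo]
  have hcomp : ∀ g ∈ V 1, ∀ v : C₀(ℕ, ℝ), ‖v‖ < 1 → ∀ d : Annulus,
      ev (act g v) d ∈ sector φ i j 2 ∧ (relPos φ i j (ev (act g v) d)).arg =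
        (relPos φ i j (ev g (d.1, d.2 + (profile v d.1 : ℝ)))).arg + profile v d.1 := by
    intro g hg v hv d
    have h1 := sector_add (hg (d.1, d.2 + (profile v d.1 : ℝ)))
      ((abs_profile_le v d.1).trans_lt hv)
    have h2 : ev (act g v) d = (g.1 (Q (d.1, d.2 + (profile v d.1 : ℝ))), d.2) := by
      simp only [ev, act, H, ContinuousMap.coe_mk, ContinuousMap.comp_apply, hQ]
    rw [h2]
    exact h1
  have hcont : ∀ g : V 2, Continuous fun d => (relPos φ i j (ev g d)).arg := fun g =>
    continuous_iff_continuousAt.2 fun d =>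
      (continuousAt_arg_relPos (g.2 d)).comp (ev g).continuous.continuousAt
  let A : V 2 → C(Annulus, ℝ) := fun g => ⟨fun d => (relPos φ i j (ev g d)).arg, hcont g⟩
  have hA : Continuous A := by
    refine ContinuousMap.continuous_of_continuous_uncurry _ (continuous_iff_continuousAt.2 ?_)
    rintro ⟨g, d⟩
    exact ContinuousAt.comp (f := fun p : V 2 × Annulus => ev p.1 p.2) (x := (g, d))
      (continuousAt_arg_relPos (g.2 d))
      (hev'.comp ((continuous_subtype_val.comp continuous_fst).prodMk
        continuous_snd)).continuousAt
  have hUV : V 1 ⊆ V 2 := fun g hg d => ⟨(hg d).1, (hg d).2.1, (hg d).2.2.trans (by norm_num)⟩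
  let o : MPHomeoFixSet M X μ := ⟨ContinuousMap.id M, id_mem_mpHomeoFixSet X μ⟩
  have ho : ∀ d, (ev o d).1 ∈ φ.source ∧ relPos φ i j (ev o d) = (√(d.1 : ℝ) : ℝ) := fun d => by
    refine ⟨φ.map_target (hpolar d), ?_⟩
    change toC i j (φ (φ.symm (polar i j d))) * (starRingEnd ℂ) (unit d.2) = _
    rw [φ.right_inv (hpolar d), toC_polar hij, mul_assoc, unit_mul_conj, mul_one]
  have ho1 : o ∈ V 1 := fun d => by
    have hd : (0 : ℝ) < d.1 := lt_of_lt_of_le (by norm_num) d.1.2.1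
    refine ⟨(ho d).1, ?_, ?_⟩
    · rw [(ho d).2]
      exact Complex.ofReal_mem_slitPlane.2 (Real.sqrt_pos.2 hd)
    · rw [(ho d).2, Complex.arg_ofReal_of_nonneg (Real.sqrt_nonneg _)]
      simp
  refine _root_.exists_ball_factor act hact (fun g v => ?_) (hV 1) (hV 2) hUV
    (fun g => means (A g)) (continuous_means.comp hA)
    (fun g hg v hv d => (hcomp g hg v hv d).1) (fun g hg v hv => ?_) ho1 ?_
  · apply Subtype.ext
    ext m
    exact congrArg g.1 (push_push_neg hij hφ v m)
  · exact means_eq_add fun s t => (hcomp g hg v hv (s, t)).2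
  · have : A ⟨o, hUV ho1⟩ = 0 := by
      ext d
      change (relPos φ i j (ev o d)).arg = 0
      rw [(ho d).2, Complex.arg_ofReal_of_nonneg (Real.sqrt_nonneg _)]
    change means (A ⟨o, hUV ho1⟩) = 0
    rw [this]
    ext k
    rw [means_apply]
    simp [mean]

end ChartTwist

end

section

open Filter Topology TopologicalSpace MeasureTheory

namespace OxtobyUlam

variable {ι : Type*}

/-- The unit cube. -/
abbrev Cube (ι : Type*) : Type _ := ι → unitInterval

/-- The boundary of the unit cube. -/
def bdry (ι : Type*) : Set (Cube ι) := {x | ∃ j, x j = 0 ∨ x j = 1}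

theorem isClosed_bdry [Finite ι] : IsClosed (bdry ι) := by
  have : bdry ι = ⋃ j, {x : Cube ι | x j = 0 ∨ x j = 1} := by ext; simp [bdry]
  rw [this]
  refine isClosed_iUnion_of_finite fun j => ?_
  exact (isClosed_eq (continuous_apply j) continuous_const).union
    (isClosed_eq (continuous_apply j) continuous_const)

theorem dense_compl_bdry : Dense (bdry ι)ᶜ := by
  have h : Dense ({0, 1}ᶜ : Set unitInterval) := by
    have := (dense_univ (X := unitInterval)).sdiff_finite (t := {0, 1}) (by simp)
    rwa [← Set.compl_eq_univ_sdiff] at this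
  convert dense_pi Set.univ fun (_ : ι) _ => h using 1
  ext x
  simp [bdry]

/-- A finite measure on the cube without atoms, with full support, and vanishing on the
boundary. -/
structure IsGood [Fintype ι] (α : Measure (Cube ι)) : Prop where
  finite : IsFiniteMeasure α
  atom : ∀ x, α {x} = 0
  pos : ∀ V : Set (Cube ι), IsOpen V → V.Nonempty → 0 < α V
  bdry : α (bdry ι) = 0

/-- A subdivision of the cube into topological cubes with disjoint interiors. -/
structure IsCells {A : Type*} (κ : A → Cube ι → Cube ι) : Prop where
  cont : ∀ a, Continuous (κ a)
  inj : ∀ a, Function.Injective (κ a)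
  cover : ∀ z, ∃ a x, κ a x = z
  inter : ∀ a b x y, a ≠ b → κ a x = κ b y → x ∈ bdry ι
  bdry : ∀ a x, κ a x ∈ bdry ι → x ∈ bdry ι

namespace IsCells

variable {A : Type*} {κ : A → Cube ι → Cube ι}

theorem isClosedEmbedding (hκ : IsCells κ) (a : A) : IsClosedEmbedding (κ a) :=
  (hκ.cont a).isClosedEmbedding (hκ.inj a)

theorem homeo_comp (hκ : IsCells κ) {h : Cube ι ≃ₜ Cube ι} (hh : ∀ x ∈ OxtobyUlam.bdry ι, h x = x) :
    IsCells fun a x => h (κ a x) where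
  cont a := h.continuous.comp (hκ.cont a)
  inj a := h.injective.comp (hκ.inj a)
  cover z := by
    obtain ⟨a, x, hx⟩ := hκ.cover (h.symm z)
    exact ⟨a, x, by rw [hx, h.apply_symm_apply]⟩
  inter a b x y hab h' := hκ.inter a b x y hab (h.injective h')
  bdry a x hx := by
    have h1 := h.injective (hh _ hx)
    rw [h1] at hx
    exact hκ.bdry a x hx

theorem trans (hκ : IsCells κ) {B : A → Type*} {κ' : (a : A) → B a → Cube ι → Cube ι}
    (hκ' : ∀ a, IsCells (κ' a)) : IsCells fun (p : Σ a, B a) x => κ p.1 (κ' p.1 p.2 x) where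
  cont p := (hκ.cont _).comp ((hκ' _).cont _)
  inj p := (hκ.inj _).comp ((hκ' _).inj _)
  cover z := by
    obtain ⟨a, x, rfl⟩ := hκ.cover z
    obtain ⟨b, y, rfl⟩ := (hκ' a).cover x
    exact ⟨⟨a, b⟩, y, rfl⟩
  inter := by
    rintro ⟨a, b⟩ ⟨a', b'⟩ x y hne h
    by_cases haa : a = a'
    · subst haa
      have hb : b ≠ b' := by rintro rfl; exact hne rfl
      exact (hκ' a).inter b b' x y hb (hκ.inj a h)
    · exact (hκ' a).bdry b x (hκ.inter _ _ _ _ haa h)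
  bdry p x hx := (hκ' _).bdry _ _ (hκ.bdry _ _ hx)

theorem exists_continuous_glue [Finite A] (hκ : IsCells κ) {g : A → Cube ι → Cube ι}
    (hg : ∀ a, Continuous (g a)) (hb : ∀ a, ∀ x ∈ OxtobyUlam.bdry ι, g a x = x) :
    ∃ F : Cube ι → Cube ι, Continuous F ∧ ∀ a x, F (κ a x) = κ a (g a x) := by
  let π : (Σ _ : A, Cube ι) → Cube ι := fun p => κ p.1 p.2
  have hπ : Continuous π := continuous_sigma hκ.cont
  have hsurj : Function.Surjective π := fun z => by
    obtain ⟨a, x, hx⟩ := hκ.cover z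
    exact ⟨⟨a, x⟩, hx⟩
  have hq : IsQuotientMap π := hπ.isClosedMap.isQuotientMap hπ hsurj
  let F : Cube ι → Cube ι := fun z =>
    κ (Function.surjInv hsurj z).1 (g (Function.surjInv hsurj z).1 (Function.surjInv hsurj z).2)
  have hF : ∀ a x, F (κ a x) = κ a (g a x) := by
    intro a x
    have h1 : κ (Function.surjInv hsurj (κ a x)).1 (Function.surjInv hsurj (κ a x)).2 = κ a x :=
      Function.surjInv_eq hsurj (κ a x)
    revert h1
    simp only [F]
    generalize Function.surjInv hsurj (κ a x) = p
    obtain ⟨b, y⟩ := p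
    intro h1
    by_cases hab : a = b
    · subst hab
      have := hκ.inj a h1
      subst this
      rfl
    · change κ b (g b y) = _
      rw [hb a x (hκ.inter a b x y hab h1.symm), hb b y (hκ.inter b a y x (Ne.symm hab) h1)]
      exact h1
  refine ⟨F, ?_, hF⟩
  rw [hq.continuous_iff]
  refine continuous_sigma fun a => ?_
  refine ((hκ.cont a).comp (hg a)).congr fun x => (hF a x).symm

theorem exists_glue [Finite A] (hκ : IsCells κ) {g : A → Cube ι ≃ₜ Cube ι}
    (hb : ∀ a, ∀ x ∈ OxtobyUlam.bdry ι, g a x = x) :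
    ∃ G : Cube ι ≃ₜ Cube ι, (∀ a x, G (κ a x) = κ a (g a x)) ∧
      ∀ x ∈ OxtobyUlam.bdry ι, G x = x := by
  obtain ⟨F, hFc, hF⟩ := hκ.exists_continuous_glue (fun a => (g a).continuous) hb
  obtain ⟨F', hFc', hF'⟩ := hκ.exists_continuous_glue (fun a => (g a).symm.continuous)
    fun a x hx => (g a).injective (by rw [(g a).apply_symm_apply, hb a x hx])
  refine ⟨⟨⟨F, F', fun z => ?_, fun z => ?_⟩, hFc, hFc'⟩, hF, fun z hz => ?_⟩
  · obtain ⟨a, x, rfl⟩ := hκ.cover z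
    rw [hF, hF', (g a).symm_apply_apply]
  · obtain ⟨a, x, rfl⟩ := hκ.cover z
    rw [hF', hF, (g a).apply_symm_apply]
  · obtain ⟨a, x, rfl⟩ := hκ.cover z
    exact (hF a x).trans (by rw [hb a x (hκ.bdry a x hz)])

theorem measurableEmbedding [Fintype ι] (hκ : IsCells κ) (a : A) : MeasurableEmbedding (κ a) :=
  (hκ.isClosedEmbedding a).measurableEmbedding

/-- The image of a nonempty open set under a cell has nonempty interior. -/
theorem exists_isOpen_subset_image [Finite A] (hκ : IsCells κ) (a : A) {V : Set (Cube ι)}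
    (hV : IsOpen V) (hne : V.Nonempty) :
    ∃ O : Set (Cube ι), IsOpen O ∧ O.Nonempty ∧ O ⊆ κ a '' V := by
  obtain ⟨x, hxV, hx⟩ := dense_compl_bdry.inter_open_nonempty V hV hne
  obtain ⟨O, hO, rfl⟩ := (hκ.isClosedEmbedding a).isInducing.isOpen_iff.1 hV
  have hC : IsClosed (⋃ b : {b // b ≠ a}, Set.range (κ b)) :=
    isClosed_iUnion_of_finite fun b => (hκ.isClosedEmbedding b).isClosed_range
  refine ⟨O ∩ (⋃ b : {b // b ≠ a}, Set.range (κ b))ᶜ, hO.inter hC.isOpen_compl,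
    ⟨κ a x, hxV, ?_⟩, ?_⟩
  · simp only [Set.mem_compl_iff, Set.mem_iUnion, not_exists]
    rintro ⟨b, hb⟩ ⟨y, hy⟩
    exact hx (hκ.inter a b x y hb.symm hy.symm)
  · rintro z ⟨hz, hz'⟩
    obtain ⟨b, y, rfl⟩ := hκ.cover z
    have hb : b = a := by
      by_contra hb
      exact hz' (Set.mem_iUnion.2 ⟨⟨b, hb⟩, y, rfl⟩)
    subst hb
    exact ⟨y, hz, rfl⟩

theorem isGood_comap [Fintype ι] [Finite A] (hκ : IsCells κ) {α : Measure (Cube ι)}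
    (hα : IsGood α) (a : A) (hbd : α (κ a '' OxtobyUlam.bdry ι) = 0) : IsGood (α.comap (κ a)) := by
  have hc := (hκ.measurableEmbedding a).comap_apply α
  have := hα.finite
  refine ⟨⟨?_⟩, fun x => ?_, fun V hV hne => ?_, ?_⟩
  · rw [hc]; exact measure_lt_top _ _
  · rw [hc, Set.image_singleton]; exact hα.atom _
  · obtain ⟨O, hO, hne', hsub⟩ := hκ.exists_isOpen_subset_image a hV hne
    rw [hc]
    exact (hα.pos O hO hne').trans_le (measure_mono hsub)
  · rw [hc]; exact hbd

/-- The measure of a union of cells with null boundaries. -/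
theorem sum_measure_range [Fintype ι] [Fintype A] (hκ : IsCells κ) {α : Measure (Cube ι)}
    (hbd : ∀ a, α (κ a '' OxtobyUlam.bdry ι) = 0) (S : Finset A) :
    ∑ a ∈ S, α (Set.range (κ a)) = α (⋃ a ∈ S, Set.range (κ a)) := by
  refine (measure_biUnion_finset₀ (fun a _ b _ hab => ?_) fun a _ =>
    (hκ.isClosedEmbedding a).isClosed_range.measurableSet.nullMeasurableSet).symm
  refine measure_mono_null ?_ (hbd a)
  rintro z ⟨⟨x, rfl⟩, ⟨y, hy⟩⟩
  exact ⟨x, hκ.inter a b x y hab hy.symm, rfl⟩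

end IsCells

/-- The measures `α` and `β` give corresponding cells the same mass. -/
structure IsMatch [Fintype ι] {A : Type*} (α β : Measure (Cube ι)) (h : Cube ι ≃ₜ Cube ι)
    (κ : A → Cube ι → Cube ι) : Prop where
  cells : IsCells κ
  fix : ∀ x ∈ bdry ι, h x = x
  null_left : ∀ a, α (κ a '' bdry ι) = 0
  null_right : ∀ a, β ((fun x => h (κ a x)) '' bdry ι) = 0
  mass : ∀ a, α (Set.range (κ a)) = β (Set.range fun x => h (κ a x))

namespace IsMatch

variable [Fintype ι] {A : Type*} {α β : Measure (Cube ι)} {h : Cube ι ≃ₜ Cube ι}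
  {κ : A → Cube ι → Cube ι}

theorem cells_right (H : IsMatch α β h κ) : IsCells fun a x => h (κ a x) :=
  H.cells.homeo_comp H.fix

theorem swap (H : IsMatch α β h κ) : IsMatch β α h.symm fun a x => h (κ a x) where
  cells := H.cells_right
  fix x hx := h.injective (by rw [h.apply_symm_apply, H.fix x hx])
  null_left := H.null_right
  null_right a := by simpa using H.null_left a
  mass a := by simpa using (H.mass a).symm

theorem refl (hα : IsGood α) (hβ : IsGood β) (hm : α Set.univ = β Set.univ) :
    IsMatch α β (Homeomorph.refl _) fun (_ : Unit) x => x where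
  cells := ⟨fun _ => continuous_id, fun _ => Function.injective_id, fun z => ⟨(), z, rfl⟩,
    fun _ _ _ _ h => (h rfl).elim, fun _ _ h => h⟩
  fix _ _ := rfl
  null_left _ := by simpa using hα.bdry
  null_right _ := by simpa using hβ.bdry
  mass _ := by simpa using hm

theorem trans [Finite A] (H : IsMatch α β h κ) {B : A → Type*} {g : A → Cube ι ≃ₜ Cube ι}
    {κ' : (a : A) → B a → Cube ι → Cube ι}
    (H' : ∀ a, IsMatch (α.comap (κ a)) (β.comap fun x => h (κ a x)) (g a) (κ' a)) :
    ∃ h' : Cube ι ≃ₜ Cube ι, IsMatch α β h' (fun (p : Σ a, B a) x => κ p.1 (κ' p.1 p.2 x)) ∧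
      ∀ a x, h' (κ a x) = h (κ a (g a x)) := by
  obtain ⟨G, hG, hGb⟩ := H.cells.exists_glue fun a => (H' a).fix
  have hα := fun a => (H.cells.measurableEmbedding a).comap_apply α
  have hβ := fun a => (H.cells_right.measurableEmbedding a).comap_apply β
  have hh' : ∀ a x, (G.trans h) (κ a x) = h (κ a (g a x)) := fun a x => by
    rw [Homeomorph.trans_apply, hG]
  refine ⟨G.trans h, ⟨H.cells.trans fun a => (H' a).cells, fun x hx => ?_, ?_, ?_, ?_⟩, hh'⟩
  · rw [Homeomorph.trans_apply, hGb x hx, H.fix x hx]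
  · rintro ⟨a, b⟩
    have := (H' a).null_left b
    rwa [hα, Set.image_image] at this
  · rintro ⟨a, b⟩
    have := (H' a).null_right b
    rw [hβ, Set.image_image] at this
    simpa only [hh'] using this
  · rintro ⟨a, b⟩
    have := (H' a).mass b
    rw [hβ, hα, ← Set.range_comp, ← Set.range_comp] at this
    simpa only [hh', Function.comp_def] using this

theorem isGood_left [Finite A] (H : IsMatch α β h κ) (hα : IsGood α) (a : A) :
    IsGood (α.comap (κ a)) := H.cells.isGood_comap hα a (H.null_left a)

theorem isGood_right [Finite A] (H : IsMatch α β h κ) (hβ : IsGood β) (a : A) :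
    IsGood (β.comap fun x => h (κ a x)) := H.cells_right.isGood_comap hβ a (H.null_right a)

theorem comap_univ (H : IsMatch α β h κ) (a : A) :
    (α.comap (κ a)) Set.univ = (β.comap fun x => h (κ a x)) Set.univ := by
  rw [(H.cells.measurableEmbedding a).comap_apply, (H.cells_right.measurableEmbedding a).comap_apply,
    Set.image_univ, Set.image_univ]
  exact H.mass a

end IsMatch

end OxtobyUlam

end

section

open Filter Topology TopologicalSpace MeasureTheory

namespace OxtobyUlam

/-- If for distinct points `x, y` of `D` the functions `u c` rarely agree at `x` and `y`, then
for some `c` all level sets of `u c` in `D` are null. -/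
theorem exists_null_levels {Z : Type*} [MeasurableSpace Z] [MeasurableEq Z]
    {β : Measure Z} [IsFiniteMeasure β] (hatom : ∀ z, β {z} = 0) {D : Set Z}
    (hD : MeasurableSet D) {u : ℝ → Z → ℝ} (hu : Measurable fun p : ℝ × Z => u p.1 p.2)
    (h : ∀ x ∈ D, ∀ y ∈ D, x ≠ y → volume {c | u c x = u c y} = 0) :
    ∃ c, ∀ s, β (D ∩ {z | u c z = s}) = 0 := by
  let W : Set ((Z × Z) × ℝ) := {p | p.1.1 ∈ D ∧ p.1.2 ∈ D ∧ u p.2 p.1.1 = u p.2 p.1.2}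
  have hW : MeasurableSet W := by
    refine ((measurable_fst.comp measurable_fst) hD).inter
      (((measurable_snd.comp measurable_fst) hD).inter (measurableSet_eq_fun ?_ ?_))
    · exact hu.comp (measurable_snd.prodMk (measurable_fst.comp measurable_fst))
    · exact hu.comp (measurable_snd.prodMk (measurable_snd.comp measurable_fst))
  have hdiag : ∀ᵐ p ∂β.prod β, p.1 ≠ p.2 := by
    have : (β.prod β) (Set.diagonal Z) = 0 := by
      rw [Measure.measure_prod_null measurableSet_diagonal]
      refine Eventually.of_forall fun x => ?_
      have : Prod.mk x ⁻¹' Set.diagonal Z = {x} := by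
        ext y
        simp [eq_comm]
      simp only [this, hatom, Pi.zero_apply]
    rw [ae_iff]
    convert this using 2
    ext p
    simp [Set.mem_diagonal_iff]
  have hW0 : ((β.prod β).prod (volume : Measure ℝ)) W = 0 := by
    rw [Measure.measure_prod_null hW]
    filter_upwards [hdiag] with p hp
    by_cases hp1 : p.1 ∈ D ∧ p.2 ∈ D
    · refine measure_mono_null ?_ (h p.1 hp1.1 p.2 hp1.2 hp)
      intro c hc
      exact hc.2.2
    · have : Prod.mk p ⁻¹' W = ∅ := by
        ext c
        simp only [Set.mem_preimage, Set.mem_empty_iff_false, iff_false]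
        exact fun hc => hp1 ⟨hc.1, hc.2.1⟩
      simp [this]
  have hW1 : ((volume : Measure ℝ).prod (β.prod β)) (Prod.swap ⁻¹' W) = 0 := by
    rw [Measure.measurePreserving_swap.measure_preimage hW.nullMeasurableSet, hW0]
  obtain ⟨c, hc⟩ := (Measure.measure_ae_null_of_prod_null hW1).exists
  refine ⟨c, fun s => ?_⟩
  have : (D ∩ {z | u c z = s}) ×ˢ (D ∩ {z | u c z = s}) ⊆ Prod.mk c ⁻¹' (Prod.swap ⁻¹' W) := by
    rintro ⟨x, y⟩ ⟨hx, hy⟩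
    exact ⟨hx.1, hy.1, (show u c x = s from hx.2).trans (show u c y = s from hy.2).symm⟩
  have h0 := measure_mono_null this hc
  rw [Measure.prod_prod] at h0
  simpa using h0

theorem exists_measure_Iic_eq {ν : Measure ℝ} [IsFiniteMeasure ν] [NullSingletonClass ν]
    {m : ENNReal} (h0 : 0 < m) (hm : m < ν Set.univ) : ∃ s, ν (Set.Iic s) = m := by
  have hcont : Continuous fun s => ν.real (Set.Iic s) := by
    have h1 := intervalIntegral.continuous_primitive (μ := ν) (f := fun _ => (1 : ℝ))
      (fun a b => intervalIntegrable_const) 0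
    simp only [intervalIntegral.integral_const_of_cdf, smul_eq_mul, mul_one] at h1
    exact (h1.add (continuous_const (y := ν.real (Set.Iic 0)))).congr fun s => by simp
  have hmt : m ≠ ⊤ := (hm.trans_le le_top).ne
  obtain ⟨b, hb⟩ := ((tendsto_measure_Iic_atTop ν).eventually_const_lt hm).exists
  have hlt : ν Set.univ - m < ν Set.univ := ENNReal.sub_lt_self (measure_ne_top _ _) hm.ne_bot h0.ne'
  obtain ⟨a, ha⟩ := ((tendsto_measure_Ici_atBot ν).eventually_const_lt hlt).exists
  have hs : m.toReal ∈ Set.range fun s => ν.real (Set.Iic s) := by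
    refine mem_range_of_exists_le_of_exists_ge hcont ⟨a, ?_⟩ ⟨b, ?_⟩
    · refine ENNReal.toReal_mono hmt ?_
      have h1 : ν (Set.Iic a) + ν (Set.Ici a) = ν Set.univ := by
        rw [← measure_congr (Ioi_ae_eq_Ici (μ := ν) (a := a)), ← Set.compl_Iic]
        exact measure_add_measure_compl measurableSet_Iic
      by_contra hcon
      have h2 : ν Set.univ < ν Set.univ := calc
        ν Set.univ = m + (ν Set.univ - m) := (add_tsub_cancel_of_le hm.le).symm
        _ < ν (Set.Iic a) + ν (Set.Ici a) := ENNReal.add_lt_add (not_le.1 hcon) ha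
        _ = ν Set.univ := h1
      exact h2.ne rfl
    · exact ENNReal.toReal_mono (measure_ne_top _ _) hb.le
  obtain ⟨s, hs⟩ := hs
  exact ⟨s, (ENNReal.toReal_eq_toReal_iff' (measure_ne_top _ _) hmt).1 hs⟩

/-- A one-parameter group of homeomorphisms of the unit interval acting simply transitively on its
interior. -/
noncomputable def slide (r : ℝ) (x : unitInterval) : unitInterval :=
  ⟨Real.exp r * x / (Real.exp r * x + (1 - x)), by
    have h0 := x.2.1
    have h1 := x.2.2
    have he := Real.exp_pos r
    constructor
    · exact div_nonneg (by positivity) (add_nonneg (by positivity) (by linarith))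
    · exact div_le_one_of_le₀ (by linarith) (add_nonneg (by positivity) (by linarith))⟩

theorem slide_denom_pos (r : ℝ) (x : unitInterval) : 0 < Real.exp r * (x : ℝ) + (1 - x) := by
  have h0 := x.2.1
  have h1 := x.2.2
  have he := Real.exp_pos r
  rcases h0.eq_or_lt with h | h
  · rw [← h]; simp
  · have := mul_pos he h
    linarith

theorem slide_zero (x : unitInterval) : slide 0 x = x := by
  ext
  simp [slide]

theorem slide_slide (r r' : ℝ) (x : unitInterval) : slide r (slide r' x) = slide (r + r') x := by
  ext
  have h1 := slide_denom_pos r' x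
  have h2 := slide_denom_pos (r + r') x
  have h3 : 0 < Real.exp r * (slide r' x : ℝ) + (1 - slide r' x) := slide_denom_pos r (slide r' x)
  simp only [slide] at h3 ⊢
  rw [Real.exp_add] at h2 ⊢
  rw [div_eq_div_iff h3.ne' h2.ne']
  field_simp
  ring

theorem slide_left (r : ℝ) : slide r 0 = 0 := by
  ext
  simp [slide]

theorem slide_right (r : ℝ) : slide r 1 = 1 := by
  ext
  simp [slide]

theorem continuous_slide : Continuous fun p : ℝ × unitInterval => slide p.1 p.2 := by
  refine Continuous.subtype_mk ?_ _
  refine Continuous.div (by fun_prop) (by fun_prop) fun p => (slide_denom_pos p.1 p.2).ne'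

/-- The parameter moving `t` to `x`. -/
noncomputable def slideTime (t x : ℝ) : ℝ := Real.log (x * (1 - t) / (t * (1 - x)))

theorem slide_le_iff {r t : ℝ} {x : unitInterval} (ht0 : 0 < t) (ht1 : t < 1)
    (hx0 : x ≠ 0) (hx1 : x ≠ 1) : (slide (-r) x : ℝ) ≤ t ↔ slideTime t x ≤ r := by
  have h0 : (0 : ℝ) < x := unitInterval.pos_iff_ne_zero.2 hx0
  have h1 : (x : ℝ) < 1 := unitInterval.lt_one_iff_ne_one.2 hx1
  have h2 : 0 < 1 - (x : ℝ) := by linarith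
  have h3 : 0 < 1 - t := by linarith
  have he := Real.exp_pos r
  rw [slideTime, Real.log_le_iff_le_exp (by positivity), div_le_iff₀ (by positivity)]
  simp only [slide]
  rw [div_le_iff₀ (slide_denom_pos _ _), Real.exp_neg]
  rw [← mul_le_mul_iff_right₀ he]
  field_simp
  constructor <;> intro h <;> nlinarith

theorem le_slide_iff {r t : ℝ} {x : unitInterval} (ht0 : 0 < t) (ht1 : t < 1)
    (hx0 : x ≠ 0) (hx1 : x ≠ 1) : t ≤ (slide (-r) x : ℝ) ↔ r ≤ slideTime t x := by
  have h0 : (0 : ℝ) < x := unitInterval.pos_iff_ne_zero.2 hx0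
  have h1 : (x : ℝ) < 1 := unitInterval.lt_one_iff_ne_one.2 hx1
  have h2 : 0 < 1 - (x : ℝ) := by linarith
  have h3 : 0 < 1 - t := by linarith
  have he := Real.exp_pos r
  rw [slideTime, Real.le_log_iff_exp_le (by positivity), le_div_iff₀ (by positivity)]
  simp only [slide]
  rw [le_div_iff₀ (slide_denom_pos _ _), Real.exp_neg]
  rw [← mul_le_mul_iff_right₀ he]
  field_simp
  constructor <;> intro h <;> nlinarith

theorem slideTime_injOn {t : ℝ} (ht0 : 0 < t) (ht1 : t < 1) :
    Set.InjOn (slideTime t) (Set.Ioo 0 1) := by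
  rintro x ⟨hx0, hx1⟩ y ⟨hy0, hy1⟩ h
  have h2 : 0 < 1 - x := by linarith
  have h2' : 0 < 1 - y := by linarith
  have h3 : 0 < 1 - t := by linarith
  have h4 := Real.log_injOn_pos (Set.mem_Ioi.2 (by positivity)) (Set.mem_Ioi.2 (by positivity)) h
  rw [div_eq_div_iff (by positivity) (by positivity)] at h4
  have h5 : t * (1 - t) * (x - y) = 0 := by linear_combination h4
  have : 0 < t * (1 - t) := by positivity
  have := (mul_eq_zero.1 h5).resolve_left this.ne'
  linarith

end OxtobyUlam

end

section

open Filter Topology TopologicalSpace MeasureTheory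

namespace OxtobyUlam

variable {ι : Type*} [DecidableEq ι]

/-- The two halves of the cube cut at `x i = t`. -/
def cut (i : ι) (t : unitInterval) (a : Bool) (x : Cube ι) : Cube ι :=
  Function.update x i
    (if a then unitInterval.symm (unitInterval.symm t * unitInterval.symm (x i)) else t * x i)

theorem cut_of_ne {i j : ι} (h : j ≠ i) (t : unitInterval) (a : Bool) (x : Cube ι) :
    cut i t a x j = x j := Function.update_of_ne h _ _

theorem cut_false_self (i : ι) (t : unitInterval) (x : Cube ι) :
    (cut i t false x i : ℝ) = t * x i := by simp [cut]

theorem cut_true_self (i : ι) (t : unitInterval) (x : Cube ι) :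
    (cut i t true x i : ℝ) = t + (1 - t) * x i := by simp [cut]; ring

theorem continuous_cut (i : ι) (t : unitInterval) (a : Bool) : Continuous (cut i t a) := by
  refine continuous_id.update i ?_
  split_ifs
  · exact unitInterval.continuous_symm.comp
      (continuous_const.mul (unitInterval.continuous_symm.comp (continuous_apply i)))
  · exact continuous_const.mul (continuous_apply i)

variable {i : ι} {t : unitInterval}

theorem range_cut_false (ht0 : 0 < (t : ℝ)) :
    Set.range (cut i t false) = {x : Cube ι | (x i : ℝ) ≤ t} := by
  ext z
  constructor
  · rintro ⟨x, rfl⟩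
    rw [Set.mem_ofPred_eq, cut_false_self]
    have := (x i).2.2
    nlinarith
  · intro hz
    refine ⟨Function.update z i ⟨z i / t, div_nonneg (z i).2.1 ht0.le, div_le_one_of_le₀ hz ht0.le⟩, ?_⟩
    ext j
    by_cases hj : j = i
    · subst hj
      rw [cut_false_self]
      simp only [Function.update_self]
      field_simp
    · rw [cut_of_ne hj, Function.update_of_ne hj]

theorem range_cut_true (ht1 : (t : ℝ) < 1) :
    Set.range (cut i t true) = {x : Cube ι | (t : ℝ) ≤ x i} := by
  have h : 0 < 1 - (t : ℝ) := by linarith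
  ext z
  constructor
  · rintro ⟨x, rfl⟩
    rw [Set.mem_ofPred_eq, cut_true_self]
    have := (x i).2.1
    nlinarith
  · intro hz
    have hz : (t : ℝ) ≤ z i := hz
    have hz1 := (z i).2.2
    refine ⟨Function.update z i ⟨(z i - t) / (1 - t), div_nonneg (by linarith) h.le,
      div_le_one_of_le₀ (by linarith) h.le⟩, ?_⟩
    ext j
    by_cases hj : j = i
    · subst hj
      rw [cut_true_self]
      simp only [Function.update_self]
      field_simp
      ring
    · rw [cut_of_ne hj, Function.update_of_ne hj]

theorem isCells_cut (ht0 : 0 < (t : ℝ)) (ht1 : (t : ℝ) < 1) : IsCells (cut i t) where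
  cont := continuous_cut i t
  inj a x y hxy := by
    have h : 0 < 1 - (t : ℝ) := by linarith
    ext j
    by_cases hj : j = i
    · subst hj
      have h1 := congrArg (fun z : Cube ι => (z j : ℝ)) hxy
      cases a
      · simp only [cut_false_self] at h1
        exact mul_left_cancel₀ ht0.ne' h1
      · simp only [cut_true_self] at h1
        exact mul_left_cancel₀ h.ne' (add_left_cancel h1)
    · have h1 := congrFun hxy j
      rw [cut_of_ne hj, cut_of_ne hj] at h1
      rw [h1]
  cover z := by
    rcases le_total (z i : ℝ) t with h | h
    · exact ⟨false, (range_cut_false ht0).ge h⟩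
    · exact ⟨true, (range_cut_true ht1).ge h⟩
  inter a b x y hab hxy := by
    have h1 := congrArg (fun z : Cube ι => (z i : ℝ)) hxy
    have hx0 := (x i).2.1
    have hx1 := (x i).2.2
    have hy0 := (y i).2.1
    have hy1 := (y i).2.2
    refine ⟨i, ?_⟩
    cases a <;> cases b
    · exact (hab rfl).elim
    · right
      simp only [cut_false_self, cut_true_self] at h1
      have : (x i : ℝ) = 1 := le_antisymm hx1 (by nlinarith)
      exact Subtype.ext this
    · left
      simp only [cut_false_self, cut_true_self] at h1
      have : (x i : ℝ) = 0 := le_antisymm (by nlinarith) hx0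
      exact Subtype.ext this
    · exact (hab rfl).elim
  bdry a x := by
    rintro ⟨j, hj⟩
    refine ⟨j, ?_⟩
    by_cases hji : j = i
    · subst hji
      have hx0 := (x j).2.1
      have hx1 := (x j).2.2
      rw [Subtype.ext_iff, Subtype.ext_iff] at hj ⊢
      cases a
      · simp only [cut_false_self, Set.Icc.coe_zero, Set.Icc.coe_one] at hj ⊢
        rcases hj with hj | hj
        · left; nlinarith
        · right; nlinarith
      · simp only [cut_true_self, Set.Icc.coe_zero, Set.Icc.coe_one] at hj ⊢
        rcases hj with hj | hj
        · left; nlinarith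
        · right; nlinarith
    · rwa [cut_of_ne hji] at hj

theorem image_cut_bdry_subset (a : Bool) :
    cut i t a '' bdry ι ⊆ bdry ι ∪ {x | (x i : ℝ) = t} := by
  rintro _ ⟨x, ⟨j, hj⟩, rfl⟩
  by_cases hji : j = i
  · subst hji
    cases a
    · rcases hj with hj | hj
      · left; exact ⟨j, Or.inl (Subtype.ext (by rw [cut_false_self, hj]; simp))⟩
      · right; rw [Set.mem_ofPred_eq, cut_false_self, hj]; simp
    · rcases hj with hj | hj
      · right; rw [Set.mem_ofPred_eq, cut_true_self, hj]; simp
      · left; exact ⟨j, Or.inr (Subtype.ext (by rw [cut_true_self, hj]; simp))⟩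
  · left
    exact ⟨j, by rwa [cut_of_ne hji]⟩

theorem dist_cut_le (ht0 : 1 / 3 ≤ (t : ℝ)) (ht1 : (t : ℝ) ≤ 2 / 3) (a : Bool) (x y : Cube ι)
    (j : ι) : |(cut i t a x j : ℝ) - cut i t a y j| ≤
      (if j = i then 2 / 3 else 1) * |(x j : ℝ) - y j| := by
  split_ifs with hj
  · subst hj
    cases a
    · rw [cut_false_self, cut_false_self, ← mul_sub, abs_mul, abs_of_nonneg t.2.1]
      gcongr
    · rw [cut_true_self, cut_true_self, add_sub_add_left_eq_sub, ← mul_sub, abs_mul,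
        abs_of_nonneg (by linarith [t.2.2])]
      gcongr
      linarith
  · rw [cut_of_ne hj, cut_of_ne hj, one_mul]

/-- Slide the `i`-th coordinate of each point `x` by the amount `f x`. -/
noncomputable def shear (i : ι) (f : Cube ι → ℝ) (hf : Continuous f)
    (hfi : ∀ x y, f (Function.update x i y) = f x) : Cube ι ≃ₜ Cube ι where
  toFun x := Function.update x i (slide (f x) (x i))
  invFun x := Function.update x i (slide (-f x) (x i))
  left_inv x := by simp [hfi, slide_slide, slide_zero]
  right_inv x := by simp [hfi, slide_slide, slide_zero]
  continuous_toFun := by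
    refine continuous_id.update i ?_
    have := continuous_slide.comp (hf.prodMk (continuous_apply i))
    exact this
  continuous_invFun := by
    refine continuous_id.update i ?_
    have := continuous_slide.comp (hf.neg.prodMk (continuous_apply i))
    exact this

theorem shear_symm_apply (f : Cube ι → ℝ) (hf : Continuous f)
    (hfi : ∀ x y, f (Function.update x i y) = f x) (x : Cube ι) :
    (shear i f hf hfi).symm x = Function.update x i (slide (-f x) (x i)) := rfl

variable [Fintype ι]

/-- A weight on the faces orthogonal to the `i`-th direction vanishing on their boundaries. -/
def faceBump (i : ι) (x : Cube ι) : ℝ := ∏ j ∈ Finset.univ.erase i, (x j : ℝ) * (1 - x j)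

/-- A family of linear functionals not involving the `i`-th coordinate. -/
def faceForm (i : ι) (e : ι → ℕ) (c : ℝ) (x : Cube ι) : ℝ :=
  ∑ j ∈ Finset.univ.erase i, c ^ (e j + 1) * (x j : ℝ)

theorem continuous_faceBump (i : ι) : Continuous (faceBump i) := by
  unfold faceBump
  fun_prop

theorem continuous_faceForm (i : ι) (e : ι → ℕ) :
    Continuous fun p : ℝ × Cube ι => faceForm i e p.1 p.2 := by
  unfold faceForm
  fun_prop

theorem faceBump_congr {x y : Cube ι} (h : ∀ j ≠ i, x j = y j) : faceBump i x = faceBump i y :=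
  Finset.prod_congr rfl fun j hj => by rw [h j (Finset.ne_of_mem_erase hj)]

theorem faceForm_congr {e : ι → ℕ} {c : ℝ} {x y : Cube ι} (h : ∀ j ≠ i, x j = y j) :
    faceForm i e c x = faceForm i e c y :=
  Finset.sum_congr rfl fun j hj => by rw [h j (Finset.ne_of_mem_erase hj)]

theorem faceBump_pos {x : Cube ι} (hx : x ∉ bdry ι) : 0 < faceBump i x := by
  refine Finset.prod_pos fun j _ => ?_
  have h : x j ≠ 0 ∧ x j ≠ 1 := by
    constructor <;> intro h <;> exact hx ⟨j, by simp [h]⟩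
  exact mul_pos (unitInterval.pos_iff_ne_zero.2 h.1)
    (sub_pos.2 (unitInterval.lt_one_iff_ne_one.2 h.2))

theorem faceBump_eq_zero {x : Cube ι} {j : ι} (hj : j ≠ i) (h : x j = 0 ∨ x j = 1) :
    faceBump i x = 0 := by
  refine Finset.prod_eq_zero (Finset.mem_erase.2 ⟨hj, Finset.mem_univ j⟩) ?_
  rcases h with h | h <;> simp [h]

theorem finite_setOf_faceForm_eq {e : ι → ℕ} (he : Function.Injective e) {x y : Cube ι} {j : ι}
    (hj : j ≠ i) (hxy : x j ≠ y j) (A B : ℝ) :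
    {c | A + faceForm i e c x = B + faceForm i e c y}.Finite := by
  let P : Polynomial ℝ := Polynomial.C (A - B) + ∑ k ∈ Finset.univ.erase i,
    Polynomial.C ((x k : ℝ) - y k) * Polynomial.X ^ (e k + 1)
  have hP : P ≠ 0 := by
    intro h0
    have h1 : P.coeff (e j + 1) = (x j : ℝ) - y j := by
      simp only [P, Polynomial.coeff_add, Polynomial.coeff_C_succ, zero_add,
        Polynomial.finsetSum_coeff, Polynomial.coeff_C_mul_X_pow, add_left_inj]
      rw [Finset.sum_eq_single j]
      · simp
      · intro k _ hk
        rw [if_neg fun h => hk (he h).symm]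
      · intro h
        exact (h (Finset.mem_erase.2 ⟨hj, Finset.mem_univ j⟩)).elim
    rw [h0, Polynomial.coeff_zero] at h1
    exact hxy (Subtype.ext (by linarith))
  refine (P.rootSet_finite ℝ).subset fun c hc => ?_
  rw [Polynomial.mem_rootSet]
  refine ⟨hP, ?_⟩
  have hc : A + faceForm i e c x = B + faceForm i e c y := hc
  simp only [P, map_add, map_sum, map_mul, Polynomial.aeval_C, Polynomial.aeval_X, map_pow]
  simp only [faceForm] at hc
  simp only [Algebra.algebraMap_self, RingHom.id_apply, sub_mul, Finset.sum_sub_distrib]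
  simp only [mul_comm (c ^ _)] at hc
  linarith

end OxtobyUlam

end

section

open Filter Topology TopologicalSpace MeasureTheory

namespace OxtobyUlam

variable {ι : Type*} [DecidableEq ι] [Fintype ι]

theorem exists_null_wall {α : Measure (Cube ι)} [IsFiniteMeasure α] (i : ι) :
    ∃ t : unitInterval, 1 / 3 ≤ (t : ℝ) ∧ (t : ℝ) ≤ 2 / 3 ∧ α {x | (x i : ℝ) = t} = 0 := by
  have hm : Measurable fun x : Cube ι => (x i : ℝ) := by fun_prop
  have hc := Measure.countable_meas_level_set_pos (μ := α) hm
  have hI : ¬ (Set.Icc (1 / 3 : ℝ) (2 / 3)).Countable := by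
    rw [← Cardinal.le_aleph0_iff_set_countable, Cardinal.mk_Icc_real (by norm_num), not_le]
    exact Cardinal.aleph0_lt_continuum
  obtain ⟨t, ht, htn⟩ : ∃ t ∈ Set.Icc (1 / 3 : ℝ) (2 / 3), t ∉ {t | 0 < α {x | (x i : ℝ) = t}} := by
    by_contra! h
    exact hI (hc.mono h)
  refine ⟨⟨t, by linarith [ht.1], by linarith [ht.2]⟩, ht.1, ht.2, ?_⟩
  simpa using htn

/-- The function whose sublevel sets become half cubes after shearing. -/
noncomputable def wall (i : ι) (e : ι → ℕ) (t c : ℝ) (x : Cube ι) : ℝ :=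
  slideTime t (x i) / faceBump i x + faceForm i e c x

theorem measurable_wall (i : ι) (e : ι → ℕ) (t : ℝ) :
    Measurable fun p : ℝ × Cube ι => wall i e t p.1 p.2 := by
  unfold wall slideTime
  have h1 : Measurable fun p : ℝ × Cube ι => (p.2 i : ℝ) :=
    measurable_subtype_coe.comp ((measurable_pi_apply i).comp measurable_snd)
  refine Measurable.add (Measurable.div (Real.measurable_log.comp ?_) ?_) ?_
  · exact (h1.mul_const _).div (measurable_const.mul (measurable_const.sub h1))
  · exact (continuous_faceBump i).measurable.comp measurable_snd
  · exact (continuous_faceForm i e).measurable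

theorem exists_null_walls {β : Measure (Cube ι)} (hβ : IsGood β) (i : ι) {e : ι → ℕ}
    (he : Function.Injective e) {t : ℝ} (ht0 : 0 < t) (ht1 : t < 1) :
    ∃ c, ∀ s, β ((bdry ι)ᶜ ∩ {x | wall i e t c x = s}) = 0 := by
  have := hβ.finite
  refine exists_null_levels hβ.atom isClosed_bdry.measurableSet.compl (measurable_wall i e t) ?_
  intro x hx y hy hxy
  by_cases h : ∀ j ≠ i, x j = y j
  · have hi : x i ≠ y i := fun hi => hxy (funext fun j => by
      by_cases hj : j = i
      · rw [hj, hi]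
      · exact h j hj)
    have hz : ∀ z : Cube ι, z ∉ bdry ι → (z i : ℝ) ∈ Set.Ioo (0 : ℝ) 1 := fun z hz =>
      ⟨unitInterval.pos_iff_ne_zero.2 fun h => hz ⟨i, Or.inl h⟩,
        unitInterval.lt_one_iff_ne_one.2 fun h => hz ⟨i, Or.inr h⟩⟩
    have : {c | wall i e t c x = wall i e t c y} = ∅ := by
      ext c
      simp only [Set.mem_ofPred_eq, Set.mem_empty_iff_false, iff_false, wall]
      rw [faceBump_congr h, faceForm_congr h, add_left_inj, div_left_inj' (faceBump_pos hy).ne']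
      exact fun h' => hi (Subtype.ext (slideTime_injOn ht0 ht1 (hz x hx) (hz y hy) h'))
    rw [this, measure_empty]
  · push Not at h
    obtain ⟨j, hj, hne⟩ := h
    exact (finite_setOf_faceForm_eq he hj hne _ _).measure_zero _

/-- Two good measures of the same mass are matched on a subdivision into two boxes. -/
theorem exists_isMatch_cut {α β : Measure (Cube ι)} (hα : IsGood α) (hβ : IsGood β)
    (hm : α Set.univ = β Set.univ) (i : ι) :
    ∃ (t : unitInterval) (h : Cube ι ≃ₜ Cube ι), 1 / 3 ≤ (t : ℝ) ∧ (t : ℝ) ≤ 2 / 3 ∧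
      IsMatch α β h (cut i t) := by
  have hαf := hα.finite
  have hβf := hβ.finite
  obtain ⟨t, ht0, ht1, htn⟩ := exists_null_wall (α := α) i
  have ht0' : 0 < (t : ℝ) := by linarith
  have ht1' : (t : ℝ) < 1 := by linarith
  obtain ⟨e, he⟩ := Countable.exists_injective_nat ι
  obtain ⟨c, hc⟩ := exists_null_walls hβ i he ht0' ht1'
  set D : Set (Cube ι) := (bdry ι)ᶜ with hD
  have hDm : MeasurableSet D := isClosed_bdry.measurableSet.compl
  have hu : Measurable (wall i e t c) := by
    have := (measurable_wall i e t).comp (measurable_const (a := c) |>.prodMk measurable_id)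
    exact this
  let ν : Measure ℝ := (β.restrict D).map (wall i e t c)
  have hν : ∀ S, MeasurableSet S → ν S = β (D ∩ wall i e t c ⁻¹' S) := fun S hS => by
    rw [Measure.map_apply hu hS, Measure.restrict_apply (hu hS), Set.inter_comm]
  have : NullSingletonClass ν := ⟨fun s => by
    rw [hν _ (measurableSet_singleton s)]
    exact hc s⟩
  have hcoord : Continuous fun x : Cube ι => (x i : ℝ) := by fun_prop
  have hνuniv : ν Set.univ = β Set.univ := by
    rw [hν _ MeasurableSet.univ, Set.preimage_univ, Set.inter_univ]
    have := measure_add_measure_compl (μ := β) (isClosed_bdry (ι := ι)).measurableSet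
    rwa [hβ.bdry, zero_add] at this
  have hsplit : α {x | (x i : ℝ) ≤ t} + α {x | (t : ℝ) < x i} = α Set.univ := by
    rw [← measure_add_measure_compl (μ := α) (isClosed_le hcoord continuous_const).measurableSet]
    congr 2
    ext x
    simp
  have hpos0 : 0 < α {x | (x i : ℝ) ≤ t} := by
    refine (hα.pos {x | (x i : ℝ) < t} (isOpen_lt hcoord continuous_const) ⟨fun _ => 0, ?_⟩).trans_le
      (measure_mono fun x (hx : (x i : ℝ) < t) => hx.le)
    simpa using ht0'
  have hpos1 : 0 < α {x | (t : ℝ) < x i} := by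
    refine hα.pos _ (isOpen_lt continuous_const hcoord) ⟨fun _ => 1, ?_⟩
    simpa using ht1'
  obtain ⟨s, hs⟩ : ∃ s, ν (Set.Iic s) = α {x | (x i : ℝ) ≤ t} := by
    refine exists_measure_Iic_eq hpos0 ?_
    rw [hνuniv, ← hm, ← hsplit]
    exact ENNReal.lt_add_right (measure_ne_top _ _) hpos1.ne'
  have hform : Continuous (faceForm (ι := ι) i e c) := by
    have := (continuous_faceForm (ι := ι) i e).comp
      (continuous_const (y := c) |>.prodMk continuous_id)
    exact this
  have hupd : ∀ (x : Cube ι) y, ∀ j ≠ i, Function.update x i y j = x j :=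
    fun x y j hj => Function.update_of_ne hj _ _
  let f : Cube ι → ℝ := fun x => faceBump i x * (s - faceForm i e c x)
  have hf : Continuous f := (continuous_faceBump i).mul (continuous_const.sub hform)
  have hfi : ∀ x y, f (Function.update x i y) = f x := fun x y => by
    simp only [f, faceBump_congr (hupd x y), faceForm_congr (hupd x y)]
  let h := shear i f hf hfi
  have hsymm : ∀ z, h.symm z i = slide (-f z) (z i) := fun z => by
    change (shear i f hf hfi).symm z i = _
    rw [shear_symm_apply, Function.update_self]
  have hne : ∀ z ∈ D, z i ≠ 0 ∧ z i ≠ 1 := fun z hz =>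
    ⟨fun h => hz ⟨i, Or.inl h⟩, fun h => hz ⟨i, Or.inr h⟩⟩
  have hle : ∀ z ∈ D, ((h.symm z i : ℝ) ≤ t ↔ wall i e t c z ≤ s) := fun z hz => by
    have hb := faceBump_pos (i := i) hz
    rw [hsymm, slide_le_iff ht0' ht1' (hne z hz).1 (hne z hz).2, wall, ← le_sub_iff_add_le,
      div_le_iff₀ hb, mul_comm]
  have hge : ∀ z ∈ D, ((t : ℝ) ≤ h.symm z i ↔ s ≤ wall i e t c z) := fun z hz => by
    have hb := faceBump_pos (i := i) hz
    rw [hsymm, le_slide_iff ht0' ht1' (hne z hz).1 (hne z hz).2, wall, ← sub_le_iff_le_add,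
      le_div_iff₀ hb, mul_comm]
  have hfix : ∀ x ∈ bdry ι, h x = x := by
    rintro x ⟨j, hj⟩
    change Function.update x i (slide (f x) (x i)) = x
    by_cases hji : j = i
    · subst hji
      rcases hj with hj | hj
      · rw [hj, slide_left, ← hj, Function.update_eq_self]
      · rw [hj, slide_right, ← hj, Function.update_eq_self]
    · have : f x = 0 := by simp only [f, faceBump_eq_zero hji hj, zero_mul]
      rw [this, slide_zero, Function.update_eq_self]
  have hcells := isCells_cut (i := i) ht0' ht1'
  have hnull_left : ∀ a, α (cut i t a '' bdry ι) = 0 := fun a =>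
    measure_mono_null (image_cut_bdry_subset a) (measure_union_null hα.bdry htn)
  have hnull_right : ∀ a, β ((fun x => h (cut i t a x)) '' bdry ι) = 0 := by
    intro a
    refine measure_mono_null (t := bdry ι ∪ D ∩ {x | wall i e t c x = s}) ?_
      (measure_union_null hβ.bdry (hc s))
    rintro _ ⟨x, hx, rfl⟩
    by_cases hz : h (cut i t a x) ∈ bdry ι
    · exact Or.inl hz
    · right
      refine ⟨hz, ?_⟩
      rcases image_cut_bdry_subset (t := t) a (Set.mem_image_of_mem _ hx) with hx' | hx'
      · rw [hfix _ hx'] at hz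
        exact (hz hx').elim
      · have hx' : (cut i t a x i : ℝ) = t := hx'
        have h1 : (h.symm (h (cut i t a x)) i : ℝ) = t := by rw [h.symm_apply_apply, hx']
        exact le_antisymm ((hle _ hz).1 h1.le) ((hge _ hz).1 h1.ge)
  have hmass : α (Set.range (cut i t false)) = β (Set.range fun x => h (cut i t false x)) := by
    rw [range_cut_false ht0', ← hs, hν _ measurableSet_Iic]
    refine measure_congr (ae_eq_set.2 ⟨measure_mono_null ?_ hβ.bdry, measure_mono_null ?_ hβ.bdry⟩)
    · rintro z ⟨⟨hz, hz'⟩, hz2⟩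
      refine (hz2 ?_).elim
      obtain ⟨x, hx⟩ : h.symm z ∈ Set.range (cut i t false) := by
        rw [range_cut_false ht0']
        exact (hle z hz).2 hz'
      exact ⟨x, by simp only [hx, h.apply_symm_apply]⟩
    · rintro _ ⟨⟨x, rfl⟩, hz2⟩
      by_contra hz
      refine hz2 ⟨hz, (hle _ hz).1 ?_⟩
      rw [h.symm_apply_apply]
      exact (range_cut_false ht0').le ⟨x, rfl⟩
  refine ⟨t, h, ht0, ht1, hcells, hfix, hnull_left, hnull_right, ?_⟩
  have hcr : IsCells fun a x => h (cut i t a x) := hcells.homeo_comp hfix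
  have hsum : ∀ {γ : Measure (Cube ι)} {κ : Bool → Cube ι → Cube ι}, IsCells κ →
      (∀ a, γ (κ a '' bdry ι) = 0) →
      γ (Set.range (κ false)) + γ (Set.range (κ true)) = γ Set.univ := by
    intro γ κ hκ hbd
    have h1 := hκ.sum_measure_range hbd Finset.univ
    rw [Fintype.sum_bool, add_comm] at h1
    rw [h1]
    congr 1
    refine Set.eq_univ_of_forall fun z => ?_
    obtain ⟨a, x, hx⟩ := hκ.cover z
    simp only [Finset.mem_univ, Set.iUnion_true, Set.mem_iUnion]
    exact ⟨a, x, hx⟩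
  intro a
  cases a
  · exact hmass
  · have h1 := hsum hcells hnull_left
    have h2 := hsum hcr hnull_right
    rw [hm, ← h2, hmass] at h1
    exact (ENNReal.add_right_inj (measure_ne_top _ _)).1 h1

end OxtobyUlam

end

section

open Filter Topology TopologicalSpace MeasureTheory

namespace OxtobyUlam

variable {ι : Type*} [Fintype ι]

theorem exists_isMatch_list [DecidableEq ι] (l : List ι) : ∀ {α β : Measure (Cube ι)}, IsGood α → IsGood β →
    α Set.univ = β Set.univ → ∃ (A : Type) (_ : Finite A) (h : Cube ι ≃ₜ Cube ι)
      (κ : A → Cube ι → Cube ι), IsMatch α β h κ ∧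
      ∀ a x y j, |(κ a x j : ℝ) - κ a y j| ≤ (2 / 3) ^ l.count j * |(x j : ℝ) - y j| := by
  induction l with
  | nil =>
    intro α β hα hβ hm
    exact ⟨Unit, inferInstance, _, _, IsMatch.refl hα hβ hm, fun a x y j => by simp⟩
  | cons i l ih =>
    intro α β hα hβ hm
    obtain ⟨t, h, ht0, ht1, H⟩ := exists_isMatch_cut hα hβ hm i
    choose A hA g κ' H' hκ' using fun a =>
      ih (H.isGood_left hα a) (H.isGood_right hβ a) (H.comap_univ a)
    obtain ⟨h', Hh', -⟩ := H.trans H'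
    refine ⟨Σ a, A a, inferInstance, h', _, Hh', fun p x y j => ?_⟩
    refine (dist_cut_le ht0 ht1 p.1 _ _ j).trans ?_
    have h2 := hκ' p.1 p.2 x y j
    rw [List.count_cons]
    by_cases hj : j = i
    · subst hj
      simp only [if_true, beq_self_eq_true, pow_succ]
      nlinarith
    · have : (i == j) = false := by simpa using fun h => hj h.symm
      simpa [hj, this] using h2

theorem exists_list_count_ge [DecidableEq ι] (n : ℕ) : ∃ l : List ι, ∀ j, n ≤ l.count j := by
  induction n with
  | zero => exact ⟨[], fun j => Nat.zero_le _⟩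
  | succ n ih =>
    obtain ⟨l, hl⟩ := ih
    refine ⟨Finset.univ.toList ++ l, fun j => ?_⟩
    rw [List.count_append]
    have : 0 < (Finset.univ : Finset ι).toList.count j := by simp [List.count_pos_iff]
    have := hl j
    omega

theorem exists_isMatch_small [DecidableEq ι] {α β : Measure (Cube ι)} (hα : IsGood α) (hβ : IsGood β)
    (hm : α Set.univ = β Set.univ) {ε : ℝ} (hε : 0 < ε) :
    ∃ (A : Type) (_ : Finite A) (h : Cube ι ≃ₜ Cube ι)
      (κ : A → Cube ι → Cube ι), IsMatch α β h κ ∧ ∀ a x y, dist (κ a x) (κ a y) ≤ ε := by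
  obtain ⟨n, hn⟩ := exists_pow_lt_of_lt_one hε (show (2 / 3 : ℝ) < 1 by norm_num)
  obtain ⟨l, hl⟩ := exists_list_count_ge (ι := ι) n
  obtain ⟨A, hA, h, κ, H, hκ⟩ := exists_isMatch_list l hα hβ hm
  refine ⟨A, hA, h, κ, H, fun a x y => (dist_pi_le_iff hε.le).2 fun j => ?_⟩
  rw [Subtype.dist_eq, Real.dist_eq]
  refine (hκ a x y j).trans ?_
  have h1 : |(x j : ℝ) - y j| ≤ 1 := by
    rw [abs_le]
    constructor <;> linarith [(x j).2.1, (x j).2.2, (y j).2.1, (y j).2.2]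
  have h2 : (2 / 3 : ℝ) ^ l.count j ≤ (2 / 3) ^ n :=
    pow_le_pow_of_le_one (by norm_num) (by norm_num) (hl j)
  calc (2 / 3 : ℝ) ^ l.count j * |(x j : ℝ) - y j| ≤ (2 / 3 : ℝ) ^ n * 1 := by gcongr
    _ ≤ ε := by linarith

/-- A finite subdivision of the cube on which two measures are matched. -/
structure Stage (α β : Measure (Cube ι)) where
  /-- The index set of the cells. -/
  A : Type
  finite : Finite A
  /-- The homeomorphism carrying the cells to the matching cells. -/
  h : Cube ι ≃ₜ Cube ι
  /-- The parametrizations of the cells. -/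
  κ : A → Cube ι → Cube ι
  isMatch : IsMatch α β h κ

namespace Stage

variable {α β : Measure (Cube ι)}

/-- The stage with the roles of the two measures exchanged. -/
def swap (S : Stage α β) : Stage β α := ⟨S.A, S.finite, S.h.symm, _, S.isMatch.swap⟩

theorem swap_h_κ (S : Stage α β) (a : S.A) (x : Cube ι) : S.swap.h (S.swap.κ a x) = S.κ a x :=
  S.h.symm_apply_apply _

theorem swap_swap (S : Stage α β) : S.swap.swap = S := by
  obtain ⟨A, _, h, κ, H⟩ := S
  simp [swap]

/-- The cells of `S` on both sides lie in corresponding cells of `T`. -/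
def Refines (S T : Stage α β) : Prop :=
  ∀ a, ∃ b, (∀ x, S.κ a x ∈ Set.range (T.κ b)) ∧
    ∀ x, S.h (S.κ a x) ∈ Set.range fun y => T.h (T.κ b y)

theorem Refines.refl (S : Stage α β) : S.Refines S :=
  fun a => ⟨a, fun x => ⟨x, rfl⟩, fun x => ⟨x, rfl⟩⟩

theorem Refines.trans {S T U : Stage α β} (h : S.Refines T) (h' : T.Refines U) :
    S.Refines U := by
  intro a
  obtain ⟨b, hb, hb'⟩ := h a
  obtain ⟨c, hc, hc'⟩ := h' b
  refine ⟨c, fun x => ?_, fun x => ?_⟩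
  · obtain ⟨y, hy⟩ := hb x
    rw [← hy]
    exact hc y
  · obtain ⟨y, hy⟩ := hb' x
    rw [← hy]
    exact hc' y

theorem Refines.swap {S T : Stage α β} (h : S.Refines T) : S.swap.Refines T.swap := by
  intro a
  obtain ⟨b, hb, hb'⟩ := h a
  refine ⟨b, hb', fun x => ?_⟩
  obtain ⟨y, hy⟩ := hb x
  exact ⟨y, (T.swap_h_κ b y).trans (hy.trans (S.swap_h_κ a x).symm)⟩

/-- The cells of `S` on the source side have diameter at most `ε`. -/
def Small (S : Stage α β) (ε : ℝ) : Prop := ∀ a x y, dist (S.κ a x) (S.κ a y) ≤ ε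

theorem Small.of_refines {S T : Stage α β} {ε : ℝ} (hT : T.Small ε) (h : S.Refines T) :
    S.Small ε := by
  intro a x y
  obtain ⟨b, hb, -⟩ := h a
  obtain ⟨x', hx'⟩ := hb x
  obtain ⟨y', hy'⟩ := hb y
  rw [← hx', ← hy']
  exact hT b x' y'

theorem exists_refines_small [DecidableEq ι] (hα : IsGood α) (hβ : IsGood β) (S : Stage α β) {ε : ℝ}
    (hε : 0 < ε) : ∃ T : Stage α β, T.Refines S ∧ T.Small ε := by
  have := S.finite
  have hu : ∀ a, UniformContinuous (S.κ a) := fun a =>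
    CompactSpace.uniformContinuous_of_continuous (S.isMatch.cells.cont a)
  choose δ hδ hδ' using fun a => Metric.uniformContinuous_iff.1 (hu a) ε hε
  choose A hA g κ' H' hκ' using fun a =>
    exists_isMatch_small (S.isMatch.isGood_left hα a) (S.isMatch.isGood_right hβ a)
      (S.isMatch.comap_univ a) (half_pos (hδ a))
  obtain ⟨h', Hh', hh'⟩ := S.isMatch.trans H'
  refine ⟨⟨Σ a, A a, inferInstance, h', _, Hh'⟩, fun p => ⟨p.1, fun x => ⟨_, rfl⟩, fun x => ?_⟩, ?_⟩
  · exact ⟨_, (hh' _ _).symm⟩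
  · intro p x y
    exact (hδ' p.1 ((hκ' p.1 p.2 x y).trans_lt (half_lt_self (hδ p.1)))).le

theorem exists_refines [DecidableEq ι] (hα : IsGood α) (hβ : IsGood β) (S : Stage α β) {ε : ℝ} (hε : 0 < ε) :
    ∃ T : Stage α β, T.Refines S ∧ T.Small ε ∧ T.swap.Small ε := by
  obtain ⟨T, hT, hTs⟩ := exists_refines_small hα hβ S hε
  obtain ⟨U, hU, hUs⟩ := exists_refines_small hβ hα T.swap hε
  have h1 : U.swap.Refines T := by simpa only [swap_swap] using hU.swap
  exact ⟨U.swap, h1.trans hT, hTs.of_refines h1, by rwa [swap_swap]⟩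

theorem dist_le_of_refines {S T : Stage α β} (h : S.Refines T) {ε : ℝ} (hT : T.swap.Small ε)
    (z : Cube ι) : dist (S.h z) (T.h z) ≤ ε := by
  obtain ⟨a, x, rfl⟩ := S.isMatch.cells.cover z
  obtain ⟨b, hb, hb'⟩ := h a
  obtain ⟨y, hy⟩ := hb x
  obtain ⟨y', hy'⟩ := hb' x
  rw [← hy', ← hy]
  exact hT b y' y

end Stage

end OxtobyUlam

end

section

open Filter Topology TopologicalSpace MeasureTheory

/-- A sequence of homeomorphisms which, together with their inverses, is uniformly Cauchy,
converges to a homeomorphism. -/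
theorem Homeomorph.exists_limit {K : Type*} [MetricSpace K] [CompactSpace K] {h : ℕ → K ≃ₜ K}
    {ε : ℕ → ℝ} (hε : Tendsto ε atTop (𝓝 0))
    (h1 : ∀ n m, n ≤ m → ∀ z, dist (h m z) (h n z) ≤ ε n)
    (h2 : ∀ n m, n ≤ m → ∀ z, dist ((h m).symm z) ((h n).symm z) ≤ ε n) :
    ∃ H : K ≃ₜ K, ∀ n z, dist (H z) (h n z) ≤ ε n := by
  have key : ∀ f : ℕ → C(K, K), (∀ n m, n ≤ m → ∀ z, dist (f m z) (f n z) ≤ ε n) →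
      ∃ F : K → K, Continuous F ∧ TendstoUniformly (fun n => ⇑(f n)) F atTop ∧
        ∀ n z, dist (F z) (f n z) ≤ ε n := by
    intro f hf
    have hc : ∀ z, CauchySeq fun n => f n z := fun z =>
      cauchySeq_of_le_tendsto_0 (fun n => 2 * ε n) (fun n m N hn hm => by
        have a1 := hf N n hn z
        have a2 := hf N m hm z
        have := dist_triangle_right (f n z) (f m z) (f N z)
        linarith) (by simpa using hε.const_mul 2)
    choose F hF using fun z => cauchySeq_tendsto_of_complete (hc z)
    have hle : ∀ n z, dist (F z) (f n z) ≤ ε n := fun n z =>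
      le_of_tendsto ((hF z).dist tendsto_const_nhds)
        ((eventually_ge_atTop n).mono fun m hm => hf n m hm z)
    have hu : TendstoUniformly (fun n => ⇑(f n)) F atTop := by
      rw [Metric.tendstoUniformly_iff]
      intro δ hδ
      filter_upwards [hε.eventually_lt_const hδ] with n hn z using (hle n z).trans_lt hn
    exact ⟨F, hu.continuous (Frequently.of_forall fun n => (f n).continuous), hu, hle⟩
  obtain ⟨F, hFc, hFu, hF⟩ := key (fun n => ⟨h n, (h n).continuous⟩) h1
  obtain ⟨L, hLc, hLu, hL⟩ := key (fun n => ⟨(h n).symm, (h n).symm.continuous⟩) h2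
  refine ⟨⟨⟨F, L, fun z => ?_, fun z => ?_⟩, hFc, hLc⟩, hF⟩
  · have := hLu.tendsto_comp hLc.continuousAt (hFu.tendsto_at z)
    refine tendsto_nhds_unique this ?_
    simp
  · have := hFu.tendsto_comp hFc.continuousAt (hLu.tendsto_at z)
    refine tendsto_nhds_unique this ?_
    simp

theorem MeasureTheory.Measure.eq_of_forall_isClosed_le {K : Type*} [MetricSpace K]
    [MeasurableSpace K] [BorelSpace K] {α β : Measure K} [IsFiniteMeasure α] [IsFiniteMeasure β]
    (h : ∀ C, IsClosed C → α C ≤ β C) (hm : α Set.univ = β Set.univ) : α = β := by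
  refine Measure.eq_of_le_of_measure_univ_eq (Measure.le_iff.2 fun B hB => ?_) hm
  rw [hB.measure_eq_iSup_isClosed_of_ne_top (measure_ne_top α B)]
  exact iSup₂_le fun C hC => iSup_le fun hCc => (h C hCc).trans (measure_mono hC)

namespace OxtobyUlam

variable {ι : Type*} [Fintype ι]

/-- **Oxtoby–Ulam**: two good measures on the cube with the same mass are related by a
homeomorphism fixing the boundary. -/
theorem exists_map_eq {α β : Measure (Cube ι)} (hα : IsGood α) (hβ : IsGood β)
    (hm : α Set.univ = β Set.univ) :
    ∃ H : Cube ι ≃ₜ Cube ι, (∀ x ∈ bdry ι, H x = x) ∧ α.map H = β := by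
  classical
  have := hα.finite
  have := hβ.finite
  let S₀ : Stage α β := ⟨Unit, inferInstance, _, _, IsMatch.refl hα hβ hm⟩
  choose next hnext hnext1 hnext2 using fun (n : ℕ) (S : Stage α β) =>
    Stage.exists_refines hα hβ S (show (0 : ℝ) < (1 / 2) ^ n by positivity)
  let S : ℕ → Stage α β := fun n => Nat.rec (next 0 S₀) (fun n T => next (n + 1) T) n
  have hsucc : ∀ n, S (n + 1) = next (n + 1) (S n) := fun n => rfl
  have hsmall : ∀ n, (S n).Small ((1 / 2) ^ n) ∧ (S n).swap.Small ((1 / 2) ^ n) := by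
    intro n
    cases n with
    | zero => exact ⟨hnext1 0 S₀, hnext2 0 S₀⟩
    | succ n => rw [hsucc]; exact ⟨hnext1 _ _, hnext2 _ _⟩
  have href : ∀ n m, n ≤ m → (S m).Refines (S n) := by
    intro n m hnm
    induction m, hnm using Nat.le_induction with
    | base => exact Stage.Refines.refl _
    | succ m _ ih => rw [hsucc]; exact (hnext _ _).trans ih
  obtain ⟨H, hH⟩ := Homeomorph.exists_limit (h := fun n => (S n).h) (ε := fun n => (1 / 2 : ℝ) ^ n)
    (tendsto_pow_atTop_nhds_zero_of_lt_one (by norm_num) (by norm_num))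
    (fun n m hnm z => Stage.dist_le_of_refines (href n m hnm) (hsmall n).2 z)
    (fun n m hnm z => Stage.dist_le_of_refines (href n m hnm).swap
      (by rw [Stage.swap_swap]; exact (hsmall n).1) z)
  have hpow : Tendsto (fun n : ℕ => 2 * (1 / 2 : ℝ) ^ n) atTop (𝓝 0) := by
    simpa using (tendsto_pow_atTop_nhds_zero_of_lt_one (r := (1 / 2 : ℝ)) (by norm_num)
      (by norm_num)).const_mul 2
  refine ⟨H, fun x hx => ?_, ?_⟩
  · refine dist_le_zero.1 (ge_of_tendsto hpow (Eventually.of_forall fun n => ?_))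
    have h1 := hH n x
    simp only [(S n).isMatch.fix x hx] at h1
    have : (0 : ℝ) ≤ (1 / 2) ^ n := by positivity
    linarith
  · have : IsFiniteMeasure (α.map H) := Measure.isFiniteMeasure_map α H
    refine Measure.eq_of_forall_isClosed_le (fun C hC => ?_) ?_
    · rw [Measure.map_apply H.continuous.measurable hC.measurableSet]
      have hlim : Tendsto (fun n : ℕ => β (Metric.cthickening (2 * (1 / 2 : ℝ) ^ n) C)) atTop
          (𝓝 (β C)) :=
        (tendsto_measure_cthickening_of_isClosed ⟨1, one_pos, measure_ne_top _ _⟩ hC).comp hpow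
      refine ge_of_tendsto hlim (Eventually.of_forall fun n => ?_)
      have := (S n).finite
      have := Fintype.ofFinite (S n).A
      have hM := (S n).isMatch
      let I : Finset (S n).A := Finset.univ.filter fun a => ∃ x, H ((S n).κ a x) ∈ C
      calc α (H ⁻¹' C) ≤ α (⋃ a ∈ I, Set.range ((S n).κ a)) := by
            refine measure_mono fun z hz => ?_
            obtain ⟨a, x, rfl⟩ := hM.cells.cover z
            exact Set.mem_iUnion₂.2 ⟨a, by simpa [I] using ⟨x, hz⟩, x, rfl⟩
        _ = ∑ a ∈ I, α (Set.range ((S n).κ a)) := (hM.cells.sum_measure_range hM.null_left I).symm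
        _ = ∑ a ∈ I, β (Set.range fun x => (S n).h ((S n).κ a x)) :=
            Finset.sum_congr rfl fun a _ => hM.mass a
        _ = β (⋃ a ∈ I, Set.range fun x => (S n).h ((S n).κ a x)) :=
            hM.cells_right.sum_measure_range hM.null_right I
        _ ≤ β (Metric.cthickening (2 * (1 / 2 : ℝ) ^ n) C) := by
            refine measure_mono (Set.iUnion₂_subset fun a ha => ?_)
            rintro _ ⟨y, rfl⟩
            obtain ⟨x, hx⟩ := (Finset.mem_filter.1 ha).2
            refine Metric.mem_cthickening_of_dist_le _ _ _ _ hx ?_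
            have h1 := hH n ((S n).κ a x)
            have h2 : dist ((S n).h ((S n).κ a y)) ((S n).h ((S n).κ a x)) ≤ (1 / 2) ^ n :=
              (hsmall n).2 a y x
            have h3 := dist_triangle_right ((S n).h ((S n).κ a y)) (H ((S n).κ a x))
              ((S n).h ((S n).κ a x))
            linarith
    · rw [Measure.map_apply H.continuous.measurable MeasurableSet.univ, Set.preimage_univ, hm]

end OxtobyUlam

end

section

open Filter Topology TopologicalSpace MeasureTheory

namespace OxtobyUlam

variable {ι : Type*}

/-- The affine parametrization of a closed box. -/
def aff (p : ι → ℝ) (r : ℝ) (x : Cube ι) : ι → ℝ := fun j => p j + r * (2 * x j - 1)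

theorem continuous_aff (p : ι → ℝ) (r : ℝ) : Continuous (aff p r) := by
  unfold aff
  fun_prop

theorem abs_aff_sub (p : ι → ℝ) {r : ℝ} (hr : 0 < r) (x : Cube ι) (j : ι) :
    dist (aff p r x j) (p j) = r * |2 * (x j : ℝ) - 1| := by
  rw [Real.dist_eq, aff, add_sub_cancel_left, abs_mul, abs_of_pos hr]

theorem injective_aff (p : ι → ℝ) {r : ℝ} (hr : 0 < r) : Function.Injective (aff p r) := by
  intro x y h
  ext j
  have h1 : p j + r * (2 * (x j : ℝ) - 1) = p j + r * (2 * (y j : ℝ) - 1) := congrFun h j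
  have := mul_left_cancel₀ hr.ne' (add_left_cancel h1)
  linarith

/-- The inverse of `aff`, extended to the whole space. -/
noncomputable def affInv (p : ι → ℝ) (r : ℝ) (y : ι → ℝ) : Cube ι :=
  fun j => Set.projIcc 0 1 zero_le_one (((y j - p j) / r + 1) / 2)

theorem continuous_affInv (p : ι → ℝ) (r : ℝ) : Continuous (affInv p r) := by
  refine continuous_pi fun j => continuous_projIcc.comp ?_
  fun_prop

theorem affInv_aff (p : ι → ℝ) {r : ℝ} (hr : 0 < r) (x : Cube ι) : affInv p r (aff p r x) = x := by
  ext j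
  have : ((aff p r x j - p j) / r + 1) / 2 = x j := by
    simp only [aff]
    field_simp
    ring
  rw [affInv, this, Set.projIcc_val]

variable [Fintype ι]

theorem aff_mem_closedBall (p : ι → ℝ) {r : ℝ} (hr : 0 < r) (x : Cube ι) :
    aff p r x ∈ Metric.closedBall p r := by
  refine (dist_pi_le_iff hr.le).2 fun j => ?_
  rw [abs_aff_sub p hr]
  have : |2 * (x j : ℝ) - 1| ≤ 1 := abs_le.2 ⟨by linarith [(x j).2.1], by linarith [(x j).2.2]⟩
  nlinarith

theorem aff_mem_ball (p : ι → ℝ) {r : ℝ} (hr : 0 < r) {x : Cube ι} (hx : x ∉ bdry ι) :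
    aff p r x ∈ Metric.ball p r := by
  refine (dist_pi_lt_iff hr).2 fun j => ?_
  rw [abs_aff_sub p hr]
  have h0 : (0 : ℝ) < x j := unitInterval.pos_iff_ne_zero.2 fun h => hx ⟨j, Or.inl h⟩
  have h1 : (x j : ℝ) < 1 := unitInterval.lt_one_iff_ne_one.2 fun h => hx ⟨j, Or.inr h⟩
  have : |2 * (x j : ℝ) - 1| < 1 := abs_lt.2 ⟨by linarith, by linarith⟩
  nlinarith

theorem aff_mem_sphere (p : ι → ℝ) {r : ℝ} (hr : 0 < r) {x : Cube ι} (hx : x ∈ bdry ι) :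
    aff p r x ∈ Metric.sphere p r := by
  refine le_antisymm (aff_mem_closedBall p hr x) ?_
  obtain ⟨j, hj⟩ := hx
  refine le_trans (le_of_eq ?_) (dist_le_pi_dist _ _ j)
  rw [abs_aff_sub p hr]
  rcases hj with hj | hj <;> norm_num [hj]

theorem aff_affInv (p : ι → ℝ) {r : ℝ} (hr : 0 < r) {y : ι → ℝ} (hy : y ∈ Metric.closedBall p r) :
    aff p r (affInv p r y) = y := by
  ext j
  have h := (dist_pi_le_iff hr.le).1 hy j
  rw [Real.dist_eq, abs_le] at h
  have h1 : -1 ≤ (y j - p j) / r := by rw [le_div_iff₀ hr]; linarith [h.1]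
  have h2 : (y j - p j) / r ≤ 1 := by rw [div_le_iff₀ hr]; linarith [h.2]
  rw [aff, affInv, Set.projIcc_of_mem zero_le_one ⟨by linarith, by linarith⟩]
  field_simp
  ring

/-- The parametrization of an open box by the interior of the cube. -/
noncomputable def box (p : ι → ℝ) {r : ℝ} (hr : 0 < r) :
    OpenPartialHomeomorph (Cube ι) (ι → ℝ) where
  toFun := aff p r
  invFun := affInv p r
  source := (bdry ι)ᶜ
  target := Metric.ball p r
  map_source' x hx := aff_mem_ball p hr hx
  map_target' y hy hb := by
    have h1 := aff_mem_sphere p hr hb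
    rw [aff_affInv p hr (Metric.ball_subset_closedBall hy)] at h1
    exact (Metric.mem_ball.1 hy).ne h1
  left_inv' x _ := affInv_aff p hr x
  right_inv' y hy := aff_affInv p hr (Metric.ball_subset_closedBall hy)
  open_source := isClosed_bdry.isOpen_compl
  open_target := Metric.isOpen_ball
  continuousOn_toFun := (continuous_aff p r).continuousOn
  continuousOn_invFun := (continuous_affInv p r).continuousOn

section Chart

variable {M : Type*} [TopologicalSpace M] [T2Space M] {ψ : OpenPartialHomeomorph M (ι → ℝ)}
  {p : ι → ℝ} {r : ℝ}

theorem isClosedEmbedding_chart (hr : 0 < r) (hψ : Metric.closedBall p r ⊆ ψ.target) :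
    IsClosedEmbedding fun x => ψ.symm (aff p r x) := by
  refine Continuous.isClosedEmbedding ?_ ?_
  · exact ψ.continuousOn_symm.comp_continuous (continuous_aff p r)
      fun x => hψ (aff_mem_closedBall p hr x)
  · intro x y h
    exact injective_aff p hr (ψ.symm.injOn (hψ (aff_mem_closedBall p hr x))
      (hψ (aff_mem_closedBall p hr y)) h)

variable [MeasurableSpace M] [BorelSpace M] {μ : Measure M}

theorem isGood_chart (hr : 0 < r) (hψ : Metric.closedBall p r ⊆ ψ.target)
    [IsFiniteMeasureOnCompacts μ] (hatom : ∀ p : M, μ {p} = 0)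
    (hpos : ∀ U : Set M, IsOpen U → U.Nonempty → 0 < μ U)
    (hsphere : μ (ψ.symm '' Metric.sphere p r) = 0) :
    IsGood (μ.comap fun x => ψ.symm (aff p r x)) := by
  have hemb := isClosedEmbedding_chart hr hψ
  have hc := hemb.measurableEmbedding.comap_apply μ
  refine ⟨⟨?_⟩, fun x => ?_, fun V hV hne => ?_, ?_⟩
  · rw [hc, Set.image_univ]
    exact (isCompact_range hemb.continuous).measure_lt_top
  · rw [hc, Set.image_singleton]
    exact hatom _
  · obtain ⟨x, hxV, hx⟩ := dense_compl_bdry.inter_open_nonempty V hV hne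
    have hO : IsOpen (Metric.ball p r ∩ affInv p r ⁻¹' V) :=
      Metric.isOpen_ball.inter (hV.preimage (continuous_affInv p r))
    have hsub : Metric.ball p r ∩ affInv p r ⁻¹' V ⊆ ψ.symm.source :=
      fun y hy => hψ (Metric.ball_subset_closedBall hy.1)
    rw [hc]
    refine (hpos _ (ψ.symm.isOpen_image_of_subset_source hO hsub)
      ⟨_, aff p r x, ⟨aff_mem_ball p hr hx, ?_⟩, rfl⟩).trans_le (measure_mono ?_)
    · rw [Set.mem_preimage, affInv_aff p hr]
      exact hxV
    · rintro _ ⟨y, ⟨hy, hyV⟩, rfl⟩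
      exact ⟨_, hyV, by simp only [aff_affInv p hr (Metric.ball_subset_closedBall hy)]⟩
  · rw [hc]
    refine measure_mono_null ?_ hsphere
    rintro _ ⟨x, hx, rfl⟩
    exact ⟨_, aff_mem_sphere p hr hx, rfl⟩

theorem exists_null_sphere [SFinite μ] {r₀ : ℝ} (hr₀ : 0 < r₀)
    (hψ : Metric.closedBall p r₀ ⊆ ψ.target) :
    ∃ r, 0 < r ∧ r ≤ r₀ ∧ μ (ψ.symm '' Metric.sphere p r) = 0 := by
  have hsub : ∀ r : Set.Ioo 0 r₀, Metric.sphere p r ⊆ ψ.symm.source := fun r y hy =>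
    hψ (Metric.closedBall_subset_closedBall r.2.2.le (Metric.sphere_subset_closedBall hy))
  have hc := Measure.countable_meas_pos_of_disjoint_iUnion (μ := μ)
    (As := fun r : Set.Ioo 0 r₀ => ψ.symm '' Metric.sphere p r)
    (fun r => ((isCompact_sphere p r).image_of_continuousOn
      (ψ.continuousOn_symm.mono (hsub r))).isClosed.measurableSet) (by
      intro r r' hne
      rw [Function.onFun, Set.disjoint_left]
      rintro _ ⟨y, hy, rfl⟩ ⟨y', hy', h⟩
      have := ψ.symm.injOn (hsub r' hy') (hsub r hy) h
      subst this
      exact hne (Subtype.ext ((Metric.mem_sphere.1 hy).symm.trans hy')))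
  have hI : ¬ (Set.univ : Set (Set.Ioo 0 r₀)).Countable := by
    rw [Set.countable_univ_iff, Set.countable_coe_iff, ← Cardinal.le_aleph0_iff_set_countable,
      Cardinal.mk_Ioo_real hr₀, not_le]
    exact Cardinal.aleph0_lt_continuum
  obtain ⟨r, hr⟩ : ∃ r : Set.Ioo 0 r₀, ¬ 0 < μ (ψ.symm '' Metric.sphere p r) := by
    by_contra! h
    exact hI (hc.mono fun r _ => h r)
  exact ⟨r, r.2.1, r.2.2.le, by simpa using hr⟩

/-- Inside any chart there is a chart around a large ball in which a good measure is a multiple of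
Lebesgue measure. -/
theorem exists_chart [SFinite μ] [IsFiniteMeasureOnCompacts μ] (hatom : ∀ p : M, μ {p} = 0)
    (hpos : ∀ U : Set M, IsOpen U → U.Nonempty → 0 < μ U) [Nonempty ι]
    (hψ : ψ.target.Nonempty) :
    ∃ (φ : OpenPartialHomeomorph M (ι → ℝ)) (c : ENNReal), φ.source ⊆ ψ.source ∧
      φ.target = Metric.ball 0 2 ∧
      ∀ B ⊆ φ.target, MeasurableSet B → μ (φ.symm '' B) = c * volume B := by
  obtain ⟨p, hp⟩ := hψ
  obtain ⟨r₀, hr₀, hball⟩ := Metric.nhds_basis_closedBall.mem_iff.1 (ψ.open_target.mem_nhds hp)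
  obtain ⟨r, hr, hrr, hsphere⟩ := exists_null_sphere (μ := μ) hr₀ hball
  have hcb : Metric.closedBall p r ⊆ ψ.target :=
    (Metric.closedBall_subset_closedBall hrr).trans hball
  have hα := isGood_chart hr hcb hatom hpos hsphere
  set α := μ.comap fun x => ψ.symm (aff p r x) with hαdef
  have hαf := hα.finite
  have hlam : IsGood ((volume : Measure (ι → ℝ)).comap fun x => aff 0 2 x) := by
    have hs : volume ((OpenPartialHomeomorph.refl (ι → ℝ)).symm '' Metric.sphere 0 2) = 0 := by
      have h0 : volume (id '' Metric.sphere (0 : ι → ℝ) 2) = 0 := by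
        rw [Set.image_id]
        exact Measure.addHaar_sphere_of_ne_zero _ _ two_ne_zero
      exact h0
    exact isGood_chart (ψ := OpenPartialHomeomorph.refl (ι → ℝ)) two_pos (Set.subset_univ _)
      (fun x => measure_singleton x) (fun U hU hne => hU.measure_pos _ hne) hs
  set lam : Measure (Cube ι) := (volume : Measure (ι → ℝ)).comap fun x => aff 0 2 x with hlamdef
  have hlamf := hlam.finite
  have hembl : MeasurableEmbedding fun x : Cube ι => aff 0 2 x :=
    ((continuous_aff 0 2).isClosedEmbedding (injective_aff 0 two_pos)).measurableEmbedding
  have hemb := (isClosedEmbedding_chart hr hcb).measurableEmbedding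
  have hl0 : lam Set.univ ≠ 0 := (hlam.pos _ isOpen_univ Set.univ_nonempty).ne'
  have ha0 : α Set.univ ≠ 0 := (hα.pos _ isOpen_univ Set.univ_nonempty).ne'
  let c : ENNReal := α Set.univ / lam Set.univ
  have hct : c ≠ ⊤ := ENNReal.div_ne_top (measure_ne_top _ _) hl0
  have hc0 : c ≠ 0 := ENNReal.div_ne_zero.2 ⟨ha0, measure_ne_top _ _⟩
  have hβ : IsGood (c • lam) := by
    refine ⟨⟨?_⟩, fun x => ?_, fun V hV hne => ?_, ?_⟩
    · rw [Measure.smul_apply, smul_eq_mul]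
      exact ENNReal.mul_lt_top hct.lt_top (measure_lt_top _ _)
    · rw [Measure.smul_apply, hlam.atom, smul_zero]
    · rw [Measure.smul_apply, smul_eq_mul]
      exact ENNReal.mul_pos hc0 (hlam.pos V hV hne).ne'
    · rw [Measure.smul_apply, hlam.bdry, smul_zero]
  obtain ⟨H, hHb, hH⟩ := exists_map_eq hα hβ (by
    rw [Measure.smul_apply, smul_eq_mul, ENNReal.div_mul_cancel hl0 (measure_ne_top _ _)])
  have hHs : ∀ x, H.symm x ∈ bdry ι → x ∈ bdry ι := fun x hx => by
    have := hHb _ hx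
    rw [H.apply_symm_apply] at this
    rwa [this]
  let φ : OpenPartialHomeomorph M (ι → ℝ) :=
    ψ.trans ((box p hr).symm.trans (H.toOpenPartialHomeomorph.trans (box 0 two_pos)))
  have hφsymm : ∀ y, φ.symm y = ψ.symm (aff p r (H.symm (affInv 0 2 y))) := fun y => rfl
  have htarget : φ.target = Metric.ball 0 2 := by
    ext y
    simp only [φ, OpenPartialHomeomorph.trans_target, Set.mem_inter_iff, Set.mem_preimage]
    constructor
    · rintro ⟨⟨⟨h, -⟩, -⟩, -⟩
      exact h
    · intro hy
      have h1 : affInv 0 2 y ∉ bdry ι := (box (ι := ι) 0 two_pos).map_target hy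
      exact ⟨⟨⟨hy, Set.mem_univ _⟩, fun h => h1 (hHs _ h)⟩, hcb (aff_mem_closedBall p hr _)⟩
  refine ⟨φ, c, fun z hz => ?_, htarget, fun B hB hBm => ?_⟩
  · rw [OpenPartialHomeomorph.trans_source] at hz
    exact hz.1
  · rw [htarget] at hB
    have hcl : ∀ y ∈ B, aff 0 2 (affInv 0 2 y) = y := fun y hy =>
      aff_affInv 0 two_pos (Metric.ball_subset_closedBall (hB hy))
    have hpre : MeasurableSet ((fun x : Cube ι => aff 0 2 x) ⁻¹' B) := hembl.measurable hBm
    have h1 : φ.symm '' B = (fun x => ψ.symm (aff p r x)) '' (H ⁻¹' ((fun x => aff 0 2 x) ⁻¹' B)) := by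
      ext z
      constructor
      · rintro ⟨y, hy, rfl⟩
        refine ⟨H.symm (affInv 0 2 y), ?_, rfl⟩
        simp only [Set.mem_preimage, H.apply_symm_apply, hcl y hy]
        exact hy
      · rintro ⟨x, hx, rfl⟩
        refine ⟨_, hx, ?_⟩
        rw [hφsymm]
        simp only [affInv_aff 0 two_pos, H.symm_apply_apply]
    rw [h1, ← hemb.comap_apply, ← hαdef, ← Measure.map_apply H.continuous.measurable hpre, hH,
      Measure.smul_apply, smul_eq_mul, hlamdef, hembl.comap_apply, Set.image_preimage_eq_of_subset]
    exact fun y hy => ⟨_, hcl y hy⟩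

end Chart

end OxtobyUlam

end

open Filter Topology TopologicalSpace MeasureTheory

/-- A homeomorphism between open sets gives a chart. -/
theorem exists_openPartialHomeomorph {M E : Type*} [TopologicalSpace M] [TopologicalSpace E] {x : M}
    {U : Set M} (hU : IsOpen U) (hx : x ∈ U) {V : Set E} (hV : IsOpen V) (e : U ≃ₜ V) :
    ∃ ψ : OpenPartialHomeomorph M E, x ∈ ψ.source := by
  let f := Opens.openPartialHomeomorphSubtypeCoe ⟨U, hU⟩ ⟨⟨x, hx⟩⟩
  let g := Opens.openPartialHomeomorphSubtypeCoe ⟨V, hV⟩ ⟨e ⟨x, hx⟩⟩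
  refine ⟨f.symm.trans (e.toOpenPartialHomeomorph.trans g), ?_⟩
  simp [f, g, hx]

theorem stmt18 (n : ℕ) (hn : 2 ≤ n)
    (M : Type u) [TopologicalSpace M] [MeasurableSpace M] [BorelSpace M]
    [ConnectedSpace M] [SeparableSpace M] [MetrizableSpace M]
    -- `M` is an `n`-manifold without boundary:
    (hM : ∀ x : M, ∃ U : Set M, IsOpen U ∧ x ∈ U ∧
      ∃ V : Set (Fin n → ℝ), IsOpen V ∧ Nonempty (↥U ≃ₜ ↥V))
    (X : Set M) (hX : IsClosed X)
    -- `μ` is a good Radon measure on `M`: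
    (μ : Measure M) [IsFiniteMeasureOnCompacts μ]
    (hatom : ∀ p : M, μ {p} = 0)
    (hpos : ∀ U : Set M, IsOpen U → U.Nonempty → 0 < μ U) :
    IsL2Manifold ↥(MPHomeoFixSet M X μ) ↔
      IsANR ↥(MPHomeoFixSet M X μ) ∧ X ≠ Set.univ := by
  constructor
  · intro h
    refine ⟨h.isANR, ?_⟩
    rintro rfl
    have := subsingleton_mpHomeoFixSet_univ μ
    have : Nonempty (MPHomeoFixSet M Set.univ μ) := ⟨⟨_, id_mem_mpHomeoFixSet Set.univ μ⟩⟩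
    exact not_isL2Manifold_of_subsingleton h
  · rintro ⟨hANR, hne⟩
    have hψ : ∀ x : M, ∃ ψ : OpenPartialHomeomorph M (Fin n → ℝ), x ∈ ψ.source := fun x => by
      obtain ⟨U, hU, hx, V, hV, ⟨e⟩⟩ := hM x
      exact exists_openPartialHomeomorph hU hx hV e
    choose ψ hψ using hψ
    let _ : ChartedSpace (Fin n → ℝ) M := ⟨Set.univ, ψ, hψ, fun _ => Set.mem_univ _⟩
    have := ChartedSpace.locallyCompactSpace (Fin n → ℝ) M
    have := ChartedSpace.locallyConnectedSpace (Fin n → ℝ) M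
    have : SecondCountableTopology M :=
      let _ := metrizableSpaceMetric M
      UniformSpace.secondCountable_of_separable M
    have : PolishSpace (MPHomeoFixSet M X μ) := mpHomeoFixSet_polishSpace
    obtain ⟨x, hx⟩ := (Set.ne_univ_iff_exists_notMem X).1 hne
    have : Nonempty (Fin n) := ⟨⟨0, by omega⟩⟩
    let χ := (ψ x).restrOpen Xᶜ hX.isOpen_compl
    have hχ : x ∈ χ.source := by
      rw [OpenPartialHomeomorph.restrOpen_source]
      exact ⟨hψ x, hx⟩
    obtain ⟨φ, c, hsource, htarget, hφ⟩ := OxtobyUlam.exists_chart (μ := μ) (ψ := χ) hatom hpos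
      ⟨χ x, χ.map_source hχ⟩
    obtain ⟨Ω, hΩ, hΩne, S, ⟨e⟩⟩ := ChartTwist.exists_ball_factor (X := X) (μ := μ) (φ := φ) (c := c)
      (i := (⟨0, by omega⟩ : Fin n)) (j := ⟨1, by omega⟩) (by simp) (by
        rw [htarget]
        intro y hy
        have hy : ∑ k, y k ^ 2 ≤ 1 := hy
        refine (dist_pi_lt_iff two_pos).2 fun k => ?_
        rw [Pi.zero_apply, Real.dist_eq, sub_zero]
        have : y k ^ 2 ≤ 1 := (Finset.single_le_sum (f := fun k => y k ^ 2)
          (fun j _ => sq_nonneg (y j)) (Finset.mem_univ k)).trans hy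
        exact ((sq_le_one_iff_abs_le_one _).1 this).trans_lt one_lt_two) (by
        refine Set.disjoint_left.2 fun z hz hzX => ?_
        have := hsource hz
        rw [OpenPartialHomeomorph.restrOpen_source] at this
        exact this.2 hzX) hφ
    exact isL2Manifold_of_isANR_of_ball_factor hANR exists_homeomorph_mpHomeoFixSet hΩ hΩne e
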